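/- arXiv:1307.0439 — 3 statements merged into one kernel-verified Lean document; each statement's English description precedes it below -/
import Mathlib

section
/- (Carathéodory) If G is a Jordan domain in ℂ and φ is a Riemann map of G, then φ extends to a homeomorphism from closure(G) onto the closed unit disk. -/
open Set Topology Metric Filter

/-- A simply connected domain in `ℂ`: a nonempty open connected proper subset of `ℂ`
that is simply connected. -/
def IsSCDomain (G : Set ℂ) : Prop :=
  IsOpen G ∧ IsConnected G ∧ G ≠ Set.univ ∧ SimplyConnectedSpace G

/-- `J` is a Jordan arc with parametrization `f` on `[0,1]`. -/
def IsJordanArcParam (J : Set ℂ) (f : ℝ → ℂ) : Prop :=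
  ContinuousOn f (Set.Icc 0 1) ∧ Set.InjOn f (Set.Icc 0 1) ∧ J = f '' Set.Icc 0 1

/-- `J` is a Jordan arc: the image of an injective continuous map on `[0,1]`. -/
def IsJordanArc (J : Set ℂ) : Prop := ∃ f, IsJordanArcParam J f

/-- A crosscut of `G`: a Jordan arc whose two endpoints lie in `∂G` and which,
apart from its endpoints, is contained in `G`. -/
def IsCrosscut (G J : Set ℂ) : Prop :=
  ∃ f, IsJordanArcParam J f ∧ f 0 ∈ frontier G ∧ f 1 ∈ frontier G ∧
    J \ {f 0, f 1} ⊆ G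

/-- A domain: a nonempty open connected set. -/
def IsPlanarDomain (U : Set ℂ) : Prop := IsOpen U ∧ IsConnected U

/-- The set of accessible boundary points of `G`. -/
def accessiblePts (G : Set ℂ) : Set ℂ :=
  {b ∈ frontier G | ∃ J, IsJordanArc J ∧ J ⊆ closure G ∧ J ∩ frontier G = {b}}

/-- The set of non-accessible boundary points of `G`. -/
def nonAccessiblePts (G : Set ℂ) : Set ℂ := frontier G \ accessiblePts G

/-- `φ` is a Riemann map of `G`: analytic and injective on `G`, mapping `G` onto the
open unit disk. -/
def IsRiemannMap (G : Set ℂ) (φ : ℂ → ℂ) : Prop :=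
  AnalyticOnNhd ℂ φ G ∧ Set.InjOn φ G ∧ φ '' G = Metric.ball (0:ℂ) 1

/-- `Φ` is a continuous extension of `φ` to the closure of `G`. -/
def IsContExtension (G : Set ℂ) (φ Φ : ℂ → ℂ) : Prop :=
  ContinuousOn Φ (closure G) ∧ Set.EqOn Φ φ G

/-- The crosscut `J` separates `G` into the two disjoint domains `U` and `V`. -/
def IsCrosscutSep (G J U V : Set ℂ) : Prop :=
  IsCrosscut G J ∧ IsPlanarDomain U ∧ IsPlanarDomain V ∧ Disjoint U V ∧ G \ J = U ∪ V

/-- `a` is a multiple boundary point of `G`. -/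
def IsMultiplePt (G : Set ℂ) (a : ℂ) : Prop :=
  a ∈ frontier G ∧ ∃ J U V, IsCrosscutSep G J U V ∧ a ∈ (frontier U ∩ frontier V) \ J

/-- The set of multiple boundary points of `G`. -/
def multiplePts (G : Set ℂ) : Set ℂ := {a | IsMultiplePt G a}

/-- The set of prime boundary points of `G`. -/
def primePts (G : Set ℂ) : Set ℂ := frontier G \ multiplePts G

/-- The set of semi-accessible boundary points of `G`. -/
def semiAccessiblePts (G : Set ℂ) : Set ℂ :=
  {a ∈ frontier G | ∃ J U V, IsCrosscutSep G J U V ∧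
    a ∈ accessiblePts U ∩ nonAccessiblePts V}

/-- The set of multiple accessible boundary points of `G`. -/
def multipleAccessiblePts (G : Set ℂ) : Set ℂ :=
  {a ∈ frontier G | ∃ J U V, IsCrosscutSep G J U V ∧
    a ∈ (accessiblePts U ∩ accessiblePts V) \ J}

/-- The set of multiple unaccessible boundary points of `G`. -/
def multipleUnaccessiblePts (G : Set ℂ) : Set ℂ :=
  {a ∈ frontier G | ∃ J U V, IsCrosscutSep G J U V ∧
    a ∈ (nonAccessiblePts U ∩ nonAccessiblePts V) \ J}

/-- `Γ` is a Jordan curve: a homeomorphic image of the unit circle. -/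
def IsJordanCurve (Γ : Set ℂ) : Prop :=
  ∃ f : ℂ → ℂ, ContinuousOn f (Metric.sphere (0:ℂ) 1) ∧
    Set.InjOn f (Metric.sphere (0:ℂ) 1) ∧ Γ = f '' Metric.sphere (0:ℂ) 1

/-- A Jordan domain: a bounded connected component of the complement of a Jordan curve. -/
def IsJordanDomain (G : Set ℂ) : Prop :=
  Bornology.IsBounded G ∧ ∃ Γ, IsJordanCurve Γ ∧ ∃ x ∈ Γᶜ, G = connectedComponentIn Γᶜ x

/-- A Carathéodory domain: a simply connected domain whose boundary equals the boundary of
the unbounded component of the complement of the boundary. -/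
def IsCaratheodoryDomain (G : Set ℂ) : Prop :=
  IsSCDomain G ∧ ∃ x ∈ (frontier G)ᶜ,
    ¬ Bornology.IsBounded (connectedComponentIn (frontier G)ᶜ x) ∧
    frontier G = frontier (connectedComponentIn (frontier G)ᶜ x)

/-- `g` admits a continuous logarithm on `K`. -/
def HasLogOn (g : ℂ → ℂ) (K : Set ℂ) : Prop :=
  ∃ L : ℂ → ℂ, ContinuousOn L K ∧ ∀ z ∈ K, Complex.exp (L z) = g z

theorem HasLogOn.mono {g : ℂ → ℂ} {K K' : Set ℂ} (h : HasLogOn g K) (hK : K' ⊆ K) :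
    HasLogOn g K' := by
  obtain ⟨L, hL, h⟩ := h
  exact ⟨L, hL.mono hK, fun z hz => h z (hK hz)⟩

/-- A continuous function on a preconnected set whose exponential is `1` is constant. -/
theorem IsPreconnected.exists_eqOn_const_of_exp_eq_one {X : Type*} [TopologicalSpace X]
    {S : Set X} (hS : IsPreconnected S) {f : X → ℂ} (hf : ContinuousOn f S)
    (h : ∀ x ∈ S, Complex.exp (f x) = 1) :
    ∃ c, Complex.exp c = 1 ∧ ∀ x ∈ S, f x = c := by
  let T : AddSubgroup ℂ := AddSubgroup.zmultiples (2 * Real.pi * Complex.I)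
  have hT : IsDiscrete (T : Set ℂ) := ⟨NormedSpace.discreteTopology_zmultiples _⟩
  have hmem : ∀ w : ℂ, w ∈ (T : Set ℂ) ↔ Complex.exp w = 1 := by
    intro w
    rw [Complex.exp_eq_one_iff, SetLike.mem_coe, AddSubgroup.mem_zmultiples_iff]
    simp only [zsmul_eq_mul, eq_comm]
  obtain ⟨c, hc, h⟩ := hS.eqOn_const_of_mapsTo hT hf (fun x hx => (hmem _).2 (h x hx))
    ⟨0, T.zero_mem⟩
  exact ⟨c, (hmem c).1 hc, h⟩

theorem HasLogOn.union {g : ℂ → ℂ} {K K' : Set ℂ} (h : HasLogOn g K) (h' : HasLogOn g K')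
    (hK : IsClosed K) (hK' : IsClosed K') (hc : IsPreconnected (K ∩ K')) :
    HasLogOn g (K ∪ K') := by
  classical
  obtain ⟨L, hL, h⟩ := h
  obtain ⟨L', hL', h'⟩ := h'
  obtain ⟨c, hc, hcL⟩ := hc.exists_eqOn_const_of_exp_eq_one (f := fun z => L z - L' z)
    ((hL.mono inter_subset_left).sub (hL'.mono inter_subset_right))
    (fun z hz => by rw [Complex.exp_sub, h z hz.1, h' z hz.2, div_self]
                    rw [← h z hz.1]; exact Complex.exp_ne_zero _)
  have e1 : EqOn (K.piecewise L (fun z => L' z + c)) L K := fun z hz => by simp [hz]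
  have e2 : EqOn (K.piecewise L (fun z => L' z + c)) (fun z => L' z + c) K' := by
    intro z hz
    by_cases hzK : z ∈ K
    · have := hcL z ⟨hzK, hz⟩
      simp [hzK, ← this]
    · simp [hzK]
  refine ⟨K.piecewise L (fun z => L' z + c), ?_, ?_⟩
  · exact (hL.congr e1).union_of_isClosed ((hL'.add continuousOn_const).congr e2) hK hK'
  · rintro z (hz | hz)
    · rw [e1 hz, h z hz]
    · rw [e2 hz, Complex.exp_add, hc, h' z hz, mul_one]

/-- The ratio `(z - x) / (z - y)` has a continuous logarithm on any set of points closer to `c` than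
both `x` and `y`. -/
theorem hasLogOn_div_of_subset_ball {c x y : ℂ} {K : Set ℂ}
    (hx : ∀ z ∈ K, dist z c < dist x c) (hy : ∀ z ∈ K, dist z c < dist y c) :
    HasLogOn (fun z => (z - x) / (z - y)) K := by
  have key : ∀ x : ℂ, (∀ z ∈ K, dist z c < dist x c) → HasLogOn (fun z => z - x) K := by
    intro x hx
    rcases K.eq_empty_or_nonempty with rfl | ⟨z0, hz0⟩
    · exact ⟨0, continuousOn_empty _, by simp⟩
    have hxc : c - x ≠ 0 := by
      intro h
      have := hx z0 hz0
      rw [sub_eq_zero.1 h, dist_self] at this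
      exact absurd this (not_lt.2 dist_nonneg)
    have hslit : ∀ z ∈ K, (1 + (z - c) / (c - x)) ∈ Complex.slitPlane := by
      intro z hz
      apply Complex.mem_slitPlane_of_norm_lt_one
      rw [norm_div, div_lt_one (norm_pos_iff.2 hxc)]
      have := hx z hz
      rwa [dist_eq_norm, dist_comm, dist_eq_norm] at this
    refine ⟨fun z => Complex.log (1 + (z - c) / (c - x)) + Complex.log (c - x), ?_, ?_⟩
    · exact (ContinuousOn.clog (by fun_prop) hslit).add continuousOn_const
    · intro z hz
      rw [Complex.exp_add, Complex.exp_log (Complex.slitPlane_ne_zero (hslit z hz)),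
        Complex.exp_log hxc]
      field_simp
      ring
  obtain ⟨L, hL, h⟩ := key x hx
  obtain ⟨L', hL', h'⟩ := key y hy
  exact ⟨fun z => L z - L' z, hL.sub hL', fun z hz => by rw [Complex.exp_sub, h z hz, h' z hz]⟩

/-- If `x` and `y` lie in a preconnected set disjoint from the closed set `K`, then
`(z - x) / (z - y)` has a continuous logarithm on `K`. -/
theorem hasLogOn_div_of_isPreconnected {K S : Set ℂ} (hK : IsClosed K) (hS : IsPreconnected S)
    (hSK : Disjoint S K) {x y : ℂ} (hx : x ∈ S) (hy : y ∈ S) :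
    HasLogOn (fun z => (z - x) / (z - y)) K := by
  have hne : ∀ x ∈ S, ∀ z ∈ K, z - x ≠ 0 := fun x hx z hz h =>
    disjoint_left.1 hSK hx (sub_eq_zero.1 h ▸ hz)
  have hsymm : ∀ x y, HasLogOn (fun z => (z - x) / (z - y)) K →
      HasLogOn (fun z => (z - y) / (z - x)) K := by
    rintro x y ⟨L, hL, h⟩
    exact ⟨fun z => - L z, hL.neg, fun z hz => by rw [Complex.exp_neg, h z hz, inv_div]⟩
  refine hS.induction₂ (fun x y => HasLogOn (fun z => (z - x) / (z - y)) K) ?_ ?_ ?_ hx hy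
  · intro x hx
    apply eventually_nhdsWithin_of_eventually_nhds
    obtain ⟨r, hr, hb⟩ := Metric.isOpen_iff.1 hK.isOpen_compl x (disjoint_left.1 hSK hx)
    filter_upwards [Metric.ball_mem_nhds x hr] with y hy
    have hslit : ∀ z ∈ K, (1 + (x - y) / (z - x)) ∈ Complex.slitPlane := by
      intro z hz
      apply Complex.mem_slitPlane_of_norm_lt_one
      rw [norm_div, div_lt_one (norm_pos_iff.2 (hne x hx z hz)), ← dist_eq_norm, ← dist_eq_norm,
        dist_comm]
      refine lt_of_lt_of_le hy (not_lt.1 fun h => hb h hz)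
    apply hsymm
    refine ⟨fun z => Complex.log (1 + (x - y) / (z - x)), ?_, ?_⟩
    · refine ContinuousOn.clog ?_ hslit
      exact continuousOn_const.add (continuousOn_const.div (by fun_prop) (hne x hx))
    · intro z hz
      rw [Complex.exp_log (Complex.slitPlane_ne_zero (hslit z hz))]
      have := hne x hx z hz
      field_simp
      ring
  · rintro x y w hx hy hw ⟨L, hL, h⟩ ⟨L', hL', h'⟩
    refine ⟨fun z => L z + L' z, hL.add hL', fun z hz => ?_⟩
    rw [Complex.exp_add, h z hz, h' z hz]
    have := hne y hy z hz
    field_simp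
  · exact fun x y _ _ h => hsymm x y h

/-- There is no nonvanishing continuous function on the plane that equals `z - y` near infinity. -/
theorem not_continuous_eq_sub_of_le_dist {h : ℂ → ℂ} (hc : Continuous h) (h0 : ∀ z, h z ≠ 0)
    {y : ℂ} {R : ℝ} (hR : 0 < R) (hh : ∀ z, R ≤ dist z y → h z = z - y) : False := by
  obtain ⟨L, hL, hexp⟩ := Complex.exists_continuousOn_eqOn_exp_comp (U := (univ : Set ℂ))
    (@SimplyConnectedSpace.ofContractible _ _
      (convex_univ.contractibleSpace univ_nonempty)) isOpen_univ hc.continuousOn (by simpa using h0)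
  rw [continuousOn_univ] at hL
  have hR' : (R : ℂ) ≠ 0 := by exact_mod_cast hR.ne'
  have hz : ∀ θ : ℝ, h (y + R * Complex.exp (θ * Complex.I)) = R * Complex.exp (θ * Complex.I) := by
    intro θ
    rw [hh, add_sub_cancel_left]
    rw [dist_eq_norm, add_sub_cancel_left, norm_mul, Complex.norm_exp_ofReal_mul_I]
    simp [abs_of_pos hR]
  obtain ⟨c, -, hcst⟩ := (isPreconnected_univ (α := ℝ)).exists_eqOn_const_of_exp_eq_one
    (f := fun θ : ℝ => L (y + R * Complex.exp (θ * Complex.I)) - θ * Complex.I - Complex.log R)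
    (by fun_prop) (by
      intro θ _
      have := hexp (mem_univ (y + R * Complex.exp (θ * Complex.I)))
      rw [Function.comp_apply, hz] at this
      rw [Complex.exp_sub, Complex.exp_sub, this, Complex.exp_log hR']
      field_simp [Complex.exp_ne_zero])
  have e0 := hcst 0 (mem_univ _)
  have e1 := hcst (2 * Real.pi) (mem_univ _)
  have : Complex.exp ((2 * Real.pi : ℝ) * Complex.I) = 1 := by
    push_cast; exact Complex.exp_two_pi_mul_I
  rw [← e1, this] at e0
  simp at e0
  exact Complex.two_pi_I_ne_zero (by linear_combination e0)

theorem ContinuousOn.exists_continuous_extension {E : Set ℂ} (hE : IsClosed E) {L : ℂ → ℂ}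
    (hL : ContinuousOn L E) : ∃ M : ℂ → ℂ, Continuous M ∧ EqOn M L E := by
  obtain ⟨M, hM⟩ := ContinuousMap.exists_restrict_eq hE
    ⟨E.domRestrict L, continuousOn_iff_continuous_domRestrict.1 hL⟩
  exact ⟨M, M.continuous, fun z hz => DFunLike.congr_fun hM ⟨z, hz⟩⟩

/-- If `U` is a bounded set with `y ∈ U` and `x ∉ closure U`, then `(z - x) / (z - y)` has no continuous
logarithm on the frontier of `U`. -/
theorem not_hasLogOn_frontier {U : Set ℂ} (hU : Bornology.IsBounded U) {x y : ℂ}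
    (hy : y ∈ U) (hx : x ∉ closure U) :
    ¬ HasLogOn (fun z => (z - x) / (z - y)) (frontier U) := by
  classical
  rintro ⟨L, hL, hexp⟩
  obtain ⟨M, hM, hML⟩ := hL.exists_continuous_extension isClosed_frontier
  obtain ⟨R, hR⟩ := hU.closure.subset_ball y
  have hyc := subset_closure hy
  have hRpos : 0 < R := by simpa using (Metric.nonempty_ball.1 ⟨y, hR hyc⟩)
  refine not_continuous_eq_sub_of_le_dist (y := y) (R := R)
    (h := (closure U).piecewise (fun z => (z - x) * Complex.exp (- M z)) (fun z => z - y))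
    ?_ ?_ hRpos ?_
  · refine Continuous.piecewise ?_ (by fun_prop) (by fun_prop)
    intro z hz
    have hz := frontier_closure_subset hz
    have h1 : Complex.exp (L z) = (z - x) / (z - y) := hexp z hz
    have h2 : (z - x) / (z - y) ≠ 0 := h1.symm.trans_ne (Complex.exp_ne_zero _)
    have h3 : z - y ≠ 0 := fun h => h2 (by rw [h, div_zero])
    have h4 : z - x ≠ 0 := fun h => h2 (by rw [h, zero_div])
    rw [Complex.exp_neg, hML hz, h1]
    field_simp
  · intro z
    by_cases hz : z ∈ closure U
    · simp only [hz, piecewise_eq_of_mem]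
      exact mul_ne_zero (sub_ne_zero.2 fun h => hx (h ▸ hz)) (Complex.exp_ne_zero _)
    · simp only [hz, not_false_eq_true, piecewise_eq_of_notMem]
      exact sub_ne_zero.2 fun h => hz (h ▸ hyc)
  · intro z hz
    have : z ∉ closure U := fun h => absurd (hR h) (by simpa using hz)
    simp [this]

/-- A form of Janiszewski's theorem: let `G` be a bounded domain whose frontier lies in the closed set
`Γ` and let `K` be a closed set meeting `Γ` in a preconnected set. If `G \ K` is covered by the
disjoint open sets `U` and `V`, then `K` separates the points of `U` from those of `V`. -/
theorem not_hasLogOn_of_separation {G Γ K U V : Set ℂ} (hGb : Bornology.IsBounded G)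
    (hG : IsPreconnected G) (hfr : frontier G ⊆ Γ) (hdisj : Disjoint G Γ) (hΓ : IsClosed Γ)
    (hK : IsClosed K) (hKΓ : IsPreconnected (K ∩ Γ)) (hU : IsOpen U) (hV : IsOpen V)
    (hUV : Disjoint U V) (hUG : U ⊆ G) (hVG : V ⊆ G) (hcov : G ⊆ U ∪ V ∪ K) {x y : ℂ}
    (hy : y ∈ U) (hx : x ∈ V) : ¬ HasLogOn (fun z => (z - x) / (z - y)) K := by
  intro h
  have hxU : closure U ⊆ Vᶜ := closure_minimal (disjoint_left.1 hUV) hV.isClosed_compl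
  have h' := hasLogOn_div_of_isPreconnected hΓ hG hdisj (hVG hx) (hUG hy)
  refine not_hasLogOn_frontier (hGb.subset hUG) hy (fun h => hxU h hx)
    ((h.union h' hK hΓ hKΓ).mono ?_)
  intro z hz
  have hzU : z ∉ U := hU.frontier_eq ▸ hz |>.2
  have hzV : z ∉ V := hxU hz.1
  by_cases hzG : z ∈ G
  · rcases hcov hzG with (h | h) | h
    · exact absurd h hzU
    · exact absurd h hzV
    · exact Or.inl h
  · exact Or.inr (hfr ⟨closure_mono hUG hz.1, fun h => hzG (interior_subset h)⟩)

theorem IsJordanCurve.isCompact {Γ : Set ℂ} (h : IsJordanCurve Γ) : IsCompact Γ := by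
  obtain ⟨f, hf, -, rfl⟩ := h
  exact (isCompact_sphere 0 1).image_of_continuousOn hf

/-- A Jordan curve is uniformly locally connected. -/
theorem IsJordanCurve.exists_small_isPreconnected {Γ : Set ℂ} (h : IsJordanCurve Γ) {ε : ℝ}
    (hε : 0 < ε) : ∃ δ > 0, ∀ a ∈ Γ, ∀ b ∈ Γ, dist a b < δ →
      ∃ A ⊆ Γ, IsCompact A ∧ IsPreconnected A ∧ a ∈ A ∧ b ∈ A ∧ ∀ z ∈ A, dist z a < ε := by
  obtain ⟨f, hf, hinj, rfl⟩ := h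
  have hcpt := isCompact_sphere (0 : ℂ) 1
  obtain ⟨η, hη, hfη⟩ := Metric.uniformContinuousOn_iff.1
    (hcpt.uniformContinuousOn_of_continuous hf) ε hε
  obtain ⟨η', hη', harg⟩ := Metric.continuousAt_iff.1
    (Complex.continuousAt_arg (x := 1) (by simp)) η hη
  obtain ⟨δ, hδ, hδf⟩ : ∃ δ > 0, ∀ s ∈ sphere (0 : ℂ) 1, ∀ t ∈ sphere (0 : ℂ) 1,
      dist (f s) (f t) < δ → dist s t < η' := by
    let P : Set (ℂ × ℂ) := (sphere (0 : ℂ) 1 ×ˢ sphere (0 : ℂ) 1) ∩ {q | η' ≤ dist q.1 q.2}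
    have hP : IsCompact P := (hcpt.prod hcpt).inter_right
      (isClosed_le continuous_const continuous_dist)
    rcases P.eq_empty_or_nonempty with hPe | hPn
    · refine ⟨1, one_pos, fun s hs t ht _ => ?_⟩
      by_contra! hst
      have : (s, t) ∈ P := ⟨⟨hs, ht⟩, hst⟩
      simp [hPe] at this
    · have hcont : ContinuousOn (fun q : ℂ × ℂ => dist (f q.1) (f q.2)) P :=
        continuous_dist.comp_continuousOn
          ((hf.comp (f := Prod.fst) (s := P) continuousOn_fst fun q hq => hq.1.1).prodMk
          (hf.comp (f := Prod.snd) (s := P) continuousOn_snd fun q hq => hq.1.2))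
      obtain ⟨q, hq, hmin⟩ := hP.exists_isMinOn hPn hcont
      refine ⟨dist (f q.1) (f q.2), dist_pos.2 fun he => ?_, fun s hs t ht hst => ?_⟩
      · have := hq.2
        rw [mem_ofPred_eq, hinj hq.1.1 hq.1.2 he, dist_self] at this
        linarith
      · by_contra! hle
        have : dist (f q.1) (f q.2) ≤ dist (f s) (f t) :=
          hmin (a := (s, t)) ⟨⟨hs, ht⟩, hle⟩
        linarith
  refine ⟨δ, hδ, ?_⟩
  rintro _ ⟨s, hs, rfl⟩ _ ⟨t, ht, rfl⟩ hst
  have hs1 : ‖s‖ = 1 := by simpa using hs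
  have ht1 : ‖t‖ = 1 := by simpa using ht
  have hs0 : s ≠ 0 := by rintro rfl; simp at hs1
  have hm : dist (t / s) 1 < η' := by
    have : t / s - 1 = (t - s) / s := by field_simp
    rw [dist_eq_norm, this, norm_div, hs1, div_one, ← dist_eq_norm, dist_comm]
    exact hδf s hs t ht hst
  have hθ : |(t / s).arg| < η := by simpa [Real.dist_eq] using harg hm
  let γ : ℝ → ℂ := fun u => s * Complex.exp (u * Complex.I)
  have hγ : Continuous γ := by fun_prop
  have hγs : ∀ u, γ u ∈ sphere (0 : ℂ) 1 := by
    intro u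
    simp [γ, hs1, Complex.norm_exp_ofReal_mul_I]
  have hγc : ContinuousOn (f ∘ γ) (uIcc 0 (t / s).arg) :=
    hf.comp hγ.continuousOn fun u _ => hγs u
  refine ⟨(f ∘ γ) '' uIcc 0 (t / s).arg, ?_, isCompact_uIcc.image_of_continuousOn hγc,
    isPreconnected_uIcc.image _ hγc, ⟨0, left_mem_uIcc, by simp [γ]⟩,
    ⟨_, right_mem_uIcc, ?_⟩, ?_⟩
  · rintro _ ⟨u, -, rfl⟩
    exact ⟨_, hγs u, rfl⟩
  · have := Complex.norm_mul_exp_arg_mul_I (t / s)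
    rw [norm_div, hs1, ht1, div_one, Complex.ofReal_one, one_mul] at this
    simp only [Function.comp_apply, γ, this]
    rw [mul_div_cancel₀ _ hs0]
  · rintro _ ⟨u, hu, rfl⟩
    refine hfη _ (hγs u) s hs ?_
    have h1 : γ u - s = s * (Complex.exp (Complex.I * u) - 1) := by simp only [γ]; ring_nf
    rw [dist_eq_norm, h1, norm_mul, hs1, one_mul]
    refine lt_of_le_of_lt (Real.norm_exp_I_mul_ofReal_sub_one_le) ?_
    have := abs_sub_left_of_mem_uIcc hu
    simp only [sub_zero] at this
    exact lt_of_le_of_lt this hθ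

theorem isPreconnected_sphere_diff_singleton {s : ℂ} (hs : s ∈ sphere (0 : ℂ) 1) :
    IsPreconnected (sphere (0 : ℂ) 1 \ {s}) := by
  have hs1 : ‖s‖ = 1 := by simpa using hs
  have hs0 : s ≠ 0 := by rintro rfl; simp at hs1
  have : sphere (0 : ℂ) 1 \ {s} =
      (fun u : ℝ => s * Complex.exp (u * Complex.I)) '' Ioo 0 (2 * Real.pi) := by
    ext t
    constructor
    · rintro ⟨ht, hts⟩
      have ht1 : ‖t‖ = 1 := by simpa using ht
      have := Complex.norm_mul_exp_arg_mul_I (-(t / s))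
      rw [norm_neg, norm_div, hs1, ht1, div_one, Complex.ofReal_one, one_mul] at this
      have hne : (-(t / s)).arg ≠ Real.pi := by
        intro h
        rw [h, Complex.exp_pi_mul_I, neg_inj, eq_comm, div_eq_one_iff_eq hs0] at this
        exact hts this
      refine ⟨(-(t / s)).arg + Real.pi, ⟨?_, ?_⟩, ?_⟩
      · linarith [Complex.neg_pi_lt_arg (-(t / s))]
      · linarith [lt_of_le_of_ne (Complex.arg_le_pi (-(t / s))) hne]
      · simp only [Complex.ofReal_add, add_mul, Complex.exp_add, this, Complex.exp_pi_mul_I]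
        field_simp
    · rintro ⟨u, hu, rfl⟩
      refine ⟨by simp [hs1, Complex.norm_exp_ofReal_mul_I], fun h => ?_⟩
      have h1 : Complex.exp (u * Complex.I) = 1 := mul_left_cancel₀ hs0 (by simpa using h)
      obtain ⟨n, hn⟩ := Complex.exp_eq_one_iff.1 h1
      have hn' : u = n * (2 * Real.pi) := by
        have := congrArg Complex.im hn
        simpa using this
      have hpi := Real.two_pi_pos
      have h0 : (0 : ℝ) < n := by
        by_contra! h; nlinarith [hu.1]
      have h1 : (n : ℝ) < 1 := by
        by_contra! h; nlinarith [hu.2]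
      have : (0 : ℤ) < n := by exact_mod_cast h0
      have : n < (1 : ℤ) := by exact_mod_cast h1
      omega
  rw [this]
  exact isPreconnected_Ioo.image _ (by fun_prop)

theorem IsJordanCurve.isPreconnected_diff_singleton {Γ : Set ℂ} (h : IsJordanCurve Γ) {p : ℂ}
    (hp : p ∈ Γ) : IsPreconnected (Γ \ {p}) := by
  obtain ⟨f, hf, hinj, rfl⟩ := h
  obtain ⟨s, hs, rfl⟩ := hp
  rw [← image_singleton, ← hinj.image_sdiff_subset (by simpa using hs)]
  exact (isPreconnected_sphere_diff_singleton hs).image _ (hf.mono sdiff_subset)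

theorem frontier_connectedComponentIn_subset {X : Type*} [TopologicalSpace X]
    [LocallyConnectedSpace X] {F : Set X} (hF : IsOpen F) (x : X) :
    frontier (connectedComponentIn F x) ⊆ Fᶜ := by
  intro z hz hzF
  rw [hF.connectedComponentIn.frontier_eq] at hz
  obtain ⟨w, hw, hw'⟩ := mem_closure_iff.1 hz.1 _ (hF.connectedComponentIn (x := z))
    (mem_connectedComponentIn hzF)
  apply hz.2
  rw [connectedComponentIn_eq hw', ← connectedComponentIn_eq hw]
  exact mem_connectedComponentIn hzF

/-- The inverse of an injective holomorphic function is holomorphic. -/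
theorem AnalyticOnNhd.differentiableAt_of_leftInvOn {G : Set ℂ} {φ ψ : ℂ → ℂ} (hG : IsOpen G)
    (hφ : AnalyticOnNhd ℂ φ G) (hψ : LeftInvOn ψ φ G) {z : ℂ} (hz : z ∈ G) :
    DifferentiableAt ℂ ψ (φ z) := by
  have hconst : ∀ z ∈ G, ¬ ∀ᶠ w in 𝓝 z, φ w = φ z := by
    intro z hz h
    have : ∀ᶠ w in 𝓝[≠] z, False := by
      filter_upwards [nhdsWithin_le_nhds h, nhdsWithin_le_nhds (hG.mem_nhds hz),
        self_mem_nhdsWithin] with w hw hwG hwz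
      exact hwz (hψ.injOn hwG hz hw)
    obtain ⟨_, h⟩ := this.exists
    exact h
  have hnhds : ∀ z ∈ G, 𝓝 (φ z) ≤ map φ (𝓝 z) := fun z hz =>
    (hφ z hz).eventually_constant_or_nhds_le_map_nhds.resolve_left (hconst z hz)
  have htend : ∀ z ∈ G, Tendsto ψ (𝓝 (φ z)) (𝓝 z) := by
    intro z hz
    refine Tendsto.mono_left ?_ (hnhds z hz)
    rw [tendsto_map'_iff]
    refine tendsto_id.congr' ?_
    filter_upwards [hG.mem_nhds hz] with w hw using (hψ hw).symm
  have hcont : ∀ z ∈ G, ContinuousAt ψ (φ z) := by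
    intro z hz
    rw [ContinuousAt, hψ hz]
    exact htend z hz
  have hright : ∀ z ∈ G, ∀ᶠ w in 𝓝 (φ z), ψ w ∈ G ∧ φ (ψ w) = w := by
    intro z hz
    apply hnhds z hz
    rw [mem_map]
    filter_upwards [hG.mem_nhds hz] with w hw
    simp [hψ hw, hw]
  have hderiv : ∀ᶠ w in 𝓝[≠] z, deriv φ w ≠ 0 := by
    refine (hφ z hz).deriv.eventually_eq_zero_or_eventually_ne_zero.resolve_left fun h => ?_
    obtain ⟨r, hr, hb⟩ := Metric.eventually_nhds_iff_ball.1 (h.and (hG.mem_nhds hz))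
    refine hconst z hz ?_
    filter_upwards [Metric.ball_mem_nhds z hr] with w hw
    exact isOpen_ball.is_const_of_deriv_eq_zero (convex_ball z r).isPreconnected
      (fun u hu => (hφ u (hb u hu).2).differentiableAt.differentiableWithinAt)
      (fun u hu => (hb u hu).1) hw (mem_ball_self hr)
  refine (Complex.analyticAt_of_differentiable_on_punctured_nhds_of_continuousAt ?_
    (hcont z hz)).differentiableAt
  rw [eventually_nhdsWithin_iff] at hderiv ⊢
  filter_upwards [(htend z hz).eventually hderiv, hright z hz] with w hw hwG hne
  have h1 : deriv φ (ψ w) ≠ 0 := hw fun h => hne (by rw [← hwG.2, mem_singleton_iff.1 h]; rfl)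
  have h2 := hcont _ hwG.1
  have h3 := hright _ hwG.1
  rw [hwG.2] at h2 h3
  exact (HasDerivAt.of_local_left_inverse h2 (hφ _ hwG.1).differentiableAt.hasDerivAt h1
    (h3.mono fun _ h => h.2)).differentiableAt

section LengthArea

open MeasureTheory

/-- The area of the image of an injective holomorphic function. -/
theorem lintegral_enorm_deriv_sq_eq_volume_image {S : Set ℂ} {F : ℂ → ℂ} (hS : IsOpen S)
    (hF : DifferentiableOn ℂ F S) (hinj : InjOn F S) :
    ∫⁻ z in S, ‖deriv F z‖ₑ ^ 2 = volume (F '' S) := by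
  rw [← lintegral_abs_det_fderiv_eq_addHaar_image volume hS.measurableSet
    (f' := fun z => (ContinuousLinearMap.toSpanSingleton ℂ (deriv F z)).restrictScalars ℝ)
    (fun z hz => ((hF.differentiableAt (hS.mem_nhds hz)).hasDerivAt.hasFDerivAt.restrictScalars
      ℝ).hasFDerivWithinAt) hinj]
  congr 1
  ext z
  have : |((ContinuousLinearMap.toSpanSingleton ℂ (deriv F z)).restrictScalars ℝ).det|
      = ‖deriv F z‖ ^ 2 := by
    simp [ContinuousLinearMap.det, LinearMap.det_restrictScalars, Algebra.norm_complex_apply,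
      Complex.normSq_eq_norm_sq]
  rw [this, ENNReal.ofReal_pow (norm_nonneg _), ofReal_norm]

theorem exists_vertical_lintegral_enorm_deriv_le {F : ℂ → ℂ} {b : ℝ} (hb : 0 < b)
    (hF : DifferentiableOn ℂ F {s | s.im ∈ Ioo (-b) b}) (hinj : InjOn F {s | s.im ∈ Ioo (-b) b})
    (hbdd : Bornology.IsBounded (F '' {s | s.im ∈ Ioo (-b) b})) {δ : ℝ} (hδ : 0 < δ) (X : ℝ) :
    ∃ x < X, ∫⁻ y in Ioo (-b) b, ‖deriv F (x + y * Complex.I)‖ₑ ≤ ENNReal.ofReal δ := by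
  set S : Set ℂ := {s | s.im ∈ Ioo (-b) b} with hSdef
  have hS : IsOpen S := isOpen_Ioo.preimage Complex.continuous_im
  set g : ℝ → ENNReal := fun x => ∫⁻ y in Ioo (-b) b, ‖deriv F (x + y * Complex.I)‖ₑ ^ 2 with hg
  have hmeas : Measurable (deriv F) := measurable_deriv F
  have hgm : ∫⁻ x, g x < ⊤ := by
    have h1 : ∫⁻ z in S, ‖deriv F z‖ₑ ^ 2 < ⊤ := by
      rw [lintegral_enorm_deriv_sq_eq_volume_image hS hF hinj]
      exact hbdd.measure_lt_top
    have hSm : S = Complex.measurableEquivRealProd ⁻¹' (univ ×ˢ Ioo (-b) b) := by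
      ext z; simp [hSdef, Complex.measurableEquivRealProd_apply]
    have h2 : ∫⁻ z in S, ‖deriv F z‖ₑ ^ 2 = ∫⁻ q in univ ×ˢ Ioo (-b) b,
        ‖deriv F ((q : ℝ × ℝ).1 + q.2 * Complex.I)‖ₑ ^ 2 := by
      rw [← Complex.volume_preserving_equiv_real_prod.setLIntegral_comp_preimage
        (MeasurableSet.univ.prod measurableSet_Ioo) (by fun_prop), ← hSm]
      simp [Complex.measurableEquivRealProd_apply, Complex.re_add_im]
    rw [h2, Measure.volume_eq_prod, ← Measure.prod_restrict, Measure.restrict_univ,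
      lintegral_prod _ (by fun_prop)] at h1
    exact h1
  obtain ⟨l, hl, hlδ⟩ : ∃ l : ℝ, 0 < l ∧ (2 * b + 1) * l = δ :=
    ⟨δ / (2 * b + 1), by positivity, by field_simp⟩
  obtain ⟨x, hx, hxg⟩ : ∃ x < X, g x ≤ ENNReal.ofReal l ^ 2 := by
    by_contra! hcon
    have : ∫⁻ x in Iio X, ENNReal.ofReal l ^ 2 ≤ ∫⁻ x, g x :=
      (setLIntegral_mono' measurableSet_Iio fun x hx => (hcon x hx).le).trans
        (setLIntegral_le_lintegral _ _)
    rw [setLIntegral_const, Real.volume_Iio, ENNReal.mul_top] at this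
    · exact absurd hgm (not_lt.2 this)
    · simpa using hl
  refine ⟨x, hx, ?_⟩
  have hl0 : ENNReal.ofReal l ≠ 0 := by simpa using hl
  have key : ∀ a m : ENNReal, a * m ≤ m ^ 2 + a ^ 2 := by
    intro a m
    rcases le_total a m with h | h
    · exact le_add_right (by rw [sq]; gcongr)
    · exact le_add_left (by rw [sq]; gcongr)
  have h3 : (∫⁻ y in Ioo (-b) b, ‖deriv F (x + y * Complex.I)‖ₑ) * ENNReal.ofReal l
      ≤ ENNReal.ofReal δ * ENNReal.ofReal l := by
    rw [← lintegral_mul_const _ (by fun_prop)]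
    calc _ ≤ ∫⁻ y in Ioo (-b) b,
          (ENNReal.ofReal l ^ 2 + ‖deriv F (x + y * Complex.I)‖ₑ ^ 2) :=
          lintegral_mono fun y => key _ _
      _ = ENNReal.ofReal l ^ 2 * ENNReal.ofReal (2 * b) + g x := by
          rw [lintegral_add_left (by fun_prop), setLIntegral_const, Real.volume_Ioo]
          congr 3; ring
      _ ≤ ENNReal.ofReal l ^ 2 * ENNReal.ofReal (2 * b) + ENNReal.ofReal l ^ 2 := by gcongr
      _ = ENNReal.ofReal δ * ENNReal.ofReal l := by
          rw [← hlδ, ENNReal.ofReal_mul (p := 2 * b + 1) (by positivity), ENNReal.ofReal_add (by positivity)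
            one_pos.le, ENNReal.ofReal_one]
          ring
  exact (ENNReal.mul_le_mul_iff_left hl0 ENNReal.ofReal_ne_top).1 h3

/-- **Length–area principle**: an injective holomorphic function with bounded image on a horizontal
strip maps some vertical segment arbitrarily far to the left onto a curve of small diameter that
extends continuously to the end points. -/
theorem exists_vertical_continuousOn_extension {F : ℂ → ℂ} {b : ℝ} (hb : 0 < b)
    (hF : DifferentiableOn ℂ F {s | s.im ∈ Ioo (-b) b}) (hinj : InjOn F {s | s.im ∈ Ioo (-b) b})
    (hbdd : Bornology.IsBounded (F '' {s | s.im ∈ Ioo (-b) b})) {δ : ℝ} (hδ : 0 < δ) (X : ℝ) :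
    ∃ x < X, ∃ g : ℝ → ℂ, ContinuousOn g (Icc (-b) b) ∧
      (∀ y ∈ Ioo (-b) b, g y = F (x + y * Complex.I)) ∧
      ∀ y ∈ Icc (-b) b, ∀ y' ∈ Icc (-b) b, dist (g y) (g y') ≤ δ := by
  obtain ⟨x, hx, hle⟩ := exists_vertical_lintegral_enorm_deriv_le hb hF hinj hbdd hδ X
  have hS : IsOpen {s : ℂ | s.im ∈ Ioo (-b) b} := isOpen_Ioo.preimage Complex.continuous_im
  have hmeas : Measurable (deriv F) := measurable_deriv F
  set k : ℝ → ℂ := fun y => deriv F (x + y * Complex.I) * Complex.I with hk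
  have hkm : Measurable k := by fun_prop
  have hkn : ∀ y, ‖k y‖ₑ = ‖deriv F (x + y * Complex.I)‖ₑ := by
    intro y
    rw [hk, enorm_mul, ← ofReal_norm Complex.I, Complex.norm_I, ENNReal.ofReal_one, mul_one]
  have hle' : ∫⁻ y in Ioo (-b) b, ‖k y‖ₑ ≤ ENNReal.ofReal δ := by simpa only [hkn] using hle
  have hint : IntegrableOn k (Ioo (-b) b) :=
    ⟨hkm.aestronglyMeasurable, lt_of_le_of_lt hle' ENNReal.ofReal_lt_top⟩
  have hint' : IntervalIntegrable k volume (-b) b := by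
    rw [intervalIntegrable_iff_integrableOn_Ioo_of_le (by linarith)]
    exact hint
  have h0 : (0 : ℝ) ∈ uIcc (-b) b := by rw [uIcc_of_le (by linarith)]; constructor <;> linarith
  refine ⟨x, hx, fun y => F x + ∫ t in (0 : ℝ)..y, k t, ?_, ?_, ?_⟩
  · have := intervalIntegral.continuousOn_primitive_interval' hint' h0
    rw [uIcc_of_le (by linarith)] at this
    exact continuousOn_const.add this
  · intro y hy
    have hsub : uIcc 0 y ⊆ Ioo (-b) b := ordConnected_Ioo.uIcc_subset ⟨by linarith, hb⟩ hy
    have hd : ∀ t ∈ uIcc 0 y, HasDerivAt (fun t : ℝ => F (x + t * Complex.I)) (k t) t := by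
      intro t ht
      have h1 : HasDerivAt F (deriv F (x + t * Complex.I)) (x + t * Complex.I) :=
        (hF.differentiableAt (hS.mem_nhds (by simpa using hsub ht))).hasDerivAt
      have h2 : HasDerivAt (fun t : ℝ => (x : ℂ) + t * Complex.I) (1 * Complex.I) t :=
        ((Complex.ofRealCLM.hasDerivAt (x := t)).mul_const Complex.I).const_add _
      rw [one_mul] at h2
      exact h1.comp t h2
    change F x + ∫ t in (0 : ℝ)..y, k t = F (x + y * Complex.I)
    rw [intervalIntegral.integral_eq_sub_of_hasDerivAt hd (hint'.mono_set ?_)]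
    · simp
    · rw [uIcc_of_le (by linarith : -b ≤ b)]
      exact hsub.trans Ioo_subset_Icc_self
  · intro y hy y' hy'
    have hi : ∀ y ∈ Icc (-b) b, IntervalIntegrable k volume 0 y := fun y hy =>
      hint'.mono_set (uIcc_subset_uIcc h0 (by rwa [uIcc_of_le (by linarith)]))
    rw [dist_add_left, dist_eq_norm, intervalIntegral.integral_interval_sub_left (hi y hy)
      (hi y' hy')]
    have h1 : ENNReal.ofReal ‖∫ t in y'..y, k t‖ ≤ ENNReal.ofReal δ := by
      rw [intervalIntegral.norm_intervalIntegral_eq, ofReal_norm]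
      refine (enorm_integral_le_lintegral_enorm _).trans (le_trans ?_ hle')
      rw [restrict_Ioo_eq_restrict_Ioc]
      exact lintegral_mono_set (Ioc_subset_Ioc (le_min hy'.1 hy.1) (max_le hy'.2 hy.2))
    exact (ENNReal.ofReal_le_ofReal_iff hδ.le).1 h1

end LengthArea

/-- `φ` is a holomorphic bijection from the open set `G` onto the unit disk, with inverse `ψ`. -/
structure IsRiemannPair (G : Set ℂ) (φ ψ : ℂ → ℂ) : Prop where
  isOpen : IsOpen G
  analyticOnNhd : AnalyticOnNhd ℂ φ G
  mapsTo : MapsTo φ G (ball 0 1)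
  mapsTo_inv : MapsTo ψ (ball 0 1) G
  leftInvOn : LeftInvOn ψ φ G
  rightInvOn : LeftInvOn φ ψ (ball 0 1)

theorem IsRiemannMap.isRiemannPair {G : Set ℂ} {φ : ℂ → ℂ} (hG : IsOpen G)
    (h : IsRiemannMap G φ) : IsRiemannPair G φ (Function.invFunOn φ G) := by
  obtain ⟨h1, h2, h3⟩ := h
  refine ⟨hG, h1, fun z hz => h3 ▸ mem_image_of_mem φ hz, fun w hw => ?_,
    h2.leftInvOn_invFunOn, fun w hw => ?_⟩
  · exact Function.invFunOn_mem (by rwa [← h3] at hw)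
  · exact Function.invFunOn_eq (by rwa [← h3] at hw)

namespace IsRiemannPair

variable {G : Set ℂ} {φ ψ : ℂ → ℂ}

theorem differentiableOn_inv (h : IsRiemannPair G φ ψ) : DifferentiableOn ℂ ψ (ball 0 1) := by
  intro w hw
  have := h.analyticOnNhd.differentiableAt_of_leftInvOn h.isOpen h.leftInvOn (h.mapsTo_inv hw)
  rw [h.rightInvOn hw] at this
  exact this.differentiableWithinAt

/-- The inverse map sends sequences approaching the circle to sequences approaching the frontier. -/
theorem mem_frontier_of_tendsto (h : IsRiemannPair G φ ψ) {α : Type*} {l : Filter α} [l.NeBot]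
    {u : α → ℂ} {ζ p : ℂ} (hζ : ‖ζ‖ = 1) (hu : Tendsto u l (𝓝 ζ))
    (hub : ∀ᶠ t in l, u t ∈ ball (0 : ℂ) 1) (hp : Tendsto (fun t => ψ (u t)) l (𝓝 p)) :
    p ∈ frontier G := by
  rw [h.isOpen.frontier_eq]
  refine ⟨mem_closure_of_tendsto hp (hub.mono fun t ht => h.mapsTo_inv ht), fun hpG => ?_⟩
  have h1 : Tendsto (fun t => φ (ψ (u t))) l (𝓝 (φ p)) :=
    ((h.analyticOnNhd p hpG).continuousAt.tendsto).comp hp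
  have h2 : Tendsto u l (𝓝 (φ p)) := h1.congr' (hub.mono fun t ht => h.rightInvOn ht)
  have h3 := h.mapsTo hpG
  rw [← tendsto_nhds_unique hu h2, mem_ball_zero_iff, hζ] at h3
  exact lt_irrefl _ h3

end IsRiemannPair

theorem Complex.norm_one_sub_sq_sub (z : ℂ) : ‖1 + z‖ ^ 2 - ‖1 - z‖ ^ 2 = 4 * z.re := by
  rw [Complex.sq_norm, Complex.sq_norm, Complex.normSq_apply, Complex.normSq_apply]
  simp
  ring

theorem Complex.one_add_exp_ne_zero {s : ℂ} (hs : |s.im| ≤ Real.pi / 2) : 1 + exp s ≠ 0 := by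
  intro h
  have h1 : (1 + exp s).re = 0 := by rw [h]; simp
  rw [add_re, one_re, exp_re] at h1
  have := Real.cos_nonneg_of_mem_Icc (abs_le.1 hs |> fun h => ⟨by linarith [h.1], h.2⟩)
  have := mul_nonneg (Real.exp_pos s.re).le this
  linarith

theorem Complex.norm_one_sub_exp_div_lt {s : ℂ} (hs : |s.im| < Real.pi / 2) :
    ‖(1 - exp s) / (1 + exp s)‖ < 1 := by
  have h0 := norm_pos_iff.2 (one_add_exp_ne_zero hs.le)
  rw [norm_div, div_lt_one h0]
  have h1 := norm_one_sub_sq_sub (exp s)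
  rw [exp_re] at h1
  have := mul_pos (Real.exp_pos s.re) (Real.cos_pos_of_mem_Ioo (abs_lt.1 hs |> fun h =>
    ⟨by linarith [h.1], h.2⟩))
  exact lt_of_pow_lt_pow_left₀ 2 h0.le (by linarith)

theorem Complex.norm_one_sub_exp_div_eq {s : ℂ} (hs : Real.cos s.im = 0)
    (hs' : |s.im| ≤ Real.pi / 2) : ‖(1 - exp s) / (1 + exp s)‖ = 1 := by
  have h0 := norm_pos_iff.2 (one_add_exp_ne_zero hs')
  rw [norm_div, div_eq_one_iff_eq h0.ne']
  have h1 := norm_one_sub_sq_sub (exp s)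
  rw [exp_re, hs] at h1
  exact (pow_left_inj₀ (norm_nonneg _) h0.le two_ne_zero).1 (by linarith)

theorem Complex.injOn_one_sub_exp_div :
    InjOn (fun s => (1 - exp s) / (1 + exp s)) {s | s.im ∈ Ioo (-(Real.pi / 2)) (Real.pi / 2)} := by
  intro s hs t ht hst
  have hs1 := one_add_exp_ne_zero (abs_lt.2 hs).le
  have ht1 := one_add_exp_ne_zero (abs_lt.2 ht).le
  have hpi := Real.pi_pos
  have : exp s = exp t := by
    simp only at hst
    rw [div_eq_div_iff hs1 ht1] at hst
    linear_combination (-1 / 2) * hst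
  exact exp_inj_of_neg_pi_lt_of_le_pi (by linarith [hs.1]) (by linarith [hs.2])
    (by linarith [ht.1]) (by linarith [ht.2]) this

/-- A point `m` of the disk on the circle `‖1 - m‖ = exp x * ‖1 + m‖` is the image of a point of the
vertical segment `re = x`. -/
theorem Complex.exists_one_sub_exp_div_eq {m : ℂ} (hm : ‖m‖ < 1) {x : ℝ}
    (h : ‖1 - m‖ = Real.exp x * ‖1 + m‖) :
    ∃ y ∈ Ioo (-(Real.pi / 2)) (Real.pi / 2),
      (1 - exp (x + y * I)) / (1 + exp (x + y * I)) = m := by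
  have hm0 : 1 + m ≠ 0 := by
    intro h0
    have : m = -1 := by linear_combination h0
    rw [this] at hm
    simp at hm
  set z := (1 - m) / (1 + m) with hz
  have hzm : z * (1 + m) = 1 - m := div_mul_cancel₀ _ hm0
  have hz1 : 1 + z ≠ 0 := by
    intro h0
    have h2 : (2 : ℂ) = 0 := by linear_combination (1 + m) * h0 - hzm
    norm_num at h2
  have hmz : m = (1 - z) / (1 + z) := by
    rw [eq_div_iff hz1]; linear_combination hzm
  have hre : 0 < z.re := by
    have h1 := norm_one_sub_sq_sub z
    rw [hmz, norm_div, div_lt_one (norm_pos_iff.2 hz1)] at hm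
    have := pow_lt_pow_left₀ hm (norm_nonneg _) two_ne_zero
    linarith
  have hz0 : z ≠ 0 := by rintro h0; rw [h0] at hre; simp at hre
  have hnz : ‖z‖ = Real.exp x := by
    rw [hz, norm_div, h, mul_div_assoc, div_self (norm_ne_zero_iff.2 hm0), mul_one]
  refine ⟨z.arg, abs_lt.1 (abs_arg_lt_pi_div_two_iff.2 (Or.inl hre)), ?_⟩
  have : exp (x + z.arg * I) = z := by
    rw [exp_add, ← ofReal_exp, ← hnz, norm_mul_exp_arg_mul_I]
  rw [this, ← hmz]

/-- Every point of the circle is cut off by circular arcs whose preimages are short crosscuts. -/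
theorem IsRiemannPair.exists_crosscut {G : Set ℂ} {φ ψ : ℂ → ℂ} (h : IsRiemannPair G φ ψ)
    (hb : Bornology.IsBounded G) {ζ : ℂ} (hζ : ‖ζ‖ = 1) {δ : ℝ} (hδ : 0 < δ) :
    ∃ r ∈ Ioo (0 : ℝ) 1, ∃ b > 0, ∃ g : ℝ → ℂ, ContinuousOn g (Icc (-b) b) ∧
      MapsTo g (Ioo (-b) b) G ∧ g b ∈ frontier G ∧ g (-b) ∈ frontier G ∧
      (∀ y ∈ Icc (-b) b, ∀ y' ∈ Icc (-b) b, dist (g y) (g y') ≤ δ) ∧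
      ∀ w ∈ ball (0 : ℂ) 1, ‖ζ - w‖ = r * ‖ζ + w‖ → ψ w ∈ g '' Icc (-b) b := by
  set b := Real.pi / 2 with hbdef
  have hb0 : 0 < b := by positivity
  have hζ0 : ζ ≠ 0 := by rintro rfl; simp at hζ
  set T : ℂ → ℂ := fun s => ζ * ((1 - Complex.exp s) / (1 + Complex.exp s)) with hT
  have hTmaps : MapsTo T {s | s.im ∈ Ioo (-b) b} (ball 0 1) := by
    intro s hs
    rw [mem_ball_zero_iff, hT, norm_mul, hζ, one_mul]
    exact Complex.norm_one_sub_exp_div_lt (abs_lt.2 hs)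
  have hTd : ∀ s : ℂ, |s.im| ≤ b → DifferentiableAt ℂ T s := by
    intro s hs
    have := Complex.one_add_exp_ne_zero hs
    fun_prop (disch := assumption)
  have hTinj : InjOn T {s | s.im ∈ Ioo (-b) b} := fun s hs t ht hst =>
    Complex.injOn_one_sub_exp_div hs ht (mul_left_cancel₀ hζ0 hst)
  have hFmaps : MapsTo (ψ ∘ T) {s | s.im ∈ Ioo (-b) b} G := h.mapsTo_inv.comp hTmaps
  obtain ⟨x, hx, g, hgc, hgF, hgd⟩ := exists_vertical_continuousOn_extension (F := ψ ∘ T) hb0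
    (h.differentiableOn_inv.comp
      (fun s hs => (hTd s (abs_lt.2 hs).le).differentiableWithinAt) hTmaps)
    (h.rightInvOn.injOn.comp hTinj hTmaps) (hb.subset hFmaps.image_subset) hδ 0
  have him : ∀ y : ℝ, ((x : ℂ) + y * Complex.I).im = y := fun y => by simp
  have hend : ∀ y ∈ Icc (-b) b, Real.cos y = 0 → y ∈ closure (Ioo (-b) b) →
      g y ∈ frontier G := by
    intro y hy hcos hcl
    have : (𝓝[Ioo (-b) b] y).NeBot := mem_closure_iff_nhdsWithin_neBot.1 hcl
    have hyb : |((x : ℂ) + y * Complex.I).im| ≤ b := by rw [him]; exact abs_le.2 hy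
    refine h.mem_frontier_of_tendsto (l := 𝓝[Ioo (-b) b] y)
      (u := fun t : ℝ => T (x + t * Complex.I)) (ζ := T (x + y * Complex.I)) ?_ ?_ ?_ ?_
    · rw [hT, norm_mul, hζ, one_mul]
      exact Complex.norm_one_sub_exp_div_eq (by rwa [him]) hyb
    · have h1 : ContinuousAt (fun t : ℝ => (x : ℂ) + t * Complex.I) y := by fun_prop
      exact ((hTd _ hyb).continuousAt.comp_of_eq h1 rfl).tendsto.mono_left nhdsWithin_le_nhds
    · filter_upwards [self_mem_nhdsWithin] with t ht
      exact hTmaps (by simpa using ht)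
    · refine ((hgc y hy).tendsto.mono_left (nhdsWithin_mono _ Ioo_subset_Icc_self)).congr' ?_
      filter_upwards [self_mem_nhdsWithin] with t ht
      exact hgF t ht
  have hclos : closure (Ioo (-b) b) = Icc (-b) b := closure_Ioo (by linarith)
  refine ⟨Real.exp x, ⟨Real.exp_pos x, Real.exp_lt_one_iff.2 hx⟩, b, hb0, g, hgc, ?_, ?_, ?_, hgd, ?_⟩
  · intro y hy
    rw [hgF y hy]
    exact hFmaps (by simpa using hy)
  · have hmem : b ∈ Icc (-b) b := ⟨by linarith, le_rfl⟩
    exact hend b hmem Real.cos_pi_div_two (hclos ▸ hmem)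
  · have hmem : -b ∈ Icc (-b) b := ⟨le_rfl, by linarith⟩
    exact hend (-b) hmem (by rw [Real.cos_neg]; exact Real.cos_pi_div_two) (hclos ▸ hmem)
  · intro w hw hwr
    have hm : ‖w / ζ‖ < 1 := by
      rw [norm_div, hζ, div_one]; exact mem_ball_zero_iff.1 hw
    have h1 : ‖1 - w / ζ‖ = ‖ζ - w‖ := by
      rw [← mul_one ‖1 - w / ζ‖, ← hζ, ← norm_mul]; congr 1; field_simp
    have h2 : ‖1 + w / ζ‖ = ‖ζ + w‖ := by
      rw [← mul_one ‖1 + w / ζ‖, ← hζ, ← norm_mul]; congr 1; field_simp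
    obtain ⟨y, hy, hyw⟩ := Complex.exists_one_sub_exp_div_eq hm (x := x) (by rw [h1, h2, hwr])
    refine ⟨y, Ioo_subset_Icc_self hy, ?_⟩
    rw [hgF y hy, Function.comp_apply, hT]
    simp only [hyw]
    rw [mul_div_cancel₀ _ hζ0]

theorem IsJordanDomain.exists_frontier_subset {G : Set ℂ} (hG : IsJordanDomain G) :
    IsOpen G ∧ IsPreconnected G ∧ ∃ Γ, IsJordanCurve Γ ∧ Disjoint G Γ ∧ frontier G ⊆ Γ := by
  obtain ⟨-, Γ, hΓ, x, -, rfl⟩ := hG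
  have ho : IsOpen Γᶜ := hΓ.isCompact.isClosed.isOpen_compl
  refine ⟨ho.connectedComponentIn, isPreconnected_connectedComponentIn, Γ, hΓ,
    disjoint_left.2 fun z hz => connectedComponentIn_subset _ _ hz, ?_⟩
  simpa using frontier_connectedComponentIn_subset ho x

namespace IsRiemannPair

variable {G Γ : Set ℂ} {φ ψ : ℂ → ℂ}

/-- Near a point of the circle the inverse map has small oscillation. -/
theorem exists_dist_lt (h : IsRiemannPair G φ ψ) (hb : Bornology.IsBounded G)
    (hG : IsPreconnected G) (hΓ : IsJordanCurve Γ) (hdisj : Disjoint G Γ) (hfr : frontier G ⊆ Γ)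
    {ζ : ℂ} (hζ : ‖ζ‖ = 1) {ε : ℝ} (hε : 0 < ε) :
    ∃ a, ∃ δ > 0, ∀ w ∈ ball (0 : ℂ) 1, dist w ζ < δ → dist (ψ w) a < ε := by
  have h0 : (0 : ℂ) ∈ ball (0 : ℂ) 1 := mem_ball_self one_pos
  obtain ⟨ρ, hρ, hρG⟩ := Metric.isOpen_iff.1 h.isOpen _ (h.mapsTo_inv h0)
  obtain ⟨ε', hε', hεε, hερ⟩ : ∃ ε' > 0, ε' ≤ ε ∧ ε' ≤ ρ :=
    ⟨min ε ρ, lt_min hε hρ, min_le_left _ _, min_le_right _ _⟩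
  obtain ⟨δA, hδA, hA⟩ := hΓ.exists_small_isPreconnected hε'
  obtain ⟨δ, hδ, hδ1, hδ2⟩ : ∃ δ > 0, δ < δA ∧ δ < ε' := by
    obtain ⟨δ, h1, h2⟩ := exists_between (lt_min hδA hε')
    exact ⟨δ, h1, lt_min_iff.1 h2⟩
  obtain ⟨r, hr, b, hb0, g, hgc, hgG, hg1, hg2, hgd, hgw⟩ := h.exists_crosscut hb hζ hδ
  have hb1 : b ∈ Icc (-b) b := ⟨by linarith, le_rfl⟩
  have hb2 : -b ∈ Icc (-b) b := ⟨le_rfl, by linarith⟩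
  obtain ⟨A, hAΓ, hAc, hApre, haA, hcA, hAε⟩ := hA (g b) (hfr hg1) (g (-b)) (hfr hg2)
    ((hgd _ hb1 _ hb2).trans_lt hδ1)
  set K := g '' Icc (-b) b ∪ A with hKdef
  have hKball : ∀ z ∈ K, dist z (g b) < ε' := by
    rintro z (⟨y, hy, rfl⟩ | hz)
    · exact (hgd _ hy _ hb1).trans_lt hδ2
    · exact hAε z hz
  have hKc : IsCompact K := (isCompact_Icc.image_of_continuousOn hgc).union hAc
  have hKΓ : K ∩ Γ = A := by
    refine subset_antisymm ?_ fun z hz => ⟨Or.inr hz, hAΓ hz⟩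
    rintro z ⟨⟨y, hy, rfl⟩ | hz, hzΓ⟩
    · rcases eq_or_lt_of_le hy.1 with h1 | h1
      · rwa [← h1]
      rcases eq_or_lt_of_le hy.2 with h2 | h2
      · rwa [h2]
      · exact absurd hzΓ (disjoint_left.1 hdisj (hgG ⟨h1, h2⟩))
    · exact hz
  have hφc : ContinuousOn φ G := h.analyticOnNhd.continuousOn
  set U := G ∩ (fun p => ‖ζ - φ p‖ - r * ‖ζ + φ p‖) ⁻¹' Iio 0 with hU
  set V := G ∩ (fun p => ‖ζ - φ p‖ - r * ‖ζ + φ p‖) ⁻¹' Ioi 0 with hV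
  have hcont : ContinuousOn (fun p => ‖ζ - φ p‖ - r * ‖ζ + φ p‖) G := by fun_prop
  have hUo : IsOpen U := hcont.isOpen_inter_preimage h.isOpen isOpen_Iio
  have hVo : IsOpen V := hcont.isOpen_inter_preimage h.isOpen isOpen_Ioi
  have hUV : Disjoint U V := disjoint_left.2 fun z hz hz' => (mem_preimage.1 hz.2).not_gt (mem_preimage.1 hz'.2)
  have hcov : G ⊆ U ∪ V ∪ K := by
    intro p hp
    rcases lt_trichotomy (‖ζ - φ p‖ - r * ‖ζ + φ p‖) 0 with h1 | h1 | h1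
    · exact Or.inl (Or.inl ⟨hp, h1⟩)
    · have := hgw (φ p) (h.mapsTo hp) (sub_eq_zero.1 h1)
      rw [h.leftInvOn hp] at this
      exact Or.inr (Or.inl this)
    · exact Or.inl (Or.inr ⟨hp, h1⟩)
  have h0V : ψ 0 ∈ V := by
    refine ⟨h.mapsTo_inv h0, ?_⟩
    simp only [mem_preimage, mem_Ioi, h.rightInvOn h0, sub_zero, add_zero, hζ]
    linarith [hr.2]
  have h0d : ε' ≤ dist (ψ 0) (g b) := by
    by_contra! hlt
    exact disjoint_left.1 hdisj (hρG (mem_ball'.2 (hlt.trans_le hερ))) (hfr hg1)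
  have hUball : ∀ y ∈ U, dist y (g b) < ε' := by
    intro y hy
    by_contra! hlt
    refine not_hasLogOn_of_separation hb hG hfr hdisj hΓ.isCompact.isClosed hKc.isClosed
      (hKΓ ▸ hApre) hUo hVo hUV inter_subset_left inter_subset_left hcov hy h0V ?_
    exact hasLogOn_div_of_subset_ball (c := g b)
      (fun z hz => (hKball z hz).trans_le h0d) (fun z hz => (hKball z hz).trans_le hlt)
  have hev : ∀ᶠ w in 𝓝 ζ, ‖ζ - w‖ - r * ‖ζ + w‖ < 0 := by
    have : ContinuousAt (fun w => ‖ζ - w‖ - r * ‖ζ + w‖) ζ := by fun_prop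
    refine this.eventually_lt_const ?_
    beta_reduce
    rw [sub_self, norm_zero, ← two_mul, norm_mul, hζ]
    simpa using hr.1
  obtain ⟨δ', hδ', hδw⟩ := Metric.eventually_nhds_iff.1 hev
  refine ⟨g b, δ', hδ', fun w hw hwd => (hUball _ ⟨h.mapsTo_inv hw, ?_⟩).trans_le hεε⟩
  simp only [mem_preimage, mem_Iio, h.rightInvOn hw]
  exact hδw hwd

/-- The inverse of a Riemann map of a Jordan domain extends continuously to the closed disk. -/
theorem exists_continuousOn_extension (h : IsRiemannPair G φ ψ) (hb : Bornology.IsBounded G)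
    (hG : IsPreconnected G) (hΓ : IsJordanCurve Γ) (hdisj : Disjoint G Γ)
    (hfr : frontier G ⊆ Γ) :
    ∃ Ψ : ℂ → ℂ, ContinuousOn Ψ (closedBall 0 1) ∧ EqOn Ψ ψ (ball 0 1) := by
  have hcl : closure (ball (0 : ℂ) 1) = closedBall 0 1 := closure_ball 0 one_ne_zero
  have hψ : ContinuousOn ψ (ball 0 1) := h.differentiableOn_inv.continuousOn
  refine ⟨extendFrom (ball 0 1) ψ, continuousOn_extendFrom hcl.ge fun ζ hζ => ?_,
    extendFrom_extends hψ⟩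
  rcases (mem_closedBall_zero_iff.1 hζ).lt_or_eq with hlt | heq
  · exact ⟨ψ ζ, hψ ζ (mem_ball_zero_iff.2 hlt)⟩
  · have : (𝓝[ball (0 : ℂ) 1] ζ).NeBot := mem_closure_iff_nhdsWithin_neBot.1 (hcl.ge hζ)
    refine cauchy_map_iff_exists_tendsto.1 (Metric.cauchy_iff.2 ⟨inferInstance, fun ε hε => ?_⟩)
    obtain ⟨a, δ, hδ, hd⟩ := h.exists_dist_lt hb hG hΓ hdisj hfr heq (half_pos hε)
    refine ⟨ψ '' (ball ζ δ ∩ ball 0 1),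
      image_mem_map (inter_mem (mem_nhdsWithin_of_mem_nhds (ball_mem_nhds _ hδ))
        self_mem_nhdsWithin), ?_⟩
    rintro _ ⟨w, hw, rfl⟩ _ ⟨w', hw', rfl⟩
    have h1 := hd w hw.2 hw.1
    have h2 := hd w' hw'.2 hw'.1
    linarith [dist_triangle_right (ψ w) (ψ w') a]

theorem extension_mem_frontier (h : IsRiemannPair G φ ψ) {Ψ : ℂ → ℂ}
    (hΨ : ContinuousOn Ψ (closedBall 0 1)) (hΨψ : EqOn Ψ ψ (ball 0 1)) {ζ : ℂ} (hζ : ‖ζ‖ = 1) :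
    Ψ ζ ∈ frontier G := by
  have hcl : closure (ball (0 : ℂ) 1) = closedBall 0 1 := closure_ball 0 one_ne_zero
  have hmem : ζ ∈ closedBall (0 : ℂ) 1 := mem_closedBall_zero_iff.2 hζ.le
  have : (𝓝[ball (0 : ℂ) 1] ζ).NeBot := mem_closure_iff_nhdsWithin_neBot.1 (hcl.ge hmem)
  refine h.mem_frontier_of_tendsto (l := 𝓝[ball (0 : ℂ) 1] ζ) (u := id) hζ nhdsWithin_le_nhds
    self_mem_nhdsWithin ?_
  refine ((hΨ ζ hmem).tendsto.mono_left (nhdsWithin_mono _ ball_subset_closedBall)).congr' ?_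
  filter_upwards [self_mem_nhdsWithin] with w hw
  exact hΨψ hw

theorem image_extension (h : IsRiemannPair G φ ψ) {Ψ : ℂ → ℂ}
    (hΨ : ContinuousOn Ψ (closedBall 0 1)) (hΨψ : EqOn Ψ ψ (ball 0 1)) :
    Ψ '' closedBall 0 1 = closure G := by
  refine subset_antisymm ?_ ?_
  · rintro _ ⟨w, hw, rfl⟩
    rcases (mem_closedBall_zero_iff.1 hw).lt_or_eq with hlt | heq
    · have hw' := mem_ball_zero_iff.2 hlt
      rw [hΨψ hw']
      exact subset_closure (h.mapsTo_inv hw')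
    · exact frontier_subset_closure (h.extension_mem_frontier hΨ hΨψ heq)
  · refine closure_minimal (fun z hz => ?_)
      ((isCompact_closedBall 0 1).image_of_continuousOn hΨ).isClosed
    exact ⟨φ z, ball_subset_closedBall (h.mapsTo hz),
      (hΨψ (h.mapsTo hz)).trans (h.leftInvOn hz)⟩

end IsRiemannPair

/-- A function holomorphic in the disk and continuous up to the circle that is constant on an arc
takes the same value at the origin. -/
theorem eq_at_zero_of_eqOn_arc {Ψ : ℂ → ℂ} {p : ℂ} {W : Set ℂ}
    (hc : ContinuousOn Ψ (closedBall 0 1)) (hd : DifferentiableOn ℂ Ψ (ball 0 1)) (hW : IsOpen W)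
    (hne : (W ∩ sphere 0 1).Nonempty) (heq : ∀ ζ ∈ W ∩ sphere 0 1, Ψ ζ = p) : Ψ 0 = p := by
  obtain ⟨ζ₀, hζ₀W, hζ₀⟩ := hne
  rw [mem_sphere_zero_iff_norm] at hζ₀
  obtain ⟨t, ht, hcov⟩ := (isCompact_sphere (0 : ℂ) 1).elim_nhds_subcover
    (fun ζ => (fun z => ζ₀ / ζ * z) ⁻¹' W) (fun ζ hζ => by
      have hζ0 : ζ ≠ 0 := by rintro rfl; simp at hζ
      refine (hW.preimage (by fun_prop)).mem_nhds ?_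
      rwa [mem_preimage, div_mul_cancel₀ _ hζ0])
  have hnorm : ∀ ζ ∈ t, ∀ z : ℂ, ‖ζ₀ / ζ * z‖ = ‖z‖ := by
    intro ζ hζ z
    rw [norm_mul, norm_div, hζ₀, mem_sphere_zero_iff_norm.1 (ht ζ hζ), div_one, one_mul]
  have hP : DiffContOnCl ℂ (fun z => ∏ ζ ∈ t, (Ψ (ζ₀ / ζ * z) - p)) (ball 0 1) := by
    refine ⟨?_, ?_⟩
    · refine DifferentiableOn.fun_finsetProd fun ζ hζ => DifferentiableOn.sub_const ?_ _
      exact hd.comp (by fun_prop) fun z hz => by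
        rw [mem_ball_zero_iff, hnorm ζ hζ]; exact mem_ball_zero_iff.1 hz
    · rw [closure_ball 0 one_ne_zero]
      refine continuousOn_finsetProd _ fun ζ hζ => ContinuousOn.sub ?_ continuousOn_const
      exact hc.comp (by fun_prop) fun z hz => by
        rw [mem_closedBall_zero_iff, hnorm ζ hζ]; exact mem_closedBall_zero_iff.1 hz
  have h0 := Complex.norm_le_of_forall_mem_frontier_norm_le isBounded_ball hP (C := 0)
    (fun z hz => by
      rw [frontier_ball 0 one_ne_zero] at hz
      obtain ⟨ζ, hζ, hzW⟩ := mem_iUnion₂.1 (hcov hz)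
      have : Ψ (ζ₀ / ζ * z) = p := heq _ ⟨hzW, by
        rw [mem_sphere_zero_iff_norm, hnorm ζ hζ]; exact mem_sphere_zero_iff_norm.1 hz⟩
      rw [Finset.prod_eq_zero hζ (by rw [this, sub_self]), norm_zero])
    (subset_closure (mem_ball_self one_pos))
  rw [norm_le_zero_iff, Finset.prod_eq_zero_iff] at h0
  obtain ⟨ζ, -, h⟩ := h0
  rwa [mul_zero, sub_eq_zero] at h

/-- The signed distance (up to scaling) of `w` to the line through `ζ₁` and `ζ₂`. -/
noncomputable def chordSide (ζ₁ ζ₂ w : ℂ) : ℝ := ((w - ζ₁) * starRingEnd ℂ (ζ₂ - ζ₁)).im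

theorem chordSide_comm (ζ₁ ζ₂ w : ℂ) : chordSide ζ₂ ζ₁ w = -chordSide ζ₁ ζ₂ w := by
  simp [chordSide]
  ring

theorem continuous_chordSide (ζ₁ ζ₂ : ℂ) : Continuous (chordSide ζ₁ ζ₂) := by
  unfold chordSide
  fun_prop

theorem eq_or_eq_of_chordSide_eq_zero {ζ₁ ζ₂ w : ℂ} (h₁ : ‖ζ₁‖ = 1) (h₂ : ‖ζ₂‖ = 1) (hw : ‖w‖ = 1)
    (hne : ζ₁ ≠ ζ₂) (h : chordSide ζ₁ ζ₂ w = 0) : w = ζ₁ ∨ w = ζ₂ := by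
  have hd : ζ₂ - ζ₁ ≠ 0 := sub_ne_zero.2 hne.symm
  have hn := Complex.normSq_pos.2 hd
  obtain ⟨t, ht⟩ : ∃ t : ℝ, w = ζ₁ + t * (ζ₂ - ζ₁) := by
    refine ⟨((w - ζ₁) * starRingEnd ℂ (ζ₂ - ζ₁)).re / Complex.normSq (ζ₂ - ζ₁), ?_⟩
    have h1 : (w - ζ₁) * starRingEnd ℂ (ζ₂ - ζ₁) =
        (((w - ζ₁) * starRingEnd ℂ (ζ₂ - ζ₁)).re : ℂ) :=
      Complex.ext (by simp) (by simpa [chordSide] using h)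
    rw [Complex.ofReal_div, ← h1, ← Complex.mul_conj]
    have : starRingEnd ℂ (ζ₂ - ζ₁) ≠ 0 := (map_ne_zero _).2 hd
    field_simp
    ring
  have e1 : ζ₁.re ^ 2 + ζ₁.im ^ 2 = 1 := by
    have := Complex.sq_norm ζ₁; rw [h₁, Complex.normSq_apply] at this; linarith
  have e2 : ζ₂.re ^ 2 + ζ₂.im ^ 2 = 1 := by
    have := Complex.sq_norm ζ₂; rw [h₂, Complex.normSq_apply] at this; linarith
  have e3 : (ζ₁.re + t * (ζ₂.re - ζ₁.re)) ^ 2 + (ζ₁.im + t * (ζ₂.im - ζ₁.im)) ^ 2 = 1 := by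
    have := Complex.sq_norm w
    rw [hw, ht, Complex.normSq_apply] at this
    simp at this
    linarith
  rw [Complex.normSq_apply] at hn
  simp only [Complex.sub_re, Complex.sub_im] at hn
  have : t * (t - 1) = 0 := by
    refine (mul_eq_zero.1 (?_ : _ * ((ζ₂.re - ζ₁.re) * (ζ₂.re - ζ₁.re) +
      (ζ₂.im - ζ₁.im) * (ζ₂.im - ζ₁.im)) = 0)).resolve_right hn.ne'
    linear_combination e3 - (1 - t) * e1 - t * e2
  rcases mul_eq_zero.1 this with h0 | h0
  · left; rw [ht, h0]; simp
  · right; rw [ht, sub_eq_zero.1 h0]; simp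

theorem exists_chordSide_pos {ζ₁ ζ₂ : ℂ} (h₁ : ‖ζ₁‖ = 1) (h₂ : ‖ζ₂‖ = 1) (hne : ζ₁ ≠ ζ₂) :
    ∃ η : ℂ, ‖η‖ = 1 ∧ 0 < chordSide ζ₁ ζ₂ η := by
  set d := ζ₂ - ζ₁ with hd
  have hd0 : 0 < ‖d‖ := norm_pos_iff.2 (sub_ne_zero.2 hne.symm)
  have hdC : (‖d‖ : ℂ) ≠ 0 := by exact_mod_cast hd0.ne'
  refine ⟨Complex.I * d / ‖d‖, by simp [hd0.ne'], ?_⟩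
  have hre : 2 * (ζ₁ * starRingEnd ℂ d).re = -‖d‖ ^ 2 := by
    have a := Complex.sq_norm ζ₁
    have b := Complex.sq_norm ζ₂
    rw [h₁, Complex.normSq_apply] at a
    rw [h₂, Complex.normSq_apply] at b
    rw [Complex.sq_norm, Complex.normSq_apply, hd]
    simp
    linarith
  have hsq : ‖ζ₁ * starRingEnd ℂ d‖ ^ 2 = ‖d‖ ^ 2 := by
    rw [norm_mul, h₁, one_mul, Complex.norm_conj]
  rw [Complex.sq_norm (ζ₁ * _), Complex.normSq_apply] at hsq
  have him : (ζ₁ * starRingEnd ℂ d).im < ‖d‖ := by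
    refine lt_of_pow_lt_pow_left₀ 2 hd0.le ?_
    have : 0 < (ζ₁ * starRingEnd ℂ d).re * (ζ₁ * starRingEnd ℂ d).re := by
      refine mul_self_pos.2 fun h0 => ?_
      rw [h0] at hre
      nlinarith
    nlinarith
  have key : (Complex.I * d / ‖d‖) * starRingEnd ℂ d = ‖d‖ * Complex.I := by
    have := Complex.mul_conj d
    rw [Complex.normSq_eq_norm_sq, Complex.ofReal_pow] at this
    rw [div_mul_eq_mul_div, mul_assoc, this, sq, ← mul_assoc, mul_div_cancel_right₀ _ hdC, mul_comm]
  rw [chordSide, ← hd, sub_mul, key, Complex.sub_im]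
  simpa using him

namespace IsRiemannPair

variable {G Γ : Set ℂ} {φ ψ Ψ : ℂ → ℂ}

theorem extension_eq_of_chordSide (h : IsRiemannPair G φ ψ) (hb : Bornology.IsBounded G)
    (hG : IsPreconnected G) (hΓ : IsJordanCurve Γ) (hdisj : Disjoint G Γ) (hfr : frontier G ⊆ Γ)
    (hΨ : ContinuousOn Ψ (closedBall 0 1)) (hΨψ : EqOn Ψ ψ (ball 0 1)) {ζ₁ ζ₂ η₁ η₂ : ℂ}
    (h₁ : ‖ζ₁‖ = 1) (h₂ : ‖ζ₂‖ = 1) (hne : ζ₁ ≠ ζ₂) (heq : Ψ ζ₁ = Ψ ζ₂) (hη₁ : ‖η₁‖ = 1)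
    (hη₂ : ‖η₂‖ = 1) (hp₁ : 0 < chordSide ζ₁ ζ₂ η₁) (hp₂ : chordSide ζ₁ ζ₂ η₂ < 0) :
    Ψ η₁ = Ψ ζ₁ ∨ Ψ η₂ = Ψ ζ₁ := by
  by_contra! hcon
  obtain ⟨hq₁, hq₂⟩ := hcon
  have hsph : ∀ {ζ : ℂ}, ‖ζ‖ = 1 → Ψ ζ ∈ Γ := fun hζ =>
    hfr (h.extension_mem_frontier hΨ hΨψ hζ)
  have hc := continuous_chordSide ζ₁ ζ₂
  set J := Ψ '' (closedBall 0 1 ∩ chordSide ζ₁ ζ₂ ⁻¹' {0}) with hJ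
  have hJc : IsCompact J :=
    ((isCompact_closedBall 0 1).inter_right (isClosed_singleton.preimage hc)).image_of_continuousOn
      (hΨ.mono inter_subset_left)
  have hJΓ : J ∩ Γ = {Ψ ζ₁} := by
    refine subset_antisymm ?_ ?_
    · rintro _ ⟨⟨w, hw, rfl⟩, hwΓ⟩
      rcases (mem_closedBall_zero_iff.1 hw.1).lt_or_eq with hlt | hw1
      · have hw' := mem_ball_zero_iff.2 hlt
        rw [hΨψ hw'] at hwΓ
        exact absurd hwΓ (disjoint_left.1 hdisj (h.mapsTo_inv hw'))
      · rcases eq_or_eq_of_chordSide_eq_zero h₁ h₂ hw1 hne hw.2 with rfl | rfl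
        · rfl
        · exact heq.symm
    · rintro _ rfl
      exact ⟨⟨ζ₁, ⟨mem_closedBall_zero_iff.2 h₁.le, by simp [chordSide]⟩, rfl⟩, hsph h₁⟩
  have hφc : ContinuousOn (fun z => chordSide ζ₁ ζ₂ (φ z)) G :=
    hc.comp_continuousOn h.analyticOnNhd.continuousOn
  have happrox : ∀ η : ℂ, ‖η‖ = 1 → Ψ η ≠ Ψ ζ₁ → ∀ O : Set ℂ, IsOpen O → η ∈ O →
      ∃ ρ > 0, Disjoint (ball (Ψ η) ρ) J ∧ ∃ w ∈ ball (0 : ℂ) 1, w ∈ O ∧ ψ w ∈ ball (Ψ η) ρ := by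
    intro η hη hηp O hO hηO
    have hJ' : Ψ η ∉ J := fun hmem => hηp (hJΓ.subset ⟨hmem, hsph hη⟩)
    obtain ⟨ρ, hρ, hρJ⟩ := Metric.isOpen_iff.1 hJc.isClosed.isOpen_compl _ hJ'
    refine ⟨ρ, hρ, disjoint_left.2 fun z hz => hρJ hz, ?_⟩
    have hmem : η ∈ closedBall (0 : ℂ) 1 := mem_closedBall_zero_iff.2 hη.le
    have : (𝓝[ball (0 : ℂ) 1] η).NeBot :=
      mem_closure_iff_nhdsWithin_neBot.1 ((closure_ball (0 : ℂ) one_ne_zero).ge hmem)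
    have h3 := ((hΨ η hmem).tendsto.mono_left (nhdsWithin_mono _ ball_subset_closedBall)).eventually
      (ball_mem_nhds _ hρ)
    have h4 : ∀ᶠ w in 𝓝[ball (0 : ℂ) 1] η, w ∈ O := nhdsWithin_le_nhds (hO.mem_nhds hηO)
    obtain ⟨w, hw1, hw2, hw3⟩ := (h3.and (h4.and self_mem_nhdsWithin)).exists
    exact ⟨w, hw3, hw2, by rwa [← hΨψ hw3]⟩
  obtain ⟨ρ₁, hρ₁, hd₁, w₁, hw₁, hwO₁, hwb₁⟩ := happrox η₁ hη₁ hq₁ _ (isOpen_Ioi.preimage hc) hp₁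
  obtain ⟨ρ₂, hρ₂, hd₂, w₂, hw₂, hwO₂, hwb₂⟩ := happrox η₂ hη₂ hq₂ _ (isOpen_Iio.preimage hc) hp₂
  have hS : IsPreconnected (Γ \ {Ψ ζ₁} ∪ ball (Ψ η₁) ρ₁ ∪ ball (Ψ η₂) ρ₂) := by
    have a₁ : Ψ η₁ ∈ Γ \ {Ψ ζ₁} := ⟨hsph hη₁, hq₁⟩
    have a₂ : Ψ η₂ ∈ Γ \ {Ψ ζ₁} := ⟨hsph hη₂, hq₂⟩
    exact ((hΓ.isPreconnected_diff_singleton (hsph h₁)).union _ a₁ (mem_ball_self hρ₁)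
      (convex_ball _ _).isPreconnected).union _ (Or.inl a₂) (mem_ball_self hρ₂)
      (convex_ball _ _).isPreconnected
  have hSJ : Disjoint (Γ \ {Ψ ζ₁} ∪ ball (Ψ η₁) ρ₁ ∪ ball (Ψ η₂) ρ₂) J := by
    refine ((disjoint_left.2 fun z hz hzJ => hz.2 ?_).union_left hd₁).union_left hd₂
    exact hJΓ.subset ⟨hzJ, hz.1⟩
  refine not_hasLogOn_of_separation (K := J)
    (U := G ∩ (fun z => chordSide ζ₁ ζ₂ (φ z)) ⁻¹' Ioi 0)
    (V := G ∩ (fun z => chordSide ζ₁ ζ₂ (φ z)) ⁻¹' Iio 0) (y := ψ w₁) (x := ψ w₂)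
    hb hG hfr hdisj hΓ.isCompact.isClosed hJc.isClosed (hJΓ ▸ isPreconnected_singleton)
    (hφc.isOpen_inter_preimage h.isOpen isOpen_Ioi) (hφc.isOpen_inter_preimage h.isOpen isOpen_Iio)
    (disjoint_left.2 fun z hz hz' => lt_asymm (a := (0 : ℝ)) hz.2 hz'.2) inter_subset_left
    inter_subset_left (fun z hz => ?_) ⟨h.mapsTo_inv hw₁, ?_⟩ ⟨h.mapsTo_inv hw₂, ?_⟩
    (hasLogOn_div_of_isPreconnected hJc.isClosed hS hSJ (Or.inr hwb₂) (Or.inl (Or.inr hwb₁)))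
  · rcases lt_trichotomy (chordSide ζ₁ ζ₂ (φ z)) 0 with h0 | h0 | h0
    · exact Or.inl (Or.inr ⟨hz, h0⟩)
    · exact Or.inr ⟨φ z, ⟨ball_subset_closedBall (h.mapsTo hz), h0⟩,
        (hΨψ (h.mapsTo hz)).trans (h.leftInvOn hz)⟩
    · exact Or.inl (Or.inl ⟨hz, h0⟩)
  · simpa only [mem_preimage, h.rightInvOn hw₁] using hwO₁
  · simpa only [mem_preimage, h.rightInvOn hw₂] using hwO₂

theorem injOn_extension (h : IsRiemannPair G φ ψ) (hb : Bornology.IsBounded G)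
    (hG : IsPreconnected G) (hΓ : IsJordanCurve Γ) (hdisj : Disjoint G Γ) (hfr : frontier G ⊆ Γ)
    (hΨ : ContinuousOn Ψ (closedBall 0 1)) (hΨψ : EqOn Ψ ψ (ball 0 1)) :
    InjOn Ψ (closedBall 0 1) := by
  have hsph : ∀ {ζ : ℂ}, ‖ζ‖ = 1 → Ψ ζ ∈ Γ := fun hζ =>
    hfr (h.extension_mem_frontier hΨ hΨψ hζ)
  have hball : ∀ {w : ℂ}, ‖w‖ < 1 → Ψ w ∈ G := fun hw => by
    rw [hΨψ (mem_ball_zero_iff.2 hw)]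
    exact h.mapsTo_inv (mem_ball_zero_iff.2 hw)
  have hzero : ∀ ζ : ℂ, ‖ζ‖ = 1 → Ψ 0 ≠ Ψ ζ := fun ζ hζ h0 =>
    disjoint_left.1 hdisj (hball (by simp)) (h0 ▸ hsph hζ)
  have harc : ∀ ζ₁ ζ₂ : ℂ, ‖ζ₁‖ = 1 → ‖ζ₂‖ = 1 → ζ₁ ≠ ζ₂ →
      ∃ η : ℂ, ‖η‖ = 1 ∧ 0 < chordSide ζ₁ ζ₂ η ∧ Ψ η ≠ Ψ ζ₁ := by
    intro ζ₁ ζ₂ h₁ h₂ hne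
    by_contra! hcon
    obtain ⟨η, hη, hηp⟩ := exists_chordSide_pos h₁ h₂ hne
    refine hzero ζ₁ h₁ (eq_at_zero_of_eqOn_arc hΨ (h.differentiableOn_inv.congr hΨψ)
      (isOpen_Ioi.preimage (continuous_chordSide ζ₁ ζ₂)) ⟨η, hηp, by simpa using hη⟩ ?_)
    exact fun ζ hζ => hcon ζ (by simpa using hζ.2) hζ.1
  intro ζ₁ h₁ ζ₂ h₂ heq
  rcases (mem_closedBall_zero_iff.1 h₁).lt_or_eq with h₁ | h₁ <;>
    rcases (mem_closedBall_zero_iff.1 h₂).lt_or_eq with h₂ | h₂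
  · rw [hΨψ (mem_ball_zero_iff.2 h₁), hΨψ (mem_ball_zero_iff.2 h₂)] at heq
    exact h.rightInvOn.injOn (mem_ball_zero_iff.2 h₁) (mem_ball_zero_iff.2 h₂) heq
  · exact absurd (hsph h₂) (disjoint_left.1 hdisj (heq ▸ hball h₁))
  · exact absurd (hsph h₁) (disjoint_left.1 hdisj (heq ▸ hball h₂))
  · by_contra hne
    obtain ⟨η₁, hη₁, hp₁, hq₁⟩ := harc ζ₁ ζ₂ h₁ h₂ hne
    obtain ⟨η₂, hη₂, hp₂, hq₂⟩ := harc ζ₂ ζ₁ h₂ h₁ (Ne.symm hne)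
    rw [chordSide_comm] at hp₂
    rw [← heq] at hq₂
    rcases h.extension_eq_of_chordSide hb hG hΓ hdisj hfr hΨ hΨψ h₁ h₂ hne heq hη₁ hη₂ hp₁
      (by linarith) with h0 | h0
    · exact hq₁ h0
    · exact hq₂ h0

end IsRiemannPair

/-- Carathéodory: the Riemann map of a Jordan domain extends to a
homeomorphism from the closure of the domain onto the closed unit disk. -/
theorem caratheodory_theorem (G : Set ℂ) (φ : ℂ → ℂ)
    (hG : IsJordanDomain G) (hφ : IsRiemannMap G φ) :
    ∃ Φ : closure G ≃ₜ Metric.closedBall (0:ℂ) 1,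
      ∀ z : closure G, (z : ℂ) ∈ G → (Φ z : ℂ) = φ z := by
  obtain ⟨ho, hpre, Γ, hΓ, hdisj, hfr⟩ := hG.exists_frontier_subset
  have h := hφ.isRiemannPair ho
  obtain ⟨Ψ, hΨ, hΨψ⟩ := h.exists_continuousOn_extension hG.1 hpre hΓ hdisj hfr
  have hinj := h.injOn_extension hG.1 hpre hΓ hdisj hfr hΨ hΨψ
  have himg := h.image_extension hΨ hΨψ
  have hmaps : MapsTo Ψ (closedBall 0 1) (closure G) := himg ▸ mapsTo_image _ _
  have hcpt : CompactSpace (closedBall (0 : ℂ) 1) :=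
    isCompact_iff_compactSpace.1 (isCompact_closedBall 0 1)
  let e : closedBall (0 : ℂ) 1 ≃ closure G :=
    Equiv.ofBijective (hmaps.restrict Ψ _ _) ⟨hmaps.restrict_inj.2 hinj, fun z => by
      obtain ⟨w, hw, hwz⟩ := himg.ge z.2
      exact ⟨⟨w, hw⟩, Subtype.ext hwz⟩⟩
  have he : Continuous e := hΨ.mapsToRestrict hmaps
  refine ⟨(he.homeoOfEquivCompactToT2).symm, fun z hz => ?_⟩
  have hz' := h.mapsTo hz
  have : e ⟨φ z, ball_subset_closedBall hz'⟩ = z :=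
    Subtype.ext ((hΨψ hz').trans (h.leftInvOn hz))
  change (e.symm z : ℂ) = φ z
  rw [← this, Equiv.symm_apply_apply, this]
end

section
/- A Jordan domain G in ℂ has no multiple boundary points: for every crosscut J of G and disjoint domains U, V with G \ J = U ∪ V, one has ∂U ∩ ∂V = J; in particular no point of ∂G lies in (∂U ∩ ∂V) \ J. -/
open Set Topology Metric Filter

/-- The map `z ↦ (z - u) / (z - v)` has a continuous logarithm on `X`. -/
def HasLogRatio (X : Set ℂ) (u v : ℂ) : Prop :=
  ∃ g : ℂ → ℂ, ContinuousOn g X ∧ ∀ z ∈ X, Complex.exp (g z) * (z - v) = z - u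

/-- A continuous function with constant exponential is constant on a preconnected set. -/
lemma IsPreconnected.eq_of_exp_eq {α : Type*} [TopologicalSpace α] {S : Set α}
    (hS : IsPreconnected S) {d : α → ℂ} (hd : ContinuousOn d S)
    (h : ∀ x ∈ S, ∀ y ∈ S, Complex.exp (d x) = Complex.exp (d y))
    {x y : α} (hx : x ∈ S) (hy : y ∈ S) : d x = d y := by
  refine hS.induction₂ (fun x y => d x = d y) (fun x hx => ?_)
    (fun _ _ _ _ _ _ h₁ h₂ => h₁.trans h₂) (fun _ _ _ _ h₁ => h₁.symm) hx hy
  have hball : ∀ᶠ y in 𝓝[S] x, d y ∈ ball (d x) (2 * Real.pi) :=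
    hd x hx (ball_mem_nhds _ Real.two_pi_pos)
  filter_upwards [hball, self_mem_nhdsWithin] with y hy hyS
  obtain ⟨n, hn⟩ := Complex.exp_eq_exp_iff_exists_int.1 (h y hyS x hx)
  have hnorm : ‖(n : ℂ) * (2 * Real.pi * Complex.I)‖ < 2 * Real.pi := by
    have : d y - d x = n * (2 * Real.pi * Complex.I) := by rw [hn]; ring
    rw [← this]
    simpa [dist_eq_norm] using hy
  have hn' : |(n : ℝ)| * (2 * Real.pi) < 1 * (2 * Real.pi) := by
    simpa [abs_of_pos Real.pi_pos] using hnorm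
  have h1 : |(n : ℝ)| < 1 := lt_of_mul_lt_mul_right hn' Real.two_pi_pos.le
  have h0 : n = 0 := Int.abs_lt_one_iff.1 (by exact_mod_cast h1)
  simpa [h0] using hn.symm

lemma HasLogRatio.mono {X Y : Set ℂ} {u v : ℂ} (h : HasLogRatio X u v) (hYX : Y ⊆ X) :
    HasLogRatio Y u v :=
  let ⟨g, hg, hgz⟩ := h
  ⟨g, hg.mono hYX, fun z hz => hgz z (hYX hz)⟩

lemma HasLogRatio.symm {X : Set ℂ} {u v : ℂ} (h : HasLogRatio X u v) : HasLogRatio X v u := by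
  obtain ⟨g, hg, hgz⟩ := h
  refine ⟨fun z => -g z, hg.neg, fun z hz => ?_⟩
  rw [← hgz z hz, ← mul_assoc, ← Complex.exp_add]
  simp

lemma HasLogRatio.trans {X : Set ℂ} {u v w : ℂ} (h₁ : HasLogRatio X u v)
    (h₂ : HasLogRatio X v w) : HasLogRatio X u w := by
  obtain ⟨g, hg, hgz⟩ := h₁
  obtain ⟨k, hk, hkz⟩ := h₂
  refine ⟨fun z => g z + k z, hg.add hk, fun z hz => ?_⟩
  rw [Complex.exp_add, mul_assoc, hkz z hz, hgz z hz]

/-- Points of a connected set disjoint from `X` are not separated by `X`. -/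
lemma hasLogRatio_of_isPreconnected {X S : Set ℂ} (hX : IsClosed X) (hS : IsPreconnected S)
    (hSX : Disjoint S X) {u v : ℂ} (hu : u ∈ S) (hv : v ∈ S) : HasLogRatio X u v := by
  refine hS.induction₂ (HasLogRatio X) (fun x hx => ?_)
    (fun _ _ _ _ _ _ h₁ h₂ => h₁.trans h₂) (fun _ _ _ _ h => h.symm) hu hv
  obtain ⟨r, hr, hball⟩ := Metric.isOpen_iff.1 hX.isOpen_compl x (hSX.notMem_of_mem_left hx)
  filter_upwards [mem_nhdsWithin_of_mem_nhds (ball_mem_nhds x hr)] with y hy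
  have hxz : ∀ z ∈ X, z - x ≠ 0 := fun z hz h0 =>
    hSX.notMem_of_mem_left hx (sub_eq_zero.1 h0 ▸ hz)
  have hslit : ∀ z ∈ X, 1 + (x - y) / (z - x) ∈ Complex.slitPlane := by
    intro z hz
    apply Complex.mem_slitPlane_of_norm_lt_one
    have hrz : r ≤ ‖z - x‖ := by
      by_contra! hlt
      exact hball (by simpa [dist_eq_norm] using hlt) hz
    rw [norm_div, div_lt_one (hr.trans_le hrz), norm_sub_rev]
    exact (by simpa [dist_eq_norm] using hy : ‖y - x‖ < r).trans_le hrz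
  refine HasLogRatio.symm ⟨fun z => Complex.log (1 + (x - y) / (z - x)), ?_, fun z hz => ?_⟩
  · refine ContinuousOn.clog ?_ hslit
    exact continuousOn_const.add (continuousOn_const.div (by fun_prop) hxz)
  · rw [Complex.exp_log (Complex.slitPlane_ne_zero (hslit z hz))]
    field_simp [hxz z hz]
    ring

/-- Janiszewski's theorem, in terms of logarithms. -/
lemma HasLogRatio.union {X Y : Set ℂ} {u v : ℂ} (hX : IsClosed X) (hY : IsClosed Y)
    (hXY : IsPreconnected (X ∩ Y)) (hv : v ∉ X ∩ Y)
    (h₁ : HasLogRatio X u v) (h₂ : HasLogRatio Y u v) : HasLogRatio (X ∪ Y) u v := by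
  classical
  obtain ⟨g, hg, hgz⟩ := h₁
  obtain ⟨k, hk, hkz⟩ := h₂
  have hexp : ∀ z ∈ X ∩ Y, Complex.exp (g z - k z) = 1 := by
    intro z hz
    have hzv : z - v ≠ 0 := fun h0 => hv (sub_eq_zero.1 h0 ▸ hz)
    rw [Complex.exp_sub, div_eq_one_iff_eq (Complex.exp_ne_zero _)]
    exact mul_right_cancel₀ hzv ((hgz z hz.1).trans (hkz z hz.2).symm)
  obtain ⟨c, hc1, hc⟩ : ∃ c, Complex.exp c = 1 ∧ ∀ z ∈ X ∩ Y, g z = k z + c := by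
    rcases (X ∩ Y).eq_empty_or_nonempty with h0 | ⟨w, hw⟩
    · exact ⟨0, Complex.exp_zero, by simp [h0]⟩
    · refine ⟨g w - k w, hexp w hw, fun z hz => ?_⟩
      have := hXY.eq_of_exp_eq (d := fun z => g z - k z)
        ((hg.mono inter_subset_left).sub (hk.mono inter_subset_right))
        (fun x hx y hy => (hexp x hx).trans (hexp y hy).symm) hz hw
      rw [← this]
      ring
  refine ⟨fun z => if z ∈ X then g z else k z + c, ?_, fun z hz => ?_⟩
  · refine ContinuousOn.union_of_isClosed (hg.congr fun z hz => if_pos hz) ?_ hX hY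
    refine (hk.add (continuousOn_const (c := c))).congr fun z hz => ?_
    by_cases hzX : z ∈ X
    · simp [hzX, hc z ⟨hzX, hz⟩]
    · simp [hzX]
  · by_cases hzX : z ∈ X
    · simpa [hzX] using hgz z hzX
    · simpa [hzX, Complex.exp_add, hc1] using hkz z (hz.resolve_left hzX)

lemma ContinuousOn.of_comp_image {α β γ : Type*} [TopologicalSpace α] [TopologicalSpace β]
    [TopologicalSpace γ] [T2Space β] {K : Set α} (hK : IsCompact K) {f : α → β}
    (hf : ContinuousOn f K) {h : β → γ} (hh : ContinuousOn (h ∘ f) K) :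
    ContinuousOn h (f '' K) := by
  rw [continuousOn_iff_isClosed] at hh ⊢
  intro C hC
  obtain ⟨T, hT, hTK⟩ := hh C hC
  have hcomp : IsCompact (h ∘ f ⁻¹' C ∩ K) := hTK ▸ hK.inter_left hT
  refine ⟨f '' (h ∘ f ⁻¹' C ∩ K), (hcomp.image_of_continuousOn
    (hf.mono inter_subset_right)).isClosed, ?_⟩
  ext z
  constructor
  · rintro ⟨hz, x, hx, rfl⟩
    exact ⟨⟨x, ⟨hz, hx⟩, rfl⟩, x, hx, rfl⟩
  · rintro ⟨⟨x, ⟨hz, hx⟩, rfl⟩, hy⟩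
    exact ⟨hz, hy⟩

lemma Complex.exists_continuous_log {α : Type*} [TopologicalSpace α] [SimplyConnectedSpace α]
    [LocallyPathConnectedSpace α] {F : α → ℂ} (hF : Continuous F) (h0 : ∀ x, F x ≠ 0) :
    ∃ g : α → ℂ, Continuous g ∧ ∀ x, Complex.exp (g x) = F x := by
  obtain ⟨x₀⟩ : Nonempty α := inferInstance
  obtain ⟨g, ⟨-, hg⟩, -⟩ := Complex.isCoveringMapOn_exp.existsUnique_continuousMap_lifts
    ⟨F, hF⟩ (Complex.exp_log (h0 x₀)) h0
  exact ⟨g, g.continuous, fun x => congrFun hg x⟩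

/-- A Jordan arc does not separate the plane. -/
lemma hasLogRatio_arc {f : ℝ → ℂ} {a b : ℝ} (hab : a ≤ b) (hf : ContinuousOn f (Icc a b))
    (hinj : InjOn f (Icc a b)) {u v : ℂ} (hu : u ∉ f '' Icc a b) (hv : v ∉ f '' Icc a b) :
    HasLogRatio (f '' Icc a b) u v := by
  have hu' : ∀ x ∈ Icc a b, f x - u ≠ 0 := fun x hx h0 => hu ⟨x, hx, sub_eq_zero.1 h0⟩
  have hv' : ∀ x ∈ Icc a b, f x - v ≠ 0 := fun x hx h0 => hv ⟨x, hx, sub_eq_zero.1 h0⟩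
  have hF : ContinuousOn (fun x => (f x - u) / (f x - v)) (Icc a b) :=
    (hf.sub continuousOn_const).div (hf.sub continuousOn_const) hv'
  obtain ⟨k, hk, hkF⟩ := Complex.exists_continuous_log
    (F := IccExtend hab ((Icc a b).domRestrict fun x => (f x - u) / (f x - v)))
    hF.domRestrict.Icc_extend'
    (fun x => div_ne_zero (hu' _ (projIcc a b hab x).2) (hv' _ (projIcc a b hab x).2))
  have hinv := hinj.leftInvOn_invFunOn
  refine ⟨k ∘ Function.invFunOn f (Icc a b), ContinuousOn.of_comp_image isCompact_Icc hf
    (hk.continuousOn.congr fun x hx => ?_), ?_⟩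
  · simp [hinv hx]
  · rintro _ ⟨x, hx, rfl⟩
    rw [Function.comp_apply, hinv hx, hkF, IccExtend_of_mem hab _ hx]
    exact div_mul_cancel₀ _ (hv' x hx)

lemma Complex.not_exists_log_on_circle {c : ℂ} {R : ℝ} (hR : 0 < R) {h : ℂ → ℂ}
    (hh : Continuous h) : ¬ ∀ z ∈ sphere c R, Complex.exp (h z) = z - c := by
  intro H
  let z : ℝ → ℂ := fun t => c + R * Complex.exp (t * Complex.I)
  have hz : ∀ t, Complex.exp (h (z t)) = R * Complex.exp (t * Complex.I) := by
    intro t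
    rw [H (z t) (by simp [z, Complex.norm_exp_ofReal_mul_I, abs_of_pos hR])]
    simp [z]
  have hexp : ∀ t : ℝ, Complex.exp (h (z t) - t * Complex.I) = R := by
    intro t
    rw [Complex.exp_sub, hz, mul_div_cancel_right₀ _ (Complex.exp_ne_zero _)]
  have hd := isPreconnected_univ.eq_of_exp_eq (d := fun t : ℝ => h (z t) - t * Complex.I)
    (by fun_prop) (fun x _ y _ => (hexp x).trans (hexp y).symm)
    (mem_univ 0) (mem_univ (2 * Real.pi))
  have hper : z (2 * Real.pi) = z 0 := by simp [z]
  simp only [hper] at hd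
  push_cast at hd
  exact Complex.two_pi_I_ne_zero (by linear_combination hd)

/-- The boundary of a bounded open set separates its points from the points outside. -/
lemma not_hasLogRatio_of_frontier_subset {U X : Set ℂ} (hU : Bornology.IsBounded U)
    (hX : IsClosed X) (hUX : frontier U ⊆ X) {u v : ℂ} (hu : u ∈ U)
    (hv : v ∉ U) : ¬ HasLogRatio X u v := by
  classical
  rintro ⟨g, hg, hgz⟩
  obtain ⟨k, hk⟩ := ContinuousMap.exists_restrict_eq hX ⟨X.domRestrict g, hg.domRestrict⟩
  have hkg : ∀ z ∈ X, k z = g z := fun z hz => DFunLike.congr_fun hk ⟨z, hz⟩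
  obtain ⟨h, hh, hhF⟩ := Complex.exists_continuous_log
    (F := fun z => if z ∈ U then Complex.exp (k z) * (z - v) else z - u)
    (Continuous.if (fun z hz => by rw [hkg z (hUX hz), hgz z (hUX hz)])
      (by fun_prop) (by fun_prop))
    (fun z => by
      split_ifs with hz
      · exact mul_ne_zero (Complex.exp_ne_zero _) (sub_ne_zero.2 fun h0 => hv (h0 ▸ hz))
      · exact sub_ne_zero.2 fun h0 => hz (h0 ▸ hu))
  obtain ⟨R, hR, hUR⟩ := hU.subset_ball_lt 0 u
  refine Complex.not_exists_log_on_circle hR hh (c := u) fun z hz => ?_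
  rw [hhF, if_neg fun hzU => ?_]
  exact (mem_ball.1 (hUR hzU)).ne (mem_sphere.1 hz)

lemma closure_connectedComponentIn_compl_subset {Γ : Set ℂ} (hΓ : IsClosed Γ) (x : ℂ) :
    closure (connectedComponentIn Γᶜ x) ⊆ connectedComponentIn Γᶜ x ∪ Γ := by
  intro p hp
  by_contra! hp'
  rw [mem_union, not_or] at hp'
  obtain ⟨w, hw, hwx⟩ := mem_closure_iff.1 hp _ hΓ.isOpen_compl.connectedComponentIn
    (mem_connectedComponentIn (F := Γᶜ) hp'.2)
  apply hp'.1
  rw [connectedComponentIn_eq hwx, ← connectedComponentIn_eq hw]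
  exact mem_connectedComponentIn hp'.2

/-- A Jordan curve with a marked point `p`, parametrized by `[0, 2π]` starting at `p`. -/
lemma IsJordanCurve.exists_param {Γ : Set ℂ} (hΓ : IsJordanCurve Γ) {p : ℂ} (hp : p ∈ Γ) :
    ∃ γ : ℝ → ℂ, Continuous γ ∧ Γ = γ '' Icc 0 (2 * Real.pi) ∧ γ 0 = p ∧
      γ (2 * Real.pi) = p ∧ ∀ t ∈ Ioo 0 (2 * Real.pi), γ t ≠ p := by
  obtain ⟨φ, hφ, hinj, rfl⟩ := hΓ
  obtain ⟨w, hw, rfl⟩ := hp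
  have hw1 : ‖w‖ = 1 := by simpa using hw
  have hw0 : w ≠ 0 := norm_ne_zero_iff.1 (by simp [hw1])
  have hmem : ∀ t : ℝ, w * Complex.exp (t * Complex.I) ∈ sphere (0 : ℂ) 1 := fun t => by
    simp [hw1, Complex.norm_exp_ofReal_mul_I]
  refine ⟨fun t => φ (w * Complex.exp (t * Complex.I)), ?_, ?_, by simp, by simp, ?_⟩
  · exact hφ.comp_continuous (by fun_prop) hmem
  · refine Subset.antisymm ?_ (by rintro _ ⟨t, -, rfl⟩; exact ⟨_, hmem t, rfl⟩)
    rintro _ ⟨z, hz, rfl⟩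
    have hz1 : ‖z / w‖ = 1 := by rw [norm_div, hw1, div_one]; simpa using hz
    have harg : Complex.exp ((z / w).arg * Complex.I) = z / w := by
      have := Complex.norm_mul_exp_arg_mul_I (z / w)
      rwa [hz1, Complex.ofReal_one, one_mul] at this
    have h1 := Complex.neg_pi_lt_arg (z / w)
    have h2 := Complex.arg_le_pi (z / w)
    have hpi := Real.pi_pos
    rcases le_total 0 (z / w).arg with h0 | h0
    · exact ⟨_, ⟨h0, by linarith⟩, by simp [harg, mul_div_cancel₀ _ hw0]⟩
    · refine ⟨(z / w).arg + 2 * Real.pi, ⟨by linarith, by linarith⟩, ?_⟩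
      simp [add_mul, Complex.exp_add, harg, mul_div_cancel₀ _ hw0]
  · intro t ht h
    have h1 := hinj (hmem t) hw h
    rw [mul_eq_left₀ hw0, Complex.exp_eq_one_iff] at h1
    obtain ⟨n, hn⟩ := h1
    have ht' : t = n * (2 * Real.pi) := by
      simpa using congrArg Complex.im hn
    have hpos := Real.two_pi_pos
    have hn0 : (0 : ℝ) < n := by
      by_contra! hle
      nlinarith [ht.1]
    have hn1 : (n : ℝ) < 1 := by
      by_contra! hle
      nlinarith [ht.2]
    norm_cast at hn0 hn1
    omega

/-- Two points of a Jordan curve lie on a compact connected subset of it avoiding a third. -/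
lemma IsJordanCurve.exists_subarc {Γ : Set ℂ} (hΓ : IsJordanCurve Γ) {p a b : ℂ} (hp : p ∈ Γ)
    (ha : a ∈ Γ) (hb : b ∈ Γ) (hap : a ≠ p) (hbp : b ≠ p) :
    ∃ B ⊆ Γ, IsCompact B ∧ IsPreconnected B ∧ a ∈ B ∧ b ∈ B ∧ p ∉ B := by
  obtain ⟨γ, hγ, rfl, h0, h1, hne⟩ := hΓ.exists_param hp
  have key : ∀ x ∈ Icc 0 (2 * Real.pi), γ x ≠ p → x ∈ Ioo 0 (2 * Real.pi) := fun x hx hxp =>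
    ⟨hx.1.lt_of_ne (by rintro rfl; exact hxp h0), hx.2.lt_of_ne (by rintro rfl; exact hxp h1)⟩
  obtain ⟨s, hs, rfl⟩ := ha
  obtain ⟨t, ht, rfl⟩ := hb
  have hsub : uIcc s t ⊆ Ioo 0 (2 * Real.pi) :=
    ordConnected_Ioo.uIcc_subset (key s hs hap) (key t ht hbp)
  refine ⟨γ '' uIcc s t, image_mono (hsub.trans Ioo_subset_Icc_self),
    isCompact_uIcc.image hγ, isPreconnected_uIcc.image γ hγ.continuousOn,
    mem_image_of_mem _ left_mem_uIcc, mem_image_of_mem _ right_mem_uIcc, ?_⟩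
  rintro ⟨x, hx, hxp⟩
  exact hne x (hsub hx) hxp

lemma IsCrosscutSep.symm {G J U V : Set ℂ} (h : IsCrosscutSep G J U V) :
    IsCrosscutSep G J V U := by
  obtain ⟨hJ, hU, hV, hUV, hG⟩ := h
  exact ⟨hJ, hV, hU, hUV.symm, hG.trans (union_comm U V)⟩

lemma IsCrosscutSep.frontier_subset {G J U V Γ : Set ℂ} (h : IsCrosscutSep G J U V)
    (hΓ : closure G ⊆ G ∪ Γ) : frontier U ⊆ Γ ∪ J := by
  obtain ⟨-, hU, hV, hUV, hG⟩ := h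
  intro p hp
  by_contra! hp'
  rw [mem_union, not_or] at hp'
  have hUG : U ⊆ G := fun z hz => (hG.ge (Or.inl hz)).1
  have hpG : p ∈ G := (hΓ (closure_mono hUG hp.1)).resolve_right hp'.1
  rw [hU.1.frontier_eq] at hp
  have hpV : p ∈ V := (hG.le ⟨hpG, hp'.2⟩).resolve_left hp.2
  obtain ⟨w, hwV, hwU⟩ := mem_closure_iff.1 hp.1 V hV.1 hpV
  exact hUV.notMem_of_mem_left hwU hwV

/-- A crosscut lies in the boundary of each of the two sides. -/
lemma IsCrosscutSep.subset_frontier {G J U V Γ : Set ℂ} (h : IsCrosscutSep G J U V)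
    (hb : Bornology.IsBounded G) (hGc : IsPreconnected G) (hΓ : IsClosed Γ)
    (hGΓ : Disjoint G Γ) (hcl : closure G ⊆ G ∪ Γ) :
    J ⊆ frontier U := by
  have hUfr := h.frontier_subset hcl
  obtain ⟨⟨f, ⟨hf, hinj, rfl⟩, h0, h1, hJG⟩, hU, hV, hUV, hG⟩ := h
  have hUG : U ⊆ G \ f '' Icc 0 1 := fun z hz => hG.ge (Or.inl hz)
  have hVG : V ⊆ G \ f '' Icc 0 1 := fun z hz => hG.ge (Or.inr hz)
  obtain ⟨u, hu⟩ := hU.2.nonempty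
  obtain ⟨v, hv⟩ := hV.2.nonempty
  have hint : ∀ x ∈ Ioo (0 : ℝ) 1, f x ∈ G := by
    intro x hx
    refine hJG ⟨mem_image_of_mem _ (Ioo_subset_Icc_self hx), ?_⟩
    rintro (h | h)
    · exact hx.1.ne' (hinj (Ioo_subset_Icc_self hx) (by simp) h)
    · exact hx.2.ne (hinj (Ioo_subset_Icc_self hx) (by simp) h)
  have hmain : ∀ t ∈ Ioo (0 : ℝ) 1, f t ∈ closure U := by
    intro t ht
    by_contra hq
    have hcont : ContinuousAt f t := hf.continuousAt (Icc_mem_nhds ht.1 ht.2)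
    obtain ⟨a, b, hab, habs⟩ := mem_nhds_iff_exists_Ioo_subset.1
      (Filter.inter_mem (Ioo_mem_nhds ht.1 ht.2)
        (hcont (isClosed_closure.isOpen_compl.mem_nhds hq)))
    obtain ⟨s, has, hst⟩ := exists_between hab.1
    obtain ⟨s', hts, hsb⟩ := exists_between hab.2
    have hs := (habs ⟨has, hst.trans hab.2⟩).1
    have hs' := (habs ⟨hab.1.trans hts, hsb⟩).1
    have hss : Icc 0 s ⊆ Icc (0 : ℝ) 1 := Icc_subset_Icc_right hs.2.le
    have hss' : Icc s' 1 ⊆ Icc (0 : ℝ) 1 := Icc_subset_Icc_left hs'.1.le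
    have hc : IsClosed (f '' Icc 0 s) :=
      (isCompact_Icc.image_of_continuousOn (hf.mono hss)).isClosed
    have hc' : IsClosed (f '' Icc s' 1) :=
      (isCompact_Icc.image_of_continuousOn (hf.mono hss')).isClosed
    have huΓ : ∀ w ∈ G, w ∉ Γ := fun w hw => hGΓ.notMem_of_mem_left hw
    have hlog₁ : HasLogRatio (Γ ∪ f '' Icc 0 s) u v := by
      refine HasLogRatio.union hΓ hc ?_ (fun hv' => huΓ v (hVG hv).1 hv'.1)
        (hasLogRatio_of_isPreconnected hΓ hGc hGΓ (hUG hu).1 (hVG hv).1)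
        (hasLogRatio_arc hs.1.le (hf.mono hss) (hinj.mono hss)
          (fun h => (hUG hu).2 (image_mono hss h)) (fun h => (hVG hv).2 (image_mono hss h)))
      refine Set.Subsingleton.isPreconnected (subsingleton_of_subset_singleton (a := f 0) ?_)
      rintro _ ⟨hz, x, hx, rfl⟩
      rcases hx.1.eq_or_lt with rfl | hx0
      · rfl
      · exact (huΓ _ (hint x ⟨hx0, hx.2.trans_lt hs.2⟩) hz).elim
    have hlog₂ : HasLogRatio ((Γ ∪ f '' Icc 0 s) ∪ f '' Icc s' 1) u v := by
      refine HasLogRatio.union (hΓ.union hc) hc' ?_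
        (fun hv' => (hVG hv).2 (image_mono hss' hv'.2)) hlog₁
        (hasLogRatio_arc hs'.2.le (hf.mono hss') (hinj.mono hss')
          (fun h => (hUG hu).2 (image_mono hss' h)) (fun h => (hVG hv).2 (image_mono hss' h)))
      refine Set.Subsingleton.isPreconnected (subsingleton_of_subset_singleton (a := f 1) ?_)
      rintro _ ⟨hz, x, hx, rfl⟩
      rcases hx.2.eq_or_lt with rfl | hx1
      · rfl
      · rcases hz with hz | ⟨y, hy, hyx⟩
        · exact (huΓ _ (hint x ⟨hs'.1.trans_le hx.1, hx1⟩) hz).elim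
        · have := hinj (hss hy) (hss' hx) hyx
          have h2 := hy.2
          have h3 := hx.1
          linarith
    refine not_hasLogRatio_of_frontier_subset (hb.subset (hUG.trans sdiff_subset))
      ((hΓ.union hc).union hc') ?_ hu (hUV.notMem_of_mem_right hv) hlog₂
    intro z hz
    rcases hUfr hz with hzΓ | ⟨x, hx, rfl⟩
    · exact Or.inl (Or.inl hzΓ)
    · rcases le_or_gt x s with hxs | hxs
      · exact Or.inl (Or.inr ⟨x, ⟨hx.1, hxs⟩, rfl⟩)
      · rcases le_or_gt s' x with hxs' | hxs'
        · exact Or.inr ⟨x, ⟨hxs', hx.2⟩, rfl⟩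
        · exact ((habs ⟨has.trans hxs, hxs'.trans hsb⟩).2 hz.1).elim
  rintro _ ⟨x, hx, rfl⟩
  rw [hU.1.frontier_eq]
  refine ⟨?_, fun hxU => (hUG hxU).2 ⟨x, hx, rfl⟩⟩
  have hx' : x ∈ closure (Ioo (0 : ℝ) 1) := by rwa [closure_Ioo zero_ne_one]
  have := (hf.mono (closure_Ioo zero_ne_one).subset).image_closure
  refine closure_minimal ?_ isClosed_closure (this ⟨x, hx', rfl⟩)
  rintro _ ⟨t, ht, rfl⟩
  exact hmain t ht

/-- A point of the Jordan curve off the crosscut does not lie in the closure of both sides. -/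
lemma IsCrosscutSep.frontier_inter_subset {G J U V Γ : Set ℂ} (h : IsCrosscutSep G J U V)
    (hb : Bornology.IsBounded G) (hGc : IsPreconnected G) (hΓ : IsJordanCurve Γ)
    (hΓc : IsClosed Γ) (hGΓ : Disjoint G Γ) (hcl : closure G ⊆ G ∪ Γ)
    (hfr : frontier G ⊆ Γ) : frontier U ∩ frontier V ⊆ J := by
  have hUfr := h.frontier_subset hcl
  obtain ⟨⟨f, ⟨hf, hinj, rfl⟩, h0, h1, hJG⟩, hU, hV, hUV, hG⟩ := h
  rintro p ⟨hpU, hpV⟩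
  by_contra hpJ
  have hUG : U ⊆ G := fun z hz => (hG.ge (Or.inl hz)).1
  have hVG : V ⊆ G := fun z hz => (hG.ge (Or.inr hz)).1
  have hpΓ : p ∈ Γ := (hUfr hpU).resolve_right hpJ
  obtain ⟨B, hBΓ, hBc, hBconn, h0B, h1B, hpB⟩ := hΓ.exists_subarc hpΓ (hfr h0) (hfr h1)
    (fun h => hpJ ⟨0, by simp, h⟩) (fun h => hpJ ⟨1, by simp, h⟩)
  have hJBc : IsClosed (f '' Icc 0 1 ∪ B) :=
    (isCompact_Icc.image_of_continuousOn hf).isClosed.union hBc.isClosed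
  obtain ⟨r, hr, hball⟩ := Metric.isOpen_iff.1 hJBc.isOpen_compl p
    (fun h => h.elim hpJ hpB)
  obtain ⟨u, hur, hu⟩ := mem_closure_iff.1 hpU.1 _ isOpen_ball (mem_ball_self hr)
  obtain ⟨v, hvr, hv⟩ := mem_closure_iff.1 hpV.1 _ isOpen_ball (mem_ball_self hr)
  have hint : Γ ∩ (f '' Icc 0 1 ∪ B) = B := by
    refine Subset.antisymm ?_ fun z hz => ⟨hBΓ hz, Or.inr hz⟩
    rintro z ⟨hzΓ, hzJ | hzB⟩
    · by_contra hzB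
      refine hGΓ.notMem_of_mem_right hzΓ (hJG ⟨hzJ, ?_⟩)
      rintro (rfl | rfl)
      exacts [hzB h0B, hzB h1B]
    · exact hzB
  have hlog : HasLogRatio (Γ ∪ (f '' Icc 0 1 ∪ B)) u v :=
    HasLogRatio.union hΓc hJBc (hint.symm ▸ hBconn :)
      (fun h => hGΓ.notMem_of_mem_left (hVG hv) h.1)
      (hasLogRatio_of_isPreconnected hΓc hGc hGΓ (hUG hu) (hVG hv))
      (hasLogRatio_of_isPreconnected hJBc (convex_ball p r).isPreconnected
        (disjoint_left.2 fun z hz => hball hz) hur hvr)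
  exact not_hasLogRatio_of_frontier_subset (hb.subset hUG) (hΓc.union hJBc)
    (hUfr.trans (union_subset_union_right _ subset_union_left)) hu
    (hUV.notMem_of_mem_right hv) hlog

/-- A Jordan domain has no multiple boundary points: for any crosscut
separation `G \ J = U ∪ V` one has `∂U ∩ ∂V = J`. -/
theorem jordan_no_multiple_boundary_points (G : Set ℂ) (hG : IsJordanDomain G) :
    (∀ J U V : Set ℂ, IsCrosscutSep G J U V → frontier U ∩ frontier V = J) ∧
    (∀ a ∈ frontier G, ¬ IsMultiplePt G a) := by
  obtain ⟨hb, Γ, hΓ, x, hx, rfl⟩ := hG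
  have hΓc : IsClosed Γ := by
    obtain ⟨φ, hφ, -, rfl⟩ := hΓ
    exact ((isCompact_sphere _ _).image_of_continuousOn hφ).isClosed
  have hGo : IsOpen (connectedComponentIn Γᶜ x) := hΓc.isOpen_compl.connectedComponentIn
  have hGc : IsPreconnected (connectedComponentIn Γᶜ x) := isPreconnected_connectedComponentIn
  have hGΓ : Disjoint (connectedComponentIn Γᶜ x) Γ :=
    disjoint_left.2 fun z hz => connectedComponentIn_subset _ _ hz
  have hcl := closure_connectedComponentIn_compl_subset hΓc x
  have hfr : frontier (connectedComponentIn Γᶜ x) ⊆ Γ := fun z hz => by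
    rw [hGo.frontier_eq] at hz
    exact (hcl hz.1).resolve_left hz.2
  have hmain : ∀ J U V : Set ℂ, IsCrosscutSep (connectedComponentIn Γᶜ x) J U V →
      frontier U ∩ frontier V = J := fun J U V h =>
    Subset.antisymm (h.frontier_inter_subset hb hGc hΓ hΓc hGΓ hcl hfr)
      (subset_inter (h.subset_frontier hb hGc hΓc hGΓ hcl)
        (h.symm.subset_frontier hb hGc hΓc hGΓ hcl))
  refine ⟨hmain, ?_⟩
  rintro a - ⟨-, J, U, V, h, ha, haJ⟩
  exact haJ (hmain J U V h ▸ ha)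
end

section
/- There exists a Carathéodory domain G in ℂ whose Riemann map φ has a continuous extension Φ to closure(G), and such that the set of non-accessible boundary points of G has two distinct connected components E and F with Φ(E) = Φ(F), i.e., Φ takes the same constant value on E and on F. -/
open Set Topology Metric Filter

open scoped ComplexConjugate

/-- The closed horizontal strip of half-width `π / 2`; its interior is `openStrip`. -/
def closedStrip : Set ℂ := {ζ | |ζ.im| ≤ Real.pi / 2}

/-- The open horizontal strip of half-width `π / 2`. -/
def openStrip : Set ℂ := {ζ | |ζ.im| < Real.pi / 2}

lemma isOpen_openStrip : IsOpen openStrip :=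
  isOpen_lt (by fun_prop) continuous_const

lemma openStrip_subset_closedStrip : openStrip ⊆ closedStrip := fun ζ (h : |ζ.im| < Real.pi / 2) ↦
  show |ζ.im| ≤ Real.pi / 2 from h.le

lemma convex_closedStrip : Convex ℝ closedStrip := by
  have : closedStrip = Complex.imLm ⁻¹' Icc (-(Real.pi / 2)) (Real.pi / 2) := by
    ext ζ; simp [closedStrip, abs_le]
  rw [this]
  exact (convex_Icc _ _).linear_preimage _

lemma convex_openStrip : Convex ℝ openStrip := by
  have : openStrip = Complex.imLm ⁻¹' Ioo (-(Real.pi / 2)) (Real.pi / 2) := by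
    ext ζ; simp [openStrip, abs_lt]
  rw [this]
  exact (convex_Ioo _ _).linear_preimage _

/-- If `f'` has positive real part on a convex set, then `f` is strictly monotone there. -/
lemma re_sub_mul_conj_pos {K : Set ℂ} (hK : Convex ℝ K) {f f' : ℂ → ℂ}
    (hf : ∀ z ∈ K, HasDerivAt f (f' z) z) (hpos : ∀ z ∈ K, 0 < (f' z).re)
    {z w : ℂ} (hz : z ∈ K) (hw : w ∈ K) (hzw : z ≠ w) :
    0 < ((f z - f w) * conj (z - w)).re := by
  have hmem : ∀ t ∈ Icc (0 : ℝ) 1, w + t * (z - w) ∈ K := fun t ht ↦ by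
    have := hK.add_smul_sub_mem hw hz ht
    simpa using this
  have hd : ∀ t ∈ Icc (0 : ℝ) 1, HasDerivAt
      (fun t : ℝ ↦ (f (w + t * (z - w)) * conj (z - w)).re)
      ((f' (w + t * (z - w)) * (z - w) * conj (z - w)).re) t := by
    intro t ht
    have h1 : HasDerivAt (fun t : ℂ ↦ w + t * (z - w)) (z - w) (t : ℂ) := by
      simpa using ((hasDerivAt_id (t : ℂ)).mul_const (z - w)).const_add w
    exact (((hf _ (hmem t ht)).comp (t : ℂ) h1).mul_const (conj (z - w))).real_of_complex
  obtain ⟨t, ht, hslope⟩ := exists_hasDerivAt_eq_slope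
    (fun t : ℝ ↦ (f (w + t * (z - w)) * conj (z - w)).re) _ zero_lt_one
    (fun t ht ↦ (hd t ht).continuousAt.continuousWithinAt) (fun t ht ↦ hd t (Ioo_subset_Icc_self ht))
  have hn : (f' (w + t * (z - w)) * (z - w) * conj (z - w)).re
      = (f' (w + t * (z - w))).re * Complex.normSq (z - w) := by
    rw [mul_assoc, Complex.mul_conj, Complex.re_mul_ofReal]
  have h0 : 0 < Complex.normSq (z - w) := Complex.normSq_pos.2 (sub_ne_zero.2 hzw)
  have := mul_pos (hpos _ (hmem t (Ioo_subset_Icc_self ht))) h0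
  rw [← hn, hslope] at this
  simpa [sub_mul] using this

/-- The conformal map of the strip `{|Im u| < π / 2 + b}` onto the strip `{0 < Re w < 2 π}` that
has boundary value `0` at `-∞`. -/
noncomputable def spike (b : ℝ) (u : ℂ) : ℂ :=
  -Complex.I * (Complex.log ((Real.pi / 2 + b : ℝ) + Complex.I * u)
    - Complex.log ((Real.pi / 2 + b : ℝ) - Complex.I * u)) + Real.pi

section spike

variable {b : ℝ} {u : ℂ}

lemma le_re_add_I_mul (hu : u ∈ closedStrip) :
    b ≤ (((Real.pi / 2 + b : ℝ) : ℂ) + Complex.I * u).re := by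
  have := abs_le.1 (show |u.im| ≤ Real.pi / 2 from hu)
  simp; linarith

lemma le_re_sub_I_mul (hu : u ∈ closedStrip) :
    b ≤ (((Real.pi / 2 + b : ℝ) : ℂ) - Complex.I * u).re := by
  have := abs_le.1 (show |u.im| ≤ Real.pi / 2 from hu)
  simp; linarith

lemma spike_re : (spike b u).re = Complex.arg ((Real.pi / 2 + b : ℝ) + Complex.I * u)
    - Complex.arg ((Real.pi / 2 + b : ℝ) - Complex.I * u) + Real.pi := by
  simp [spike, -Complex.ofReal_add, -Complex.ofReal_div, Complex.log_im]

lemma spike_im : (spike b u).im = Real.log ‖((Real.pi / 2 + b : ℝ) : ℂ) - Complex.I * u‖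
    - Real.log ‖((Real.pi / 2 + b : ℝ) : ℂ) + Complex.I * u‖ := by
  simp [spike, -Complex.ofReal_add, -Complex.ofReal_div, Complex.log_re]

lemma hasDerivAt_spike (hb : 0 < b) (hu : u ∈ closedStrip) :
    HasDerivAt (spike b) ((((Real.pi / 2 + b : ℝ) : ℂ) + Complex.I * u)⁻¹
      + (((Real.pi / 2 + b : ℝ) : ℂ) - Complex.I * u)⁻¹) u := by
  have h1 := hb.trans_le (le_re_add_I_mul (b := b) hu)
  have h2 := hb.trans_le (le_re_sub_I_mul (b := b) hu)
  have d1 : HasDerivAt (fun u ↦ ((Real.pi / 2 + b : ℝ) : ℂ) + Complex.I * u) Complex.I u := by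
    simpa using ((hasDerivAt_id u).const_mul Complex.I).const_add ((Real.pi / 2 + b : ℝ) : ℂ)
  have d2 : HasDerivAt (fun u ↦ ((Real.pi / 2 + b : ℝ) : ℂ) - Complex.I * u) (-Complex.I) u := by
    simpa using ((hasDerivAt_id u).const_mul Complex.I).const_sub ((Real.pi / 2 + b : ℝ) : ℂ)
  have := (((d1.clog (Or.inl h1)).sub (d2.clog (Or.inl h2))).const_mul (-Complex.I)).add_const
    (Real.pi : ℂ)
  refine this.congr_deriv ?_
  simp only [div_eq_mul_inv (G := ℂ)]
  linear_combination (-((((Real.pi / 2 + b : ℝ) : ℂ) + Complex.I * u)⁻¹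
      + (((Real.pi / 2 + b : ℝ) : ℂ) - Complex.I * u)⁻¹)) * Complex.I_mul_I

lemma spike_deriv_re_pos (hb : 0 < b) (hu : u ∈ closedStrip) :
    0 < ((((Real.pi / 2 + b : ℝ) : ℂ) + Complex.I * u)⁻¹
      + (((Real.pi / 2 + b : ℝ) : ℂ) - Complex.I * u)⁻¹).re := by
  have h1 := hb.trans_le (le_re_add_I_mul (b := b) hu)
  have h2 := hb.trans_le (le_re_sub_I_mul (b := b) hu)
  rw [Complex.add_re, Complex.inv_re, Complex.inv_re]
  have n1 : ((Real.pi / 2 + b : ℝ) : ℂ) + Complex.I * u ≠ 0 :=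
    ne_of_apply_ne Complex.re h1.ne'
  have n2 : ((Real.pi / 2 + b : ℝ) : ℂ) - Complex.I * u ≠ 0 :=
    ne_of_apply_ne Complex.re h2.ne'
  exact add_pos (div_pos h1 (Complex.normSq_pos.2 n1)) (div_pos h2 (Complex.normSq_pos.2 n2))

lemma spike_conj (hb : 0 < b) (hu : u ∈ closedStrip) : spike b (conj u) = conj (spike b u) := by
  have h1 := hb.trans_le (le_re_add_I_mul (b := b) hu)
  have h2 := hb.trans_le (le_re_sub_I_mul (b := b) hu)
  have a1 : Complex.arg (((Real.pi / 2 + b : ℝ) : ℂ) + Complex.I * u) ≠ Real.pi := fun h ↦ by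
    rw [Complex.arg_eq_pi_iff] at h; linarith [h.1]
  have a2 : Complex.arg (((Real.pi / 2 + b : ℝ) : ℂ) - Complex.I * u) ≠ Real.pi := fun h ↦ by
    rw [Complex.arg_eq_pi_iff] at h; linarith [h.1]
  have e1 := Complex.log_conj _ a1
  have e2 := Complex.log_conj _ a2
  simp only [map_add, map_sub, map_mul, Complex.conj_I, Complex.conj_ofReal, neg_mul,
    ← sub_eq_add_neg, sub_neg_eq_add] at e1 e2
  simp only [spike, map_add, map_sub, map_mul, map_neg, Complex.conj_I, Complex.conj_ofReal,
    ← e1, ← e2]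
  ring

lemma Complex.arg_eq_arctan {w : ℂ} (hw : 0 < w.re) : w.arg = Real.arctan (w.im / w.re) := by
  have := abs_lt.1 (Complex.abs_arg_lt_pi_div_two_iff.2 (Or.inl hw))
  rw [← Complex.tan_arg, Real.arctan_tan this.1 this.2]

lemma spike_re_pos (hb : 0 < b) (hu : u ∈ closedStrip) : 0 < (spike b u).re := by
  have h1 := abs_lt.1 <| Complex.abs_arg_lt_pi_div_two_iff.2
    (Or.inl (hb.trans_le (le_re_add_I_mul (b := b) hu)))
  have h2 := abs_lt.1 <| Complex.abs_arg_lt_pi_div_two_iff.2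
    (Or.inl (hb.trans_le (le_re_sub_I_mul (b := b) hu)))
  rw [spike_re]; linarith

lemma spike_re_lt (hb : 0 < b) (hu : u ∈ closedStrip) : (spike b u).re < 2 * Real.pi := by
  have h1 := abs_lt.1 <| Complex.abs_arg_lt_pi_div_two_iff.2
    (Or.inl (hb.trans_le (le_re_add_I_mul (b := b) hu)))
  have h2 := abs_lt.1 <| Complex.abs_arg_lt_pi_div_two_iff.2
    (Or.inl (hb.trans_le (le_re_sub_I_mul (b := b) hu)))
  rw [spike_re]; linarith

lemma spike_re_le (hb : 0 < b) (hu : u ∈ closedStrip) (hx : u.re ≤ 0) :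
    (spike b u).re ≤ 2 * Real.arctan (u.re / (Real.pi + b)) + Real.pi := by
  have h1 := hb.trans_le (le_re_add_I_mul (b := b) hu)
  have h2 := hb.trans_le (le_re_sub_I_mul (b := b) hu)
  have hi := abs_le.1 (show |u.im| ≤ Real.pi / 2 from hu)
  rw [spike_re, Complex.arg_eq_arctan h1, Complex.arg_eq_arctan h2]
  simp only [Complex.add_re, Complex.sub_re, Complex.add_im, Complex.sub_im, Complex.ofReal_re,
    Complex.ofReal_im, Complex.I_mul_re, Complex.I_mul_im, zero_add, zero_sub, neg_div,
    Real.arctan_neg] at h1 h2 ⊢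
  have k : ∀ d, 0 < d → d ≤ Real.pi + b → Real.arctan (u.re / d)
      ≤ Real.arctan (u.re / (Real.pi + b)) := fun d hd hd' ↦ Real.arctan_mono <| by
    rw [div_le_div_iff₀ hd (by linarith)]; nlinarith
  have := k _ h1 (by linarith)
  have := k _ h2 (by linarith)
  linarith

lemma abs_log_sub_log_le {p q d : ℝ} (hd : 0 < d) (hp : d ≤ p) (hq : d ≤ q) :
    |Real.log p - Real.log q| ≤ |p - q| / d := by
  have key : ∀ p q : ℝ, d ≤ p → d ≤ q → Real.log p - Real.log q ≤ |p - q| / d := by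
    intro p q hp hq
    have hp0 := hd.trans_le hp
    have hq0 := hd.trans_le hq
    rw [← Real.log_div hp0.ne' hq0.ne']
    calc _ ≤ p / q - 1 := Real.log_le_sub_one_of_pos (by positivity)
      _ = (p - q) / q := by field_simp
      _ ≤ |p - q| / q := by gcongr; exact le_abs_self _
      _ ≤ _ := by gcongr
  rw [abs_le]
  constructor
  · have := key q p hq hp
    rw [abs_sub_comm] at this; linarith
  · exact key p q hp hq

lemma abs_spike_im_le {d : ℝ} (hb : 0 < b) (hd : 0 < d) (hu : u ∈ closedStrip)
    (h : d ≤ b ∨ d ≤ |u.re|) : |(spike b u).im| ≤ (Real.pi + 2 * b) / d := by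
  have h1 := le_re_add_I_mul (b := b) hu
  have h2 := le_re_sub_I_mul (b := b) hu
  set p := ((Real.pi / 2 + b : ℝ) : ℂ) + Complex.I * u with hp
  set q := ((Real.pi / 2 + b : ℝ) : ℂ) - Complex.I * u with hq
  have hpd : d ≤ ‖p‖ := h.elim (fun h ↦ (h.trans h1).trans (Complex.re_le_norm p)) fun h ↦ by
    have := Complex.abs_im_le_norm p
    simp [hp] at this; simpa [hp] using h.trans this
  have hqd : d ≤ ‖q‖ := h.elim (fun h ↦ (h.trans h2).trans (Complex.re_le_norm q)) fun h ↦ by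
    have := Complex.abs_im_le_norm q
    simp [hq] at this; simpa [hq] using h.trans this
  rw [spike_im]
  refine (abs_log_sub_log_le hd hqd hpd).trans ?_
  gcongr
  have := abs_norm_sub_norm_le q (-p)
  rw [norm_neg] at this
  refine this.trans ?_
  have e : q - -p = ((Real.pi + 2 * b : ℝ) : ℂ) := by
    rw [hp, hq]; push_cast; ring
  rw [e, Complex.norm_real, Real.norm_of_nonneg (by positivity)]

lemma spike_im_nonneg (hb : 0 < b) (hu : u ∈ closedStrip) (hi : 0 ≤ u.im) :
    0 ≤ (spike b u).im := by
  have h1 := hb.trans_le (le_re_add_I_mul (b := b) hu)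
  have h2 := hb.trans_le (le_re_sub_I_mul (b := b) hu)
  have n1 : ((Real.pi / 2 + b : ℝ) : ℂ) + Complex.I * u ≠ 0 :=
    ne_of_apply_ne Complex.re h1.ne'
  rw [spike_im, sub_nonneg]
  refine Real.log_le_log (norm_pos_iff.2 n1) ?_
  rw [Complex.norm_def, Complex.norm_def]
  refine Real.sqrt_le_sqrt ?_
  simp [Complex.normSq_apply] at h1 h2 ⊢
  nlinarith [Real.pi_pos]

lemma norm_spike_le {d : ℝ} (hb : 0 < b) (hb1 : b ≤ 1) (hd : 0 < d) (hu : u ∈ closedStrip)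
    (h : d ≤ b ∨ d ≤ |u.re|) : ‖spike b u‖ ≤ 2 * Real.pi + (Real.pi + 2) / d := by
  refine (Complex.norm_le_abs_re_add_abs_im _).trans (add_le_add ?_ ?_)
  · rw [abs_of_pos (spike_re_pos hb hu)]; exact (spike_re_lt hb hu).le
  · refine (abs_spike_im_le hb hd hu h).trans ?_
    gcongr; linarith

lemma tendsto_spike_re (hb : 0 < b) :
    Tendsto (fun u ↦ (spike b u).re) (comap Complex.re atBot ⊓ 𝓟 closedStrip) (𝓝 0) := by
  have hre : Tendsto Complex.re (comap Complex.re atBot ⊓ 𝓟 closedStrip) atBot :=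
    tendsto_comap.mono_left inf_le_left
  have hS : ∀ᶠ u in comap Complex.re atBot ⊓ 𝓟 closedStrip, u ∈ closedStrip :=
    mem_inf_of_right (mem_principal_self _)
  have hlim : Tendsto (fun u : ℂ ↦ 2 * Real.arctan (u.re / (Real.pi + b)) + Real.pi)
      (comap Complex.re atBot ⊓ 𝓟 closedStrip) (𝓝 0) := by
    have h1 : Tendsto (fun u : ℂ ↦ u.re / (Real.pi + b))
        (comap Complex.re atBot ⊓ 𝓟 closedStrip) atBot :=
      hre.atBot_div_const (by positivity)
    have h2 := (((Real.tendsto_arctan_atBot.mono_right nhdsWithin_le_nhds).comp h1).const_mul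
      2).add_const Real.pi
    rwa [show 2 * -(Real.pi / 2) + Real.pi = 0 by ring] at h2
  refine tendsto_of_tendsto_of_tendsto_of_le_of_le' tendsto_const_nhds hlim ?_ ?_
  · filter_upwards [hS] with u hu using (spike_re_pos hb hu).le
  · filter_upwards [hS, hre.eventually (eventually_le_atBot 0)] with u hu h0
    exact spike_re_le hb hu h0

lemma tendsto_spike (hb : 0 < b) :
    Tendsto (spike b) (comap Complex.re atBot ⊓ 𝓟 closedStrip) (𝓝 0) := by
  have hre : Tendsto Complex.re (comap Complex.re atBot ⊓ 𝓟 closedStrip) atBot :=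
    tendsto_comap.mono_left inf_le_left
  have hS : ∀ᶠ u in comap Complex.re atBot ⊓ 𝓟 closedStrip, u ∈ closedStrip :=
    mem_inf_of_right (mem_principal_self _)
  have him : Tendsto (fun u ↦ (spike b u).im) (comap Complex.re atBot ⊓ 𝓟 closedStrip) (𝓝 0) := by
    have hlim := (tendsto_abs_atBot_atTop.comp hre).const_div_atTop (Real.pi + 2 * b)
    refine squeeze_zero_norm' ?_ hlim
    filter_upwards [hS, hre.eventually (eventually_lt_atBot 0)] with u hu h0
    exact abs_spike_im_le hb (abs_pos.2 h0.ne) hu (Or.inr le_rfl)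
  have := ((Complex.continuous_ofReal.tendsto 0).comp (tendsto_spike_re hb)).add
    (((Complex.continuous_ofReal.tendsto 0).comp him).mul_const Complex.I)
  simpa [Function.comp_def, Complex.re_add_im] using this

end spike

/-- The `n`-th summand of `stripMap`: a spike of width comparable to `2⁻ⁿ` and height at least one
over each of the points `-n ± i π / 2`. -/
noncomputable def stripTerm (n : ℕ) (ζ : ℂ) : ℂ :=
  ((1 / 2 : ℝ) ^ n : ℝ) * spike (Real.exp (-2 ^ n)) (ζ + n)

/-- A conformal map of the strip whose boundary values oscillate at `-∞` and whose restrictions to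
suitable vertical segments tend to zero there. -/
noncomputable def stripMap (ζ : ℂ) : ℂ := Complex.exp (ζ / 2) + ∑' n, stripTerm n ζ

section stripMap

variable {ζ : ℂ}

lemma add_natCast_mem_closedStrip (hζ : ζ ∈ closedStrip) (n : ℕ) : ζ + n ∈ closedStrip := by
  simpa [closedStrip] using hζ

lemma exp_neg_two_pow_le_one (n : ℕ) : Real.exp (-2 ^ n) ≤ 1 := by
  rw [Real.exp_le_one_iff, neg_nonpos]; positivity

lemma norm_stripTerm_le {d : ℝ} {n : ℕ} (hd : 0 < d) (hζ : ζ ∈ closedStrip)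
    (h : d ≤ Real.exp (-2 ^ n) ∨ d ≤ |ζ.re + n|) :
    ‖stripTerm n ζ‖ ≤ (1 / 2 : ℝ) ^ n * (2 * Real.pi + (Real.pi + 2) / d) := by
  rw [stripTerm, norm_mul, Complex.norm_real, Real.norm_of_nonneg (by positivity)]
  gcongr
  exact norm_spike_le (Real.exp_pos _) (exp_neg_two_pow_le_one n) hd
    (add_natCast_mem_closedStrip hζ n) (by simpa using h)

lemma norm_stripTerm_le_of_re {N : ℕ} (hζ : ζ ∈ closedStrip) (hN : 1 - N ≤ ζ.re) (n : ℕ) :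
    ‖stripTerm n ζ‖ ≤
      (1 / 2 : ℝ) ^ n * (2 * Real.pi + (Real.pi + 2) / Real.exp (-2 ^ N)) := by
  refine norm_stripTerm_le (Real.exp_pos _) hζ ?_
  rcases le_or_gt n N with h | h
  · left
    gcongr
    norm_num
  · right
    have : (N : ℝ) + 1 ≤ n := by exact_mod_cast h
    exact (exp_neg_two_pow_le_one N).trans (le_trans (by linarith) (le_abs_self _))

lemma summable_geometric_mul (K : ℝ) : Summable fun n : ℕ ↦ (1 / 2 : ℝ) ^ n * K :=
  summable_geometric_two.mul_right K

lemma exists_one_sub_natCast_lt (x : ℝ) : ∃ N : ℕ, 1 - (N : ℝ) < x := by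
  obtain ⟨N, hN⟩ := exists_nat_gt (1 - x)
  exact ⟨N, by linarith⟩

lemma summable_stripTerm (hζ : ζ ∈ closedStrip) : Summable fun n ↦ stripTerm n ζ := by
  obtain ⟨N, hN⟩ := exists_one_sub_natCast_lt ζ.re
  exact .of_norm_bounded (summable_geometric_mul _) (norm_stripTerm_le_of_re hζ hN.le)

lemma hasDerivAt_stripTerm (n : ℕ) (hζ : ζ ∈ closedStrip) :
    ∃ d : ℂ, 0 < d.re ∧ HasDerivAt (stripTerm n) d ζ := by
  have hζ' := add_natCast_mem_closedStrip hζ n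
  refine ⟨_, ?_, ((hasDerivAt_spike (Real.exp_pos (-2 ^ n)) hζ').comp_add_const ζ (n : ℂ)).const_mul
    (((1 / 2 : ℝ) ^ n : ℝ) : ℂ)⟩
  rw [Complex.re_ofReal_mul]
  exact mul_pos (by positivity) (spike_deriv_re_pos (Real.exp_pos _) hζ')

lemma deriv_stripTerm_re_pos (n : ℕ) (hζ : ζ ∈ closedStrip) : 0 < (deriv (stripTerm n) ζ).re := by
  obtain ⟨d, hd, h⟩ := hasDerivAt_stripTerm n hζ
  rwa [h.deriv]

lemma differentiableAt_stripTerm (n : ℕ) (hζ : ζ ∈ closedStrip) :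
    DifferentiableAt ℂ (stripTerm n) ζ := by
  obtain ⟨d, -, h⟩ := hasDerivAt_stripTerm n hζ
  exact h.differentiableAt

lemma stripTerm_re_pos (n : ℕ) (hζ : ζ ∈ closedStrip) : 0 < (stripTerm n ζ).re := by
  rw [stripTerm, Complex.re_ofReal_mul]
  exact mul_pos (by positivity) (spike_re_pos (Real.exp_pos _) (add_natCast_mem_closedStrip hζ n))

lemma stripTerm_re_le (n : ℕ) (hζ : ζ ∈ closedStrip) :
    (stripTerm n ζ).re ≤ (1 / 2 : ℝ) ^ n * (2 * Real.pi) := by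
  rw [stripTerm, Complex.re_ofReal_mul]
  gcongr
  exact (spike_re_lt (Real.exp_pos _) (add_natCast_mem_closedStrip hζ n)).le

lemma stripTerm_im_nonneg (n : ℕ) (hζ : ζ ∈ closedStrip) (hi : 0 ≤ ζ.im) :
    0 ≤ (stripTerm n ζ).im := by
  rw [stripTerm, Complex.im_ofReal_mul]
  exact mul_nonneg (by positivity)
    (spike_im_nonneg (Real.exp_pos _) (add_natCast_mem_closedStrip hζ n) (by simpa using hi))

lemma one_le_stripTerm_im (n : ℕ) :
    1 ≤ (stripTerm n (-n + (Real.pi / 2 : ℝ) * Complex.I)).im := by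
  set b := Real.exp (-2 ^ n) with hb
  have hb0 : 0 < b := Real.exp_pos _
  have e1 : ((Real.pi / 2 + b : ℝ) : ℂ) - Complex.I * ((Real.pi / 2 : ℝ) * Complex.I)
      = ((Real.pi + b : ℝ) : ℂ) := by
    push_cast; linear_combination (-(Real.pi / 2 : ℂ)) * Complex.I_mul_I
  have e2 : ((Real.pi / 2 + b : ℝ) : ℂ) + Complex.I * ((Real.pi / 2 : ℝ) * Complex.I) = (b : ℂ) := by
    push_cast; linear_combination (Real.pi / 2 : ℂ) * Complex.I_mul_I
  rw [stripTerm, Complex.im_ofReal_mul, neg_add_cancel_comm, ← hb, spike_im, e1, e2,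
    Complex.norm_real, Complex.norm_real, Real.norm_of_nonneg hb0.le,
    Real.norm_of_nonneg (by positivity), hb, Real.log_exp, ← hb]
  have h1 : 0 ≤ Real.log (Real.pi + b) := Real.log_nonneg (by linarith [Real.pi_gt_three])
  have h2 : (1 / 2 : ℝ) ^ n * 2 ^ n = 1 := by rw [← mul_pow]; norm_num
  have h3 : (0 : ℝ) < (1 / 2) ^ n := by positivity
  nlinarith

lemma stripTerm_conj (n : ℕ) (hζ : ζ ∈ closedStrip) :
    stripTerm n (conj ζ) = conj (stripTerm n ζ) := by
  rw [stripTerm, stripTerm, map_mul, Complex.conj_ofReal,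
    ← spike_conj (Real.exp_pos _) (add_natCast_mem_closedStrip hζ n), map_add, Complex.conj_natCast]

lemma tendsto_stripTerm (n : ℕ) :
    Tendsto (stripTerm n) (comap Complex.re atBot ⊓ 𝓟 closedStrip) (𝓝 0) := by
  have hshift : Tendsto (fun ζ : ℂ ↦ ζ + n) (comap Complex.re atBot ⊓ 𝓟 closedStrip)
      (comap Complex.re atBot ⊓ 𝓟 closedStrip) := by
    refine tendsto_inf.2 ⟨tendsto_comap_iff.2 ?_, tendsto_principal.2 ?_⟩
    · have : Tendsto (fun ζ : ℂ ↦ ζ.re + n) (comap Complex.re atBot ⊓ 𝓟 closedStrip) atBot :=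
        (tendsto_atBot_add_const_right _ _ tendsto_comap).mono_left inf_le_left
      simpa [Function.comp_def] using this
    · filter_upwards [mem_inf_of_right (mem_principal_self _)] with ζ hζ
      exact add_natCast_mem_closedStrip hζ n
  have := ((tendsto_spike (Real.exp_pos (-2 ^ n))).comp hshift).const_mul
    (((1 / 2 : ℝ) ^ n : ℝ) : ℂ)
  rwa [mul_zero] at this

lemma exp_half_re_ge (hζ : ζ ∈ closedStrip) :
    Real.exp (ζ.re / 2) / 2 ≤ (Complex.exp (ζ / 2)).re := by
  have h := abs_le.1 (show |ζ.im| ≤ Real.pi / 2 from hζ)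
  have hc : 1 / 2 ≤ Real.cos (ζ.im / 2) := by
    rw [← Real.cos_abs, ← Real.cos_pi_div_three]
    refine Real.cos_le_cos_of_nonneg_of_le_pi (abs_nonneg _) ?_ (abs_le.2 ?_) <;>
    [skip; constructor] <;> linarith [Real.pi_pos]
  rw [Complex.exp_re]
  have e1 : (ζ / 2).re = ζ.re / 2 := by simp
  have e2 : (ζ / 2).im = ζ.im / 2 := by simp
  rw [e1, e2]
  nlinarith [Real.exp_pos (ζ.re / 2)]

lemma exp_half_re_le : (Complex.exp (ζ / 2)).re ≤ Real.exp (ζ.re / 2) := by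
  have := Complex.re_le_norm (Complex.exp (ζ / 2))
  rw [Complex.norm_exp] at this
  simpa using this

lemma stripMap_re (hζ : ζ ∈ closedStrip) :
    (stripMap ζ).re = (Complex.exp (ζ / 2)).re + ∑' n, (stripTerm n ζ).re := by
  rw [stripMap, Complex.add_re, Complex.re_tsum (summable_stripTerm hζ)]

lemma stripMap_im (hζ : ζ ∈ closedStrip) :
    (stripMap ζ).im = (Complex.exp (ζ / 2)).im + ∑' n, (stripTerm n ζ).im := by
  rw [stripMap, Complex.add_im, Complex.im_tsum (summable_stripTerm hζ)]

lemma stripMap_re_ge (hζ : ζ ∈ closedStrip) : Real.exp (ζ.re / 2) / 2 ≤ (stripMap ζ).re := by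
  rw [stripMap_re hζ]
  have : 0 ≤ ∑' n, (stripTerm n ζ).re := tsum_nonneg fun n ↦ (stripTerm_re_pos n hζ).le
  linarith [exp_half_re_ge hζ]

lemma tendsto_re_div_two : Tendsto (fun ζ : ℂ ↦ ζ.re / 2)
    (comap Complex.re atBot ⊓ 𝓟 closedStrip) atBot :=
  (tendsto_comap.mono_left inf_le_left).atBot_div_const two_pos

lemma tendsto_stripMap_re :
    Tendsto (fun ζ ↦ (stripMap ζ).re) (comap Complex.re atBot ⊓ 𝓟 closedStrip) (𝓝 0) := by
  have hS : ∀ᶠ u in comap Complex.re atBot ⊓ 𝓟 closedStrip, u ∈ closedStrip :=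
    mem_inf_of_right (mem_principal_self _)
  have h1 := Real.tendsto_exp_atBot.comp tendsto_re_div_two
  have h2 := tendsto_tsum_of_dominated_convergence (summable_geometric_mul (2 * Real.pi))
    (𝓕 := comap Complex.re atBot ⊓ 𝓟 closedStrip) (f := fun ζ n ↦ (stripTerm n ζ).re)
    (g := fun _ ↦ 0) (fun n ↦ (Complex.continuous_re.tendsto 0).comp (tendsto_stripTerm n))
    (by
      filter_upwards [hS] with ζ hζ n
      rw [Real.norm_of_nonneg (stripTerm_re_pos n hζ).le]
      exact stripTerm_re_le n hζ)
  have h3 := h1.add h2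
  simp only [tsum_zero, add_zero] at h3
  refine squeeze_zero' ?_ ?_ h3
  · filter_upwards [hS] with ζ hζ using (by positivity : (0 : ℝ) ≤ _).trans (stripMap_re_ge hζ)
  · filter_upwards [hS] with ζ hζ
    rw [stripMap_re hζ]
    exact add_le_add_left exp_half_re_le _

lemma tendsto_stripMap_of_re_eq :
    Tendsto stripMap (comap Complex.re atBot ⊓ 𝓟 closedStrip ⊓ 𝓟 {ζ | ∃ n : ℕ, ζ.re = -(n : ℝ) - 1 / 2})
      (𝓝 0) := by
  have hS : ∀ᶠ ζ in comap Complex.re atBot ⊓ 𝓟 closedStrip ⊓ 𝓟 {ζ | ∃ n : ℕ, ζ.re = -(n : ℝ) - 1 / 2},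
      ζ ∈ closedStrip := mem_inf_of_left (mem_inf_of_right (mem_principal_self _))
  have hD : ∀ᶠ ζ in comap Complex.re atBot ⊓ 𝓟 closedStrip ⊓ 𝓟 {ζ | ∃ n : ℕ, ζ.re = -(n : ℝ) - 1 / 2},
      ∃ n : ℕ, ζ.re = -(n : ℝ) - 1 / 2 := mem_inf_of_right (mem_principal_self _)
  have h1 : Tendsto (fun ζ : ℂ ↦ Complex.exp (ζ / 2)) (comap Complex.re atBot ⊓ 𝓟 closedStrip)
      (𝓝 0) := by
    rw [tendsto_zero_iff_norm_tendsto_zero]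
    simpa [Complex.norm_exp, Function.comp_def] using
      Real.tendsto_exp_atBot.comp tendsto_re_div_two
  have h2 := tendsto_tsum_of_dominated_convergence
    (summable_geometric_mul (2 * Real.pi + (Real.pi + 2) / (1 / 2)))
    (𝓕 := comap Complex.re atBot ⊓ 𝓟 closedStrip ⊓ 𝓟 {ζ | ∃ n : ℕ, ζ.re = -(n : ℝ) - 1 / 2})
    (f := fun ζ n ↦ stripTerm n ζ)
    (g := fun _ ↦ 0) (fun n ↦ (tendsto_stripTerm n).mono_left inf_le_left)
    (by
      filter_upwards [hS, hD] with ζ hζ ⟨m, hm⟩ n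
      refine norm_stripTerm_le (by norm_num) hζ (Or.inr ?_)
      rw [hm, le_abs']
      rcases le_or_gt n m with h | h
      · left
        have : (n : ℝ) ≤ m := by exact_mod_cast h
        linarith
      · right
        have : (m : ℝ) + 1 ≤ n := by exact_mod_cast h
        linarith)
  have h3 := (h1.mono_left inf_le_left).add h2
  rwa [tsum_zero, add_zero] at h3

lemma continuousOn_stripMap : ContinuousOn stripMap closedStrip := by
  intro ζ hζ
  obtain ⟨N, hN⟩ := exists_one_sub_natCast_lt ζ.re
  have hcont : ContinuousOn stripMap (closedStrip ∩ {ζ | 1 - (N : ℝ) < ζ.re}) := by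
    refine ContinuousOn.add (by fun_prop) (continuousOn_tsum (fun n ζ hζ ↦ ?_)
      (summable_geometric_mul _) fun n ζ hζ ↦ norm_stripTerm_le_of_re hζ.1 hζ.2.le n)
    exact (differentiableAt_stripTerm n hζ.1).continuousAt.continuousWithinAt
  exact (hcont ζ ⟨hζ, hN⟩).mono_of_mem_nhdsWithin (inter_mem self_mem_nhdsWithin
    (mem_nhdsWithin_of_mem_nhds ((isOpen_lt continuous_const Complex.continuous_re).mem_nhds hN)))

lemma exists_hasDerivAt_stripMap (hζ : ζ ∈ openStrip) :
    ∃ d : ℂ, d ≠ 0 ∧ HasDerivAt stripMap d ζ := by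
  obtain ⟨N, hN⟩ := exists_one_sub_natCast_lt ζ.re
  have hU : IsOpen (openStrip ∩ {ζ | 1 - (N : ℝ) < ζ.re}) :=
    isOpen_openStrip.inter (isOpen_lt continuous_const Complex.continuous_re)
  have hd : ∀ n, DifferentiableOn ℂ (stripTerm n) (openStrip ∩ {ζ | 1 - (N : ℝ) < ζ.re}) :=
    fun n ζ hζ ↦ (differentiableAt_stripTerm n
      (openStrip_subset_closedStrip hζ.1)).differentiableWithinAt
  have hb : ∀ n, ∀ ζ ∈ openStrip ∩ {ζ | 1 - (N : ℝ) < ζ.re}, ‖stripTerm n ζ‖ ≤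
      (1 / 2 : ℝ) ^ n * (2 * Real.pi + (Real.pi + 2) / Real.exp (-2 ^ N)) :=
    fun n ζ hζ ↦ norm_stripTerm_le_of_re (openStrip_subset_closedStrip hζ.1) hζ.2.le n
  have h1 := (Complex.differentiableOn_tsum_of_summable_norm (summable_geometric_mul _) hd hU
    hb).hasDerivAt (hU.mem_nhds ⟨hζ, hN⟩)
  have h2 := Complex.hasSum_deriv_of_summable_norm (summable_geometric_mul _) hd hU hb ⟨hζ, hN⟩
  have h3 : HasDerivAt (fun ζ : ℂ ↦ Complex.exp (ζ / 2)) (Complex.exp (ζ / 2) * (1 / 2)) ζ :=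
    ((hasDerivAt_id ζ).div_const 2).cexp
  refine ⟨_, ?_, h3.add h1⟩
  refine ne_of_apply_ne Complex.re (ne_of_gt ?_)
  have h4 : 0 ≤ (deriv (fun w ↦ ∑' n, stripTerm n w) ζ).re :=
    (Complex.hasSum_re h2).nonneg fun n ↦
      (deriv_stripTerm_re_pos n (openStrip_subset_closedStrip hζ)).le
  have h5 : 0 < (Complex.exp (ζ / 2)).re :=
    (by positivity : (0 : ℝ) < _).trans_le (exp_half_re_ge (openStrip_subset_closedStrip hζ))
  have h6 : (Complex.exp (ζ / 2) * (1 / 2)).re = (Complex.exp (ζ / 2)).re / 2 := by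
    simp [Complex.mul_re]; ring
  rw [Complex.add_re, h6, Complex.zero_re]
  linarith

lemma injOn_stripMap : InjOn stripMap closedStrip := by
  intro z hz w hw h
  by_contra hzw
  have hE := re_sub_mul_conj_pos convex_closedStrip (f := fun ζ ↦ Complex.exp (ζ / 2))
    (f' := fun ζ ↦ Complex.exp (ζ / 2) * (1 / 2)) (fun ζ _ ↦ ((hasDerivAt_id ζ).div_const 2).cexp)
    (fun ζ hζ ↦ by
      have := (by positivity : (0 : ℝ) < _).trans_le (exp_half_re_ge hζ)
      simp only [one_div, Complex.mul_re]
      simpa using this) hz hw hzw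
  have hT : HasSum (fun n ↦ ((stripTerm n z - stripTerm n w) * conj (z - w)).re)
      (((∑' n, stripTerm n z) - ∑' n, stripTerm n w) * conj (z - w)).re :=
    Complex.hasSum_re
      (((summable_stripTerm hz).hasSum.sub (summable_stripTerm hw).hasSum).mul_right _)
  have hT0 := hT.nonneg fun n ↦ (re_sub_mul_conj_pos convex_closedStrip (f := stripTerm n)
    (f' := deriv (stripTerm n)) (fun ζ hζ ↦ (differentiableAt_stripTerm n hζ).hasDerivAt)
    (fun ζ hζ ↦ deriv_stripTerm_re_pos n hζ) hz hw hzw).le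
  have hsum := add_pos_of_pos_of_nonneg hE hT0
  rw [← Complex.add_re, ← add_mul] at hsum
  have : Complex.exp (z / 2) - Complex.exp (w / 2) + (∑' n, stripTerm n z - ∑' n, stripTerm n w)
      = 0 := by
    unfold stripMap at h
    linear_combination h
  simp [this] at hsum

lemma stripMap_conj (hζ : ζ ∈ closedStrip) : stripMap (conj ζ) = conj (stripMap ζ) := by
  rw [stripMap, stripMap, map_add, Complex.conj_tsum, ← Complex.exp_conj]
  simp [stripTerm_conj _ hζ, map_div₀, Complex.conj_ofNat]

lemma ofReal_mem_openStrip (x : ℝ) : (x : ℂ) ∈ openStrip := by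
  simp [openStrip, Real.pi_pos]

lemma stripMap_ofReal_im (x : ℝ) : (stripMap x).im = 0 := by
  have hx := openStrip_subset_closedStrip (ofReal_mem_openStrip x)
  rw [← Complex.conj_eq_iff_im, ← stripMap_conj hx, Complex.conj_ofReal]

lemma exists_stripMap_im_eq_one (n : ℕ) :
    ∃ ζ ∈ closedStrip, ζ.re = -n ∧ (stripMap ζ).im = 1 := by
  have hpi := Real.pi_pos
  have hmem : ∀ y ∈ Icc (0 : ℝ) (Real.pi / 2), -n + y * Complex.I ∈ closedStrip := fun y hy ↦ by
    simpa [closedStrip, abs_of_nonneg hy.1] using hy.2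
  have hcont : ContinuousOn (fun y : ℝ ↦ (stripMap (-n + y * Complex.I)).im)
      (Icc 0 (Real.pi / 2)) :=
    Complex.continuous_im.comp_continuousOn (continuousOn_stripMap.comp (by fun_prop) hmem)
  have h0 : (stripMap (-n + (0 : ℝ) * Complex.I)).im = 0 := by
    simpa using stripMap_ofReal_im (-n)
  have h1 : 1 ≤ (stripMap (-n + (Real.pi / 2 : ℝ) * Complex.I)).im := by
    have hm := hmem (Real.pi / 2) ⟨by positivity, le_rfl⟩
    rw [stripMap_im hm]
    have hs := (Complex.hasSum_im (summable_stripTerm hm).hasSum).summable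
    have hle := hs.le_tsum n fun m _ ↦ stripTerm_im_nonneg m hm (by simp; positivity)
    have he : 0 ≤ (Complex.exp ((-n + (Real.pi / 2 : ℝ) * Complex.I) / 2)).im := by
      rw [Complex.exp_im]
      refine mul_nonneg (Real.exp_pos _).le (Real.sin_nonneg_of_nonneg_of_le_pi ?_ ?_)
      all_goals simp; try linarith
    linarith [one_le_stripTerm_im n]
  obtain ⟨y, hy, hy1⟩ := intermediate_value_Icc (by positivity) hcont
    (show (1 : ℝ) ∈ Icc _ _ from ⟨by rw [h0]; exact zero_le_one, h1⟩)
  exact ⟨_, hmem y hy, by simp, hy1⟩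

end stripMap

/-- The image of the open strip under `stripMap`. -/
def stripDomain : Set ℂ := stripMap '' openStrip

open Classical in
/-- The composition of `exp` with the inverse of `stripMap`, extended by zero outside the image of
the closed strip. -/
noncomputable def halfPlaneMap (w : ℂ) : ℂ :=
  if w ∈ stripMap '' closedStrip then Complex.exp (Function.invFunOn stripMap closedStrip w) else 0

lemma halfPlaneMap_stripMap {ζ : ℂ} (hζ : ζ ∈ closedStrip) :
    halfPlaneMap (stripMap ζ) = Complex.exp ζ := by
  rw [halfPlaneMap, if_pos (mem_image_of_mem _ hζ), injOn_stripMap.leftInvOn_invFunOn hζ]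

lemma norm_halfPlaneMap_le (w : ℂ) : ‖halfPlaneMap w‖ ≤ (2 * w.re) ^ 2 := by
  by_cases h : w ∈ stripMap '' closedStrip
  · obtain ⟨ζ, hζ, rfl⟩ := h
    rw [halfPlaneMap_stripMap hζ, Complex.norm_exp]
    have h1 := stripMap_re_ge hζ
    calc Real.exp ζ.re = Real.exp (ζ.re / 2) ^ 2 := by
          rw [← Real.exp_nat_mul]; congr 1; push_cast; ring
      _ ≤ _ := by gcongr; linarith
  · rw [halfPlaneMap, if_neg h, norm_zero]; positivity

lemma stripMap_re_pos {ζ : ℂ} (hζ : ζ ∈ closedStrip) : 0 < (stripMap ζ).re :=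
  (by positivity : (0 : ℝ) < _).trans_le (stripMap_re_ge hζ)

lemma closure_openStrip : closure openStrip = closedStrip := by
  have h1 : openStrip = Complex.im ⁻¹' Ioo (-(Real.pi / 2)) (Real.pi / 2) := by
    ext ζ; simp [openStrip, abs_lt]
  have h2 : closedStrip = Complex.im ⁻¹' Icc (-(Real.pi / 2)) (Real.pi / 2) := by
    ext ζ; simp [closedStrip, abs_le]
  rw [h1, h2, Complex.closure_preimage_im, closure_Ioo]
  linarith [Real.pi_pos]

lemma stripMap_mem_closure {ζ : ℂ} (hζ : ζ ∈ closedStrip) : stripMap ζ ∈ closure stripDomain := by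
  have : ContinuousOn stripMap (closure openStrip) := by
    rw [closure_openStrip]; exact continuousOn_stripMap
  exact this.image_closure ⟨ζ, by rwa [closure_openStrip], rfl⟩

lemma stripDomain_subset : stripDomain ⊆ stripMap '' closedStrip :=
  image_mono openStrip_subset_closedStrip

lemma re_nonneg_of_mem_closure {w : ℂ} (hw : w ∈ closure stripDomain) : 0 ≤ w.re := by
  refine closure_minimal ?_ (isClosed_le continuous_const Complex.continuous_re) hw
  rintro _ ⟨ζ, hζ, rfl⟩
  exact (stripMap_re_pos (openStrip_subset_closedStrip hζ)).le

lemma exists_le_imp_of_eventually {p : ℂ → Prop}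
    (h : ∀ᶠ ζ in comap Complex.re atBot ⊓ 𝓟 closedStrip, p ζ) :
    ∃ x₀ : ℝ, ∀ ζ ∈ closedStrip, ζ.re ≤ x₀ → p ζ := by
  rw [eventually_inf_principal, eventually_comap] at h
  obtain ⟨x₀, hx₀⟩ := eventually_atBot.1 h
  exact ⟨x₀, fun ζ hζ hre ↦ hx₀ _ hre ζ rfl hζ⟩

/-- Away from the line `Re w = 0`, the image of the closed strip is locally the image of a compact
subset. -/
lemma exists_isCompact_image {w : ℂ} (hw : 0 < w.re) :
    ∃ K ⊆ closedStrip, IsCompact K ∧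
      ∃ U ∈ 𝓝 w, U ⊆ {z | 0 < z.re} ∧ U ∩ stripMap '' closedStrip ⊆ stripMap '' K := by
  obtain ⟨x₀, hx₀⟩ := exists_le_imp_of_eventually
    (tendsto_stripMap_re.eventually (gt_mem_nhds (half_pos hw)))
  refine ⟨Icc x₀ (4 * w.re) ×ℂ Icc (-(Real.pi / 2)) (Real.pi / 2), fun ζ hζ ↦ ?_,
    isCompact_Icc.reProdIm isCompact_Icc, {z | w.re / 2 < z.re ∧ z.re < 2 * w.re}, ?_,
    fun z hz ↦ (half_pos hw).trans hz.1, ?_⟩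
  · exact abs_le.2 (Complex.mem_reProdIm.1 hζ).2
  · refine IsOpen.mem_nhds ?_ ⟨by linarith, by linarith⟩
    exact (isOpen_lt continuous_const Complex.continuous_re).inter
      (isOpen_lt Complex.continuous_re continuous_const)
  · rintro _ ⟨⟨h1, h2⟩, ζ, hζ, rfl⟩
    refine mem_image_of_mem _ (Complex.mem_reProdIm.2 ⟨⟨?_, ?_⟩, abs_le.1 hζ⟩)
    · by_contra! h
      exact lt_asymm h1 (hx₀ ζ hζ h.le)
    · by_contra! h
      have := stripMap_re_ge hζ
      have := Real.add_one_le_exp (ζ.re / 2)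
      have := Real.quadratic_le_exp_of_nonneg (x := ζ.re / 2) (by linarith)
      nlinarith

lemma mem_image_of_mem_closure {w : ℂ} (hw : w ∈ closure stripDomain) (h0 : 0 < w.re) :
    w ∈ stripMap '' closedStrip := by
  obtain ⟨K, hKS, hK, U, hU, -, hUK⟩ := exists_isCompact_image h0
  have hcl : IsClosed (stripMap '' K) := (hK.image_of_continuousOn
    (continuousOn_stripMap.mono hKS)).isClosed
  have : w ∈ closure (U ∩ stripDomain) := by
    rw [mem_closure_iff_nhds] at hw ⊢
    intro t ht
    simpa [inter_assoc] using hw _ (inter_mem ht hU)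
  exact image_mono hKS (closure_minimal
    ((inter_subset_inter_right _ stripDomain_subset).trans hUK) hcl this)

lemma continuousOn_halfPlaneMap_image {K : Set ℂ} (hKS : K ⊆ closedStrip) (hK : IsCompact K) :
    ContinuousOn halfPlaneMap (stripMap '' K) := by
  have : CompactSpace K := isCompact_iff_compactSpace.1 hK
  have hcont : Continuous ((mapsTo_image stripMap K).restrict) :=
    (continuousOn_stripMap.mono hKS).mapsToRestrict _
  have hq := hcont.isClosedMap.isQuotientMap hcont
    (by rintro ⟨_, ζ, hζ, rfl⟩; exact ⟨⟨ζ, hζ⟩, rfl⟩)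
  rw [continuousOn_iff_continuous_domRestrict, hq.continuous_iff]
  have : (stripMap '' K).domRestrict halfPlaneMap ∘ (mapsTo_image stripMap K).restrict
      = fun ζ : K ↦ Complex.exp ζ := by
    ext ζ
    exact halfPlaneMap_stripMap (hKS ζ.2)
  rw [this]
  fun_prop

lemma continuousOn_halfPlaneMap : ContinuousOn halfPlaneMap (closure stripDomain) := by
  intro w hw
  rcases (re_nonneg_of_mem_closure hw).eq_or_lt with h0 | h0
  · have hval : halfPlaneMap w = 0 := by
      have := norm_halfPlaneMap_le w
      rw [← h0] at this
      simpa using this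
    rw [ContinuousWithinAt, hval]
    refine squeeze_zero_norm norm_halfPlaneMap_le ?_
    have : Tendsto (fun w : ℂ ↦ (2 * w.re) ^ 2) (𝓝 w) (𝓝 ((2 * w.re) ^ 2)) :=
      Continuous.tendsto (by fun_prop) w
    rw [← h0] at this
    simpa using this.mono_left nhdsWithin_le_nhds
  · obtain ⟨K, hKS, hK, U, hU, hpos, hUK⟩ := exists_isCompact_image h0
    have hsub : closure stripDomain ∩ U ⊆ stripMap '' K := fun z hz ↦
      hUK ⟨hz.2, mem_image_of_mem_closure hz.1 (hpos hz.2)⟩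
    exact ((continuousOn_halfPlaneMap_image hKS hK).mono hsub w
      ⟨hw, mem_of_mem_nhds hU⟩).mono_of_mem_nhdsWithin
      (inter_mem self_mem_nhdsWithin (mem_nhdsWithin_of_mem_nhds hU))

lemma halfPlaneMap_eq_zero {w : ℂ} (hw : w.re = 0) : halfPlaneMap w = 0 := by
  simpa [hw] using norm_halfPlaneMap_le w

lemma halfPlaneMap_re_nonneg (w : ℂ) : 0 ≤ (halfPlaneMap w).re := by
  by_cases h : w ∈ stripMap '' closedStrip
  · obtain ⟨ζ, hζ, rfl⟩ := h
    rw [halfPlaneMap_stripMap hζ, Complex.exp_re]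
    have := abs_le.1 (show |ζ.im| ≤ Real.pi / 2 from hζ)
    exact mul_nonneg (Real.exp_pos _).le (Real.cos_nonneg_of_mem_Icc this)
  · simp [halfPlaneMap, h]

lemma isOpenMap_stripMap : IsOpenMap (openStrip.domRestrict stripMap) := by
  rw [isOpenMap_iff_nhds_le]
  rintro ⟨ζ, hζ⟩
  obtain ⟨d, hd0, hd⟩ := exists_hasDerivAt_stripMap hζ
  have hdiff : DifferentiableOn ℂ stripMap openStrip := fun z hz ↦ by
    obtain ⟨d, -, hd⟩ := exists_hasDerivAt_stripMap hz
    exact hd.differentiableAt.differentiableWithinAt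
  have hs := (hdiff.analyticAt (isOpen_openStrip.mem_nhds hζ)).hasStrictDerivAt
  rw [hd.deriv] at hs
  have hmap := hs.map_nhds_eq hd0
  rw [← map_nhds_subtype_coe_eq_nhds hζ (isOpen_openStrip.mem_nhds hζ), map_map] at hmap
  exact hmap.ge

lemma isOpenEmbedding_stripMap : IsOpenEmbedding (openStrip.domRestrict stripMap) :=
  .of_continuous_injective_isOpenMap
    (continuousOn_stripMap.mono openStrip_subset_closedStrip).domRestrict
    (injOn_stripMap.mono openStrip_subset_closedStrip).injective isOpenMap_stripMap

lemma isOpen_stripDomain : IsOpen stripDomain := by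
  simpa [stripDomain, range_domRestrict] using isOpenEmbedding_stripMap.isOpen_range

lemma isSCDomain_stripDomain : IsSCDomain stripDomain := by
  have hne : openStrip.Nonempty := ⟨_, ofReal_mem_openStrip 0⟩
  refine ⟨isOpen_stripDomain, ⟨hne.image _, ?_⟩, ?_, ?_⟩
  · exact convex_openStrip.isPreconnected.image _
      (continuousOn_stripMap.mono openStrip_subset_closedStrip)
  · intro h
    have : (0 : ℂ) ∈ stripDomain := h ▸ mem_univ _
    obtain ⟨ζ, hζ, h0⟩ := this
    simpa [h0] using stripMap_re_pos (openStrip_subset_closedStrip hζ)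
  · have := convex_openStrip.contractibleSpace hne
    have e : openStrip ≃ₜ stripDomain := isOpenEmbedding_stripMap.isEmbedding.toHomeomorph.trans
      (Homeomorph.setCongr (range_domRestrict _ _))
    have := e.symm.contractibleSpace
    infer_instance

lemma not_isBounded_stripDomain : ¬ Bornology.IsBounded stripDomain := by
  intro h
  obtain ⟨C, hC⟩ := h.exists_norm_le
  have h1 := hC _ (mem_image_of_mem _ (ofReal_mem_openStrip (4 * C)))
  have h2 := stripMap_re_ge (openStrip_subset_closedStrip (ofReal_mem_openStrip (4 * C)))
  have h3 := Complex.re_le_norm (stripMap (4 * C : ℝ))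
  have h4 := Real.add_one_le_exp (4 * C / 2)
  rw [Complex.ofReal_re] at h2
  linarith

lemma connectedComponentIn_compl_frontier_eq {X : Type*} [TopologicalSpace X]
    {s : Set X} (hs : IsPreconnected s) (ho : IsOpen s) {x : X} (hx : x ∈ s) :
    connectedComponentIn (frontier s)ᶜ x = s := by
  have hsub : s ⊆ (frontier s)ᶜ :=
    (disjoint_frontier_iff_isOpen.2 ho).symm.subset_compl_right
  refine Subset.antisymm ?_ (hs.subset_connectedComponentIn hx hsub)
  refine isPreconnected_connectedComponentIn.subset_left_of_subset_union ho
    isClosed_closure.isOpen_compl (disjoint_compl_right.mono_left subset_closure) ?_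
    ⟨x, mem_connectedComponentIn (hsub hx), hx⟩
  refine (connectedComponentIn_subset _ _).trans fun z hz ↦ ?_
  rw [ho.frontier_eq] at hz
  by_cases h : z ∈ closure s
  · exact Or.inl (by_contra fun h' ↦ hz ⟨h, h'⟩)
  · exact Or.inr h

lemma isCaratheodoryDomain_stripDomain : IsCaratheodoryDomain stripDomain := by
  have hx := mem_image_of_mem stripMap (ofReal_mem_openStrip 0)
  have hC := connectedComponentIn_compl_frontier_eq isSCDomain_stripDomain.2.1.isPreconnected
    isOpen_stripDomain hx
  refine ⟨isSCDomain_stripDomain, _, (disjoint_frontier_iff_isOpen.2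
    isOpen_stripDomain).symm.subset_compl_right hx, ?_, ?_⟩
  · rw [hC]; exact not_isBounded_stripDomain
  · rw [hC]

/-- The Riemann map of `stripDomain`, together with its boundary values. -/
noncomputable def diskMap (w : ℂ) : ℂ := (halfPlaneMap w - 1) / (halfPlaneMap w + 1)

lemma halfPlaneMap_add_one_ne_zero (w : ℂ) : halfPlaneMap w + 1 ≠ 0 := by
  have := halfPlaneMap_re_nonneg w
  refine ne_of_apply_ne Complex.re (ne_of_gt ?_)
  rw [Complex.add_re, Complex.one_re, Complex.zero_re]
  linarith

lemma continuousOn_diskMap : ContinuousOn diskMap (closure stripDomain) :=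
  (continuousOn_halfPlaneMap.sub continuousOn_const).div
    (continuousOn_halfPlaneMap.add continuousOn_const) fun w _ ↦ halfPlaneMap_add_one_ne_zero w

lemma log_exp_of_mem_openStrip {ζ : ℂ} (hζ : ζ ∈ openStrip) :
    Complex.log (Complex.exp ζ) = ζ := by
  have := abs_lt.1 (show |ζ.im| < Real.pi / 2 from hζ)
  exact Complex.log_exp (by linarith [Real.pi_pos]) (by linarith [Real.pi_pos])

lemma stripMap_log_halfPlaneMap {w : ℂ} (hw : w ∈ stripDomain) :
    stripMap (Complex.log (halfPlaneMap w)) = w := by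
  obtain ⟨ζ, hζ, rfl⟩ := hw
  rw [halfPlaneMap_stripMap (openStrip_subset_closedStrip hζ), log_exp_of_mem_openStrip hζ]

lemma halfPlaneMap_re_pos {w : ℂ} (hw : w ∈ stripDomain) : 0 < (halfPlaneMap w).re := by
  obtain ⟨ζ, hζ, rfl⟩ := hw
  rw [halfPlaneMap_stripMap (openStrip_subset_closedStrip hζ), Complex.exp_re]
  exact mul_pos (Real.exp_pos _) (Real.cos_pos_of_mem_Ioo (abs_lt.1 hζ))

lemma exists_halfPlaneMap_eq {η : ℂ} (hη : 0 < η.re) : ∃ w ∈ stripDomain, halfPlaneMap w = η := by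
  have hS : Complex.log η ∈ openStrip := by
    simpa [openStrip, Complex.log_im] using Complex.abs_arg_lt_pi_div_two_iff.2 (Or.inl hη)
  have h0 : η ≠ 0 := ne_of_apply_ne Complex.re hη.ne'
  exact ⟨_, mem_image_of_mem _ hS,
    by rw [halfPlaneMap_stripMap (openStrip_subset_closedStrip hS), Complex.exp_log h0]⟩

lemma differentiableAt_halfPlaneMap {w : ℂ} (hw : w ∈ stripDomain) :
    DifferentiableAt ℂ halfPlaneMap w := by
  have hcont : ContinuousAt halfPlaneMap w := (continuousOn_halfPlaneMap.mono
    subset_closure).continuousAt (isOpen_stripDomain.mem_nhds hw)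
  have hinv : ∀ᶠ z in 𝓝 w, (stripMap ∘ Complex.log) (halfPlaneMap z) = z :=
    mem_of_superset (isOpen_stripDomain.mem_nhds hw) fun z hz ↦ stripMap_log_halfPlaneMap hz
  have hre := halfPlaneMap_re_pos hw
  have hlog := Complex.hasDerivAt_log (Or.inl hre)
  obtain ⟨ζ, hζ, rfl⟩ := hw
  obtain ⟨d, hd0, hd⟩ := exists_hasDerivAt_stripMap hζ
  have he := halfPlaneMap_stripMap (openStrip_subset_closedStrip hζ)
  have hd' : HasDerivAt stripMap d (Complex.log (halfPlaneMap (stripMap ζ))) := by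
    rwa [he, log_exp_of_mem_openStrip hζ]
  refine (HasDerivAt.of_local_left_inverse hcont (hd'.comp _ hlog) ?_ hinv).differentiableAt
  rw [he]
  exact mul_ne_zero hd0 (inv_ne_zero (Complex.exp_ne_zero _))

lemma norm_sub_one_div_add_one_lt_one {η : ℂ} (hη : 0 < η.re) : ‖(η - 1) / (η + 1)‖ < 1 := by
  have h0 : η + 1 ≠ 0 := ne_of_apply_ne Complex.re (ne_of_gt (by simp; linarith))
  rw [norm_div, div_lt_one (norm_pos_iff.2 h0), ← sq_lt_sq₀ (norm_nonneg _) (norm_nonneg _),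
    Complex.sq_norm, Complex.sq_norm, Complex.normSq_apply, Complex.normSq_apply]
  simp
  nlinarith

lemma isRiemannMap_diskMap : IsRiemannMap stripDomain diskMap := by
  refine ⟨?_, ?_, Subset.antisymm ?_ ?_⟩
  · refine DifferentiableOn.analyticOnNhd (fun w hw ↦ ?_) isOpen_stripDomain
    have := differentiableAt_halfPlaneMap hw
    exact ((this.sub_const 1).div (this.add_const 1)
      (halfPlaneMap_add_one_ne_zero w)).differentiableWithinAt
  · intro z hz w hw h
    rw [diskMap, diskMap, div_eq_div_iff (halfPlaneMap_add_one_ne_zero z)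
      (halfPlaneMap_add_one_ne_zero w)] at h
    rw [← stripMap_log_halfPlaneMap hz, ← stripMap_log_halfPlaneMap hw,
      show halfPlaneMap z = halfPlaneMap w by linear_combination h / 2]
  · rintro _ ⟨w, hw, rfl⟩
    rw [mem_ball_zero_iff]
    exact norm_sub_one_div_add_one_lt_one (halfPlaneMap_re_pos hw)
  · intro z hz
    rw [mem_ball_zero_iff] at hz
    have h1 : 1 - z ≠ 0 := sub_ne_zero.2 fun h ↦ by simp [← h] at hz
    have hre : 0 < ((1 + z) / (1 - z)).re := by
      have h2 : (1 + z) / (1 - z) = (1 + z) * conj (1 - z) / (Complex.normSq (1 - z) : ℂ) := by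
        rw [← Complex.mul_conj, mul_div_mul_right _ _ ((map_ne_zero _).2 h1)]
      rw [h2, Complex.div_ofReal_re]
      refine div_pos ?_ (Complex.normSq_pos.2 h1)
      have h3 : ‖z‖ ^ 2 < 1 := by nlinarith [norm_nonneg z]
      rw [Complex.sq_norm, Complex.normSq_apply] at h3
      simp
      nlinarith
    obtain ⟨w, hw, hwz⟩ := exists_halfPlaneMap_eq hre
    refine ⟨w, hw, ?_⟩
    rw [diskMap, hwz]
    field_simp
    ring

lemma mem_accessiblePts_of_arc {G : Set ℂ} (hG : IsOpen G) {b : ℂ} (hb : b ∈ frontier G)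
    {f : ℝ → ℂ} (hf : ContinuousOn f (Icc 0 1)) (hinj : InjOn f (Icc 0 1)) (h0 : f 0 = b)
    (hfG : ∀ t ∈ Ioc (0 : ℝ) 1, f t ∈ G) : b ∈ accessiblePts G := by
  have hmem : ∀ t ∈ Icc (0 : ℝ) 1, f t = b ∨ f t ∈ G := fun t ht ↦
    ht.1.eq_or_lt.imp (fun h : 0 = t ↦ h ▸ h0) fun h ↦ hfG t ⟨h, ht.2⟩
  refine ⟨hb, _, ⟨f, hf, hinj, rfl⟩, ?_, Subset.antisymm ?_ ?_⟩
  · rintro _ ⟨t, ht, rfl⟩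
    rcases hmem t ht with h | h
    · exact h ▸ frontier_subset_closure hb
    · exact subset_closure h
  · rintro _ ⟨⟨t, ht, rfl⟩, hfr⟩
    exact (hmem t ht).resolve_right fun h ↦ (hG.frontier_eq ▸ hfr).2 h
  · rintro _ rfl
    exact ⟨⟨0, left_mem_Icc.2 zero_le_one, h0⟩, hb⟩

lemma mem_frontier_of_re_eq_zero {w : ℂ} (hw : w ∈ closure stripDomain) (h0 : w.re = 0) :
    w ∈ frontier stripDomain := by
  rw [isOpen_stripDomain.frontier_eq]
  refine ⟨hw, ?_⟩
  rintro ⟨ζ, hζ, rfl⟩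
  exact (stripMap_re_pos (openStrip_subset_closedStrip hζ)).ne' h0

lemma mem_accessiblePts_of_re_pos {b : ℂ} (hb : b ∈ frontier stripDomain) (hre : 0 < b.re) :
    b ∈ accessiblePts stripDomain := by
  obtain ⟨ζ, hζ, rfl⟩ := mem_image_of_mem_closure (frontier_subset_closure hb) hre
  have hζ' : ζ ∉ openStrip := fun h ↦
    (isOpen_stripDomain.frontier_eq ▸ hb).2 (mem_image_of_mem _ h)
  have hle : |ζ.im| ≤ Real.pi / 2 := hζ
  have him : |ζ.im| = Real.pi / 2 := hle.antisymm (not_lt.1 hζ')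
  have him0 : ζ.im ≠ 0 := abs_pos.1 (him ▸ Real.pi_div_two_pos)
  set γ : ℝ → ℂ := fun t ↦ ζ.re + ((1 - t) * ζ.im : ℝ) * Complex.I with hγ
  have hγim (t : ℝ) : (γ t).im = (1 - t) * ζ.im := by simp [hγ]
  have hγS : MapsTo γ (Icc 0 1) closedStrip := by
    intro t ht
    change |(γ t).im| ≤ _
    rw [hγim, abs_mul, him, abs_of_nonneg (by linarith [ht.2])]
    nlinarith [ht.1, Real.pi_pos]
  refine mem_accessiblePts_of_arc isOpen_stripDomain hb (f := fun t ↦ stripMap (γ t))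
    (continuousOn_stripMap.comp (by fun_prop) hγS) (fun s hs t ht h ↦ ?_) ?_ fun t ht ↦ ?_
  · have := congrArg Complex.im (injOn_stripMap (hγS hs) (hγS ht) h)
    rw [hγim, hγim] at this
    linarith [mul_right_cancel₀ him0 this]
  · simp [hγ]
  · refine mem_image_of_mem _ ?_
    change |(γ t).im| < _
    rw [hγim, abs_mul, him, abs_of_nonneg (by linarith [ht.2])]
    nlinarith [ht.1, Real.pi_pos]

lemma tendsto_stripMap_log :
    Tendsto (fun t : ℝ ↦ stripMap (Real.log t : ℝ)) (𝓝[>] 0) (𝓝 0) := by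
  have h1 : Tendsto (fun t : ℝ ↦ ((Real.log t : ℝ) : ℂ)) (𝓝[>] 0)
      (comap Complex.re atBot ⊓ 𝓟 closedStrip) :=
    tendsto_inf.2 ⟨tendsto_comap_iff.2 Real.tendsto_log_nhdsGT_zero, tendsto_principal.2
      (.of_forall fun t ↦ openStrip_subset_closedStrip (ofReal_mem_openStrip _))⟩
  have h2 := (Complex.continuous_ofReal.tendsto 0).comp (tendsto_stripMap_re.comp h1)
  rw [Complex.ofReal_zero] at h2
  refine h2.congr fun t ↦ Complex.ext ?_ ?_
  · simp
  · simp [stripMap_ofReal_im]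

lemma zero_mem_accessiblePts (h0 : (0 : ℂ) ∈ frontier stripDomain) :
    (0 : ℂ) ∈ accessiblePts stripDomain := by
  set f : ℝ → ℂ := fun t ↦ if t = 0 then 0 else stripMap (Real.log t : ℝ) with hf
  have hf0 : f 0 = 0 := if_pos rfl
  have hft {t : ℝ} (ht : 0 < t) : f t = stripMap (Real.log t : ℝ) := if_neg ht.ne'
  have hS (t : ℝ) : ((Real.log t : ℝ) : ℂ) ∈ openStrip := ofReal_mem_openStrip _
  have hne {t : ℝ} (ht : 0 < t) : f t ≠ 0 := by
    rw [hft ht]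
    exact ne_of_apply_ne Complex.re (stripMap_re_pos (openStrip_subset_closedStrip (hS t))).ne'
  have hpos : ContinuousOn f (Ioi 0) := by
    refine ContinuousOn.congr (f := fun t : ℝ ↦ stripMap (Real.log t : ℝ)) ?_ fun t ht ↦ hft ht
    refine continuousOn_stripMap.comp (fun t ht ↦ ?_)
      fun t _ ↦ openStrip_subset_closedStrip (hS t)
    exact (Complex.continuous_ofReal.continuousAt.comp
      (Real.continuousAt_log (ne_of_gt ht))).continuousWithinAt
  refine mem_accessiblePts_of_arc isOpen_stripDomain h0 (f := f) (fun t ht ↦ ?_) ?_ hf0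
    fun t ht ↦ hft ht.1 ▸ mem_image_of_mem _ (hS t)
  · rcases ht.1.eq_or_lt with rfl | ht0
    · have : ContinuousWithinAt f (Ioi 0) 0 := by
        rw [ContinuousWithinAt, hf0]
        exact tendsto_stripMap_log.congr' (eventually_mem_nhdsWithin.mono fun t ht ↦ (hft ht).symm)
      exact (this.insert).mono fun t ht ↦ ht.1.eq_or_lt.imp Eq.symm id
    · exact (hpos.continuousAt (Ioi_mem_nhds ht0)).continuousWithinAt
  · intro s hs t ht h
    rcases hs.1.eq_or_lt with rfl | hs0 <;> rcases ht.1.eq_or_lt with rfl | ht0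
    · rfl
    · exact absurd (h.symm.trans hf0) (hne ht0)
    · exact absurd (h.trans hf0) (hne hs0)
    · rw [hft hs0, hft ht0] at h
      have := injOn_stripMap (openStrip_subset_closedStrip (hS s))
        (openStrip_subset_closedStrip (hS t)) h
      exact Real.log_injOn_pos hs0 ht0 (Complex.ofReal_injective this)

lemma notMem_accessiblePts {b : ℂ} (hre : b.re = 0) (him : b.im ≠ 0) :
    b ∉ accessiblePts stripDomain := by
  rintro ⟨-, _, ⟨f, hf, hinj, rfl⟩, hcl, hfr⟩
  obtain ⟨⟨t₀, ht₀, hb⟩, -⟩ : b ∈ f '' Icc 0 1 ∩ frontier stripDomain := hfr ▸ rfl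
  have hpos : 0 < |b.im| / 2 := half_pos (abs_pos.2 him)
  obtain ⟨δ, hδ, hδf⟩ := Metric.continuousOn_iff.1 hf t₀ ht₀ _ hpos
  obtain ⟨t₁, ht₁, hne, hdist⟩ : ∃ t₁ ∈ Icc (0 : ℝ) 1, t₁ ≠ t₀ ∧ dist t₁ t₀ < δ := by
    rcases le_total t₀ (1 / 2) with h | h
    · refine ⟨t₀ + min (δ / 2) (1 / 2), ⟨?_, ?_⟩, ?_, ?_⟩
      · have : 0 < min (δ / 2) (1 / 2) := by positivity
        linarith [ht₀.1]
      · linarith [min_le_right (δ / 2) (1 / 2)]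
      · have : 0 < min (δ / 2) (1 / 2) := by positivity
        linarith
      · rw [dist_self_add_left, Real.norm_of_nonneg (by positivity)]
        linarith [min_le_left (δ / 2) (1 / 2)]
    · refine ⟨t₀ - min (δ / 2) (1 / 2), ⟨?_, ?_⟩, ?_, ?_⟩
      · linarith [min_le_right (δ / 2) (1 / 2)]
      · have : 0 < min (δ / 2) (1 / 2) := by positivity
        linarith [ht₀.2]
      · have : 0 < min (δ / 2) (1 / 2) := by positivity
        linarith
      · rw [dist_comm, dist_self_sub_right, Real.norm_of_nonneg (by positivity)]
        linarith [min_le_left (δ / 2) (1 / 2)]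
  have hsub : uIcc t₀ t₁ ⊆ Icc 0 1 := ordConnected_Icc.uIcc_subset ht₀ ht₁
  have hclose : ∀ t ∈ uIcc t₀ t₁, |b.im| / 2 < ‖f t‖ := by
    intro t ht
    have h1 : dist t t₀ ≤ dist t₁ t₀ := abs_sub_left_of_mem_uIcc ht
    have h2 := hδf t (hsub ht) (h1.trans_lt hdist)
    rw [hb, Complex.dist_eq] at h2
    have h3 := Complex.abs_im_le_norm b
    have h4 := norm_sub_norm_le b (f t)
    rw [norm_sub_rev] at h4
    linarith
  have hG₁ : f t₁ ∈ stripDomain := by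
    by_contra h
    have : f t₁ ∈ f '' Icc 0 1 ∩ frontier stripDomain :=
      ⟨mem_image_of_mem _ ht₁, isOpen_stripDomain.frontier_eq ▸ ⟨hcl (mem_image_of_mem _ ht₁), h⟩⟩
    rw [hfr, mem_singleton_iff, ← hb] at this
    exact hne (hinj ht₁ ht₀ this)
  have hg₁ : 0 < ‖halfPlaneMap (f t₁)‖ :=
    norm_pos_iff.2 (ne_of_apply_ne Complex.re (halfPlaneMap_re_pos hG₁).ne')
  have hg₀ : ‖halfPlaneMap (f t₀)‖ = 0 := by rw [hb, halfPlaneMap_eq_zero hre, norm_zero]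
  have hg : ContinuousOn (fun t ↦ ‖halfPlaneMap (f t)‖) (uIcc t₀ t₁) :=
    (continuousOn_halfPlaneMap.comp (hf.mono hsub)
      fun t ht ↦ hcl (mem_image_of_mem _ (hsub ht))).norm
  have hsmall : ∀ᶠ ζ in comap Complex.re atBot ⊓ 𝓟 closedStrip,
      (∃ n : ℕ, ζ.re = -(n : ℝ) - 1 / 2) → ‖stripMap ζ‖ < |b.im| / 2 := by
    have := tendsto_stripMap_of_re_eq.eventually (ball_mem_nhds 0 hpos)
    rw [eventually_inf_principal] at this
    simpa using this
  obtain ⟨x₀, hx₀⟩ := exists_le_imp_of_eventually hsmall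
  obtain ⟨n, hn⟩ := exists_nat_gt (max (-x₀) (-Real.log ‖halfPlaneMap (f t₁)‖))
  have hn1 := (le_max_left _ _).trans_lt hn
  have hn2 := (le_max_right _ _).trans_lt hn
  have hexp : Real.exp (-(n : ℝ) - 1 / 2) ≤ ‖halfPlaneMap (f t₁)‖ := by
    rw [← Real.le_log_iff_exp_le hg₁]
    linarith
  obtain ⟨t, ht, hgt⟩ := intermediate_value_uIcc hg
    (by rw [hg₀, uIcc_of_le hg₁.le]; exact ⟨(Real.exp_pos _).le, hexp⟩)
  have hmem : f t ∈ stripMap '' closedStrip := by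
    by_contra h
    simp only [halfPlaneMap, if_neg h, norm_zero] at hgt
    exact (Real.exp_pos _).ne hgt
  obtain ⟨ζ, hζ, hζt⟩ := hmem
  simp only [← hζt, halfPlaneMap_stripMap hζ, Complex.norm_exp, Real.exp_eq_exp] at hgt
  have h1 := hx₀ ζ hζ (by linarith) ⟨n, hgt⟩
  have h2 := hclose t ht
  rw [← hζt] at h2
  exact lt_asymm h1 h2

lemma I_mem_closure_stripDomain : Complex.I ∈ closure stripDomain := by
  choose ζ hζ hre him using exists_stripMap_im_eq_one
  have h1 : Tendsto ζ atTop (comap Complex.re atBot ⊓ 𝓟 closedStrip) := by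
    refine tendsto_inf.2 ⟨tendsto_comap_iff.2 ?_, tendsto_principal.2 (.of_forall hζ)⟩
    exact (tendsto_neg_atTop_atBot.comp tendsto_natCast_atTop_atTop).congr fun n ↦ (hre n).symm
  have h2 := ((Complex.continuous_ofReal.tendsto 0).comp
    (tendsto_stripMap_re.comp h1)).add_const Complex.I
  rw [Complex.ofReal_zero, zero_add] at h2
  refine isClosed_closure.mem_of_tendsto (h2.congr fun n ↦ ?_)
    (.of_forall fun n ↦ stripMap_mem_closure (hζ n))
  exact Complex.ext (by simp) (by simp [him])

lemma conj_mem_closure_stripDomain {w : ℂ} (hw : w ∈ closure stripDomain) :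
    conj w ∈ closure stripDomain := by
  refine map_mem_closure Complex.continuous_conj hw ?_
  rintro _ ⟨ζ, hζ, rfl⟩
  refine ⟨conj ζ, ?_, stripMap_conj (openStrip_subset_closedStrip hζ)⟩
  simpa [openStrip] using hζ

lemma re_im_of_mem_nonAccessiblePts {w : ℂ} (hw : w ∈ nonAccessiblePts stripDomain) :
    w.re = 0 ∧ w.im ≠ 0 := by
  obtain ⟨hfr, hacc⟩ := hw
  have hre : w.re = 0 :=
    ((re_nonneg_of_mem_closure (frontier_subset_closure hfr)).eq_or_lt.resolve_right
      fun h ↦ hacc (mem_accessiblePts_of_re_pos hfr h)).symm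
  refine ⟨hre, fun him ↦ hacc ?_⟩
  obtain rfl : w = 0 := Complex.ext hre him
  exact zero_mem_accessiblePts hfr

/-- There is a Carathéodory domain whose Riemann map extends continuously
to the closure and whose non-accessible boundary has two distinct components on which the
extension takes the same constant value. -/
theorem exists_caratheodory_same_value_on_two_components :
    ∃ (G : Set ℂ) (φ Φ : ℂ → ℂ),
      IsCaratheodoryDomain G ∧ IsRiemannMap G φ ∧ IsContExtension G φ Φ ∧
      ∃ x y : ℂ, x ∈ nonAccessiblePts G ∧ y ∈ nonAccessiblePts G ∧
        connectedComponentIn (nonAccessiblePts G) x ≠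
          connectedComponentIn (nonAccessiblePts G) y ∧
        ∃ c : ℂ, (∀ z ∈ connectedComponentIn (nonAccessiblePts G) x, Φ z = c) ∧
          (∀ z ∈ connectedComponentIn (nonAccessiblePts G) y, Φ z = c) := by
  have hI : Complex.I ∈ nonAccessiblePts stripDomain :=
    ⟨mem_frontier_of_re_eq_zero I_mem_closure_stripDomain Complex.I_re,
      notMem_accessiblePts Complex.I_re (by simp)⟩
  have hI' : -Complex.I ∈ nonAccessiblePts stripDomain := by
    refine ⟨mem_frontier_of_re_eq_zero ?_ (by simp), notMem_accessiblePts (by simp) (by simp)⟩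
    simpa using conj_mem_closure_stripDomain I_mem_closure_stripDomain
  have hval (x z : ℂ) (hz : z ∈ connectedComponentIn (nonAccessiblePts stripDomain) x) :
      diskMap z = -1 := by
    have := (re_im_of_mem_nonAccessiblePts (connectedComponentIn_subset _ _ hz)).1
    simp [diskMap, halfPlaneMap_eq_zero this]
  refine ⟨stripDomain, diskMap, diskMap, isCaratheodoryDomain_stripDomain, isRiemannMap_diskMap,
    ⟨continuousOn_diskMap, fun _ _ ↦ rfl⟩, Complex.I, -Complex.I, hI, hI', fun h ↦ ?_,
    -1, hval _, hval _⟩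
  obtain ⟨z, hz, hz0⟩ := isPreconnected_connectedComponentIn.intermediate_value
    (h ▸ mem_connectedComponentIn hI') (mem_connectedComponentIn hI)
    Complex.continuous_im.continuousOn (show (0 : ℝ) ∈ Icc _ _ by simp)
  exact (re_im_of_mem_nonAccessiblePts (connectedComponentIn_subset _ _ hz)).2 hz0
end
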